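/- Let ℓ ≠ p be primes, k an algebraic closure of a finite field of characteristic p, and C|k a function field with td(C|k) = 1. Let C^{ℓ,ab} be the maximal abelian pro-ℓ extension of C and G = Gal(C^{ℓ,ab}|C). Then C is a rational function field over k (i.e., C = k(t) for some t ∈ C transcendental over k) if and only if the inertia subgroups in G of the Zariski prime divisors of C|k topologically generate G. -/

import Mathlib

open IntermediateField

/-- Transcendence degree of a ring extension. -/
noncomputable def trdeg (k K : Type*) [CommRing k] [CommRing K] [Algebra k K] : Cardinal :=
  ⨆ s : {s : Set K // AlgebraicIndependent k ((↑) : s → K)}, Cardinal.mk s.1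

/-- The maximal pro-ℓ Galois extension of `K`, inside a fixed algebraic closure: the compositum
of all finite Galois extensions of `K` of `ℓ`-power degree. -/
noncomputable def proL (ℓ : ℕ) (K : Type*) [Field K] :
    IntermediateField K (AlgebraicClosure K) :=
  ⨆ L ∈ {L : IntermediateField K (AlgebraicClosure K) |
      IsGalois K L ∧ ∃ n : ℕ, Module.finrank K L = ℓ ^ n}, L

/-- `G^ℓ_K`, the Galois group of the maximal pro-ℓ extension of `K`,
carrying the Krull topology. -/
noncomputable abbrev GalL (ℓ : ℕ) (K : Type*) [Field K] :=
  ↥(proL ℓ K) ≃ₐ[K] ↥(proL ℓ K)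


/-- The maximal abelian pro-ℓ extension of `K`, inside a fixed algebraic closure: the
compositum of all finite abelian Galois extensions of `K` of `ℓ`-power degree. -/
noncomputable def proLab (ℓ : ℕ) (K : Type*) [Field K] :
    IntermediateField K (AlgebraicClosure K) :=
  ⨆ L ∈ {L : IntermediateField K (AlgebraicClosure K) |
      IsGalois K L ∧ (∃ n : ℕ, Module.finrank K L = ℓ ^ n) ∧
      ∀ a b : (↥L ≃ₐ[K] ↥L), a * b = b * a}, L

/-- `G^{ℓ,ab}_K`, the Galois group of the maximal abelian pro-ℓ extension of `K`. -/
noncomputable abbrev GalLab (ℓ : ℕ) (K : Type*) [Field K] :=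
  ↥(proLab ℓ K) ≃ₐ[K] ↥(proLab ℓ K)

section Valuations

variable {F E : Type*} [Field F] [Field E] [Algebra F E]

private theorem aut_apply_inv_apply (a : E ≃ₐ[F] E) (x : E) : a (a⁻¹ x) = x :=
  a.apply_symm_apply x

/-- The decomposition subgroup of a valuation of `E` in the Galois group of `E|F`:
the stabilizer of the valuation ring. -/
def decompSubgroup (O : ValuationSubring E) : Subgroup (E ≃ₐ[F] E) where
  carrier := {σ | ∀ x : E, σ x ∈ O ↔ x ∈ O}
  one_mem' := by intro x; rfl
  mul_mem' := by
    intro a b ha hb x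
    simpa [AlgEquiv.mul_apply] using (ha (b x)).trans (hb x)
  inv_mem' := by
    intro a ha x
    have h := (ha (a⁻¹ x)).symm
    rwa [aut_apply_inv_apply] at h

/-- The inertia subgroup of a valuation of `E` in the Galois group of `E|F`: the elements of
the decomposition group which act trivially on the residue field. -/
def inertiaSubgroup (O : ValuationSubring E) : Subgroup (E ≃ₐ[F] E) where
  carrier := {σ | (∀ x : E, σ x ∈ O ↔ x ∈ O) ∧
      ∀ x : E, x ∈ O → O.valuation (σ x - x) < 1}
  one_mem' := by
    refine ⟨fun x => Iff.rfl, fun x _ => ?_⟩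
    simp
  mul_mem' := by
    rintro a b ⟨had, hai⟩ ⟨hbd, hbi⟩
    refine ⟨fun x => by simpa [AlgEquiv.mul_apply] using (had (b x)).trans (hbd x), ?_⟩
    intro x hx
    have h1 : O.valuation (a (b x) - b x) < 1 := hai (b x) ((hbd x).mpr hx)
    have h2 : O.valuation (b x - x) < 1 := hbi x hx
    have h3 : (a * b) x - x = (a (b x) - b x) + (b x - x) := by
      rw [AlgEquiv.mul_apply]; ring
    rw [h3]
    exact lt_of_le_of_lt (O.valuation.map_add _ _) (max_lt h1 h2)
  inv_mem' := by
    rintro a ⟨had, hai⟩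
    have hdec : ∀ x : E, a⁻¹ x ∈ O ↔ x ∈ O := by
      intro x
      have h := (had (a⁻¹ x)).symm
      rwa [aut_apply_inv_apply] at h
    refine ⟨hdec, ?_⟩
    intro x hx
    have h1 : O.valuation (a (a⁻¹ x) - a⁻¹ x) < 1 := hai _ ((hdec x).mpr hx)
    rw [aut_apply_inv_apply] at h1
    have h3 : a⁻¹ x - x = -(x - a⁻¹ x) := by ring
    rw [h3, Valuation.map_neg]
    exact h1

end Valuations

section ZPD

variable {k K : Type*} [Field k] [Field K] [Algebra k K]

/-- The canonical map from the base field to the residue field of a valuation subring whose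
ring contains the base field. -/
noncomputable def resMap (O : ValuationSubring K)
    (h : ∀ c : k, algebraMap k K c ∈ O) : k →+* IsLocalRing.ResidueField ↥O :=
  (IsLocalRing.residue ↥O).comp ((algebraMap k K).codRestrict O.toSubring h)

/-- A Zariski prime divisor of `K|k`, given by its valuation ring `O`: a nontrivial valuation
of `K`, trivial on `k`, with value group isomorphic to `ℤ`, whose residue field `Kv` satisfies
`td(Kv|k) = td(K|k) - 1`. -/
structure IsZPD (k : Type*) [Field k] {K : Type*} [Field K] [Algebra k K]
    (O : ValuationSubring K) : Prop where
  trivialBase : ∀ c : k, algebraMap k K c ∈ O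
  nontrivial : O ≠ ⊤
  discrete : Nonempty ((O.ValueGroup)ˣ ≃* Multiplicative ℤ)
  residue_td :
    letI := (resMap O trivialBase).toAlgebra
    trdeg k (IsLocalRing.ResidueField ↥O) + 1 = trdeg k K

end ZPD

open IntermediateField

namespace RatCurve

/-- Standing assumptions: one-dimensional function field. -/
class FF (k C : Type*) [Field k] [Field C] [Algebra k C] : Prop where
  fin : ∀ x : C, Transcendental k x → FiniteDimensional k⟮x⟯ C
  exT : ∃ x : C, Transcendental k x

section A
variable {k C : Type*} [Field k] [Field C] [Algebra k C]

theorem indep_poly {x : C} (hx : x ≠ 0) (R : Subalgebra k C) (hxR : x ∈ R) {ι : Type*} [Fintype ι]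
    (z : ι → C) (hz : ∀ i, z i ∈ R)
    (h : ∀ c : ι → k, (∃ r ∈ R, ∑ i, c i • z i = x * r) → c = 0) (N : ℕ) :
    ∀ p : ι → Polynomial k, (∀ i, (p i).degree < N) →
      ∑ i, Polynomial.aeval x (p i) * z i = 0 → p = 0 := by
  induction N with
  | zero =>
    intro p hp _
    funext i
    have := hp i
    simpa using this
  | succ N ih =>
    intro p hp hs
    have key : ∑ i, (p i).coeff 0 • z i = - (x * ∑ i, Polynomial.aeval x (p i).divX * z i) := by
      rw [eq_neg_iff_add_eq_zero, ← hs, Finset.mul_sum, ← Finset.sum_add_distrib]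
      refine Finset.sum_congr rfl fun i _ => ?_
      conv_rhs => rw [← Polynomial.divX_mul_X_add (p i)]
      simp [Algebra.smul_def]
      ring
    have hc := h (fun i => (p i).coeff 0) ⟨- ∑ i, Polynomial.aeval x (p i).divX * z i, by
      refine neg_mem (sum_mem fun i _ => mul_mem ?_ (hz i))
      exact Polynomial.aeval_mem_adjoin_singleton k x |> fun h =>
        (Algebra.adjoin_le (by simpa using hxR) : Algebra.adjoin k {x} ≤ R) h, by
      rw [key]; ring⟩
    have hc' : ∀ i, (p i).coeff 0 = 0 := fun i => congrFun hc i
    have h0 : ∑ i, Polynomial.aeval x (p i).divX * z i = 0 := by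
      simp only [hc', zero_smul, Finset.sum_const_zero] at key
      have := (neg_eq_zero.mp key.symm)
      exact (mul_eq_zero.mp this).resolve_left hx
    have := ih (fun i => (p i).divX) (fun i => by
      by_cases h0 : p i = 0
      · rw [h0]; simp [Polynomial.divX_zero]
      · have := Polynomial.degree_divX_lt h0
        have h2 := hp i
        have h4 := (Polynomial.natDegree_lt_iff_degree_lt h0).mpr h2
        refine lt_of_lt_of_le this (Polynomial.degree_le_natDegree.trans ?_)
        exact_mod_cast Nat.lt_succ_iff.mp h4) h0
    funext i
    rw [← Polynomial.divX_mul_X_add (p i), hc' i]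
    have h3 : (p i).divX = 0 := congrFun this i
    simp [h3]

open algebraAdjoinAdjoin in
theorem indep_field {x : C} (hx : x ≠ 0) (R : Subalgebra k C) (hxR : x ∈ R) {ι : Type*} [Fintype ι]
    (z : ι → C) (hz : ∀ i, z i ∈ R)
    (h : ∀ c : ι → k, (∃ r ∈ R, ∑ i, c i • z i = x * r) → c = 0) :
    LinearIndependent k⟮x⟯ z := by
  rw [← LinearIndependent.iff_fractionRing (R := Algebra.adjoin k {x}) (K := k⟮x⟯)]
  rw [Fintype.linearIndependent_iff]
  intro g hg
  have hg' : ∀ i, ∃ p : Polynomial k, Polynomial.aeval x p = (g i : C) := by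
    intro i
    have : ∀ y ∈ Algebra.adjoin k {x}, ∃ p : Polynomial k, Polynomial.aeval x p = y := by
      intro y hy
      rw [Algebra.adjoin_singleton_eq_range_aeval] at hy
      exact hy
    exact this _ (g i).2
  choose p hp using hg'
  have := indep_poly hx R hxR z hz h (Finset.univ.sup (fun i => (p i).natDegree) + 1) p
    (fun i => by
      refine lt_of_le_of_lt Polynomial.degree_le_natDegree ?_
      have : (p i).natDegree ≤ _ := Finset.le_sup (f := fun i => (p i).natDegree) (Finset.mem_univ i)
      exact_mod_cast Nat.lt_succ_of_le this)
    (by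
      rw [← hg]
      refine Finset.sum_congr rfl fun i _ => ?_
      rw [hp]; rfl)
  intro i
  apply Subtype.ext
  rw [← hp i, this]; simp

theorem card_le_finrank {x : C} [FiniteDimensional k⟮x⟯ C]
    (hx : x ≠ 0) (R : Subalgebra k C) (hxR : x ∈ R) {ι : Type*} [Fintype ι]
    (z : ι → C) (hz : ∀ i, z i ∈ R)
    (h : ∀ c : ι → k, (∃ r ∈ R, ∑ i, c i • z i = x * r) → c = 0) :
    Fintype.card ι ≤ Module.finrank k⟮x⟯ C :=
  (indep_field hx R hxR z hz h).fintype_card_le_finrank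

/-- The places of `C|k`. -/
def Pl (k C : Type*) [Field k] [Field C] [Algebra k C] :=
  {O : ValuationSubring C // (∀ c : k, algebraMap k C c ∈ O) ∧ O ≠ ⊤}

/-- valuation ring of a place as a subalgebra -/
def Pl.alg (P : Pl k C) : Subalgebra k C where
  __ := P.1.toSubring
  algebraMap_mem' := P.2.1

theorem Pl.mem_alg (P : Pl k C) {x : C} : x ∈ P.alg ↔ x ∈ P.1 := Iff.rfl

theorem transc_of_notMem [IsAlgClosed k] {x : C} (h : x ∉ Set.range (algebraMap k C)) :
    Transcendental k x := by
  intro ha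
  apply h
  have : Algebra.IsIntegral k k⟮x⟯ := by
    have := IntermediateField.isAlgebraic_adjoin_simple (K := k) (x := x) ha.isIntegral
    infer_instance
  obtain ⟨c, hc⟩ := (IsAlgClosed.algebraMap_bijective_of_isIntegral (k := k) (K := k⟮x⟯)).2
    (AdjoinSimple.gen k x)
  exact ⟨c, congrArg Subtype.val hc⟩

theorem mem_range_or_transc [IsAlgClosed k] (x : C) :
    x ∈ Set.range (algebraMap k C) ∨ Transcendental k x := by
  by_cases h : x ∈ Set.range (algebraMap k C)
  · exact Or.inl h
  · exact Or.inr (transc_of_notMem h)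

theorem Pl.const_nonunit (P : Pl k C) {c : k} (h : algebraMap k C c ∈ P.1.nonunits) : c = 0 := by
  by_contra hc
  rw [ValuationSubring.mem_nonunits_iff_exists_mem_maximalIdeal] at h
  obtain ⟨h1, h2⟩ := h
  rw [IsLocalRing.mem_maximalIdeal, mem_nonunits_iff] at h2
  apply h2
  refine IsUnit.of_mul_eq_one ⟨algebraMap k C c⁻¹, P.2.1 _⟩ ?_
  apply Subtype.ext
  simp [hc]

theorem Pl.transc_of_nonunit [IsAlgClosed k] (P : Pl k C) {x : C} (h0 : x ≠ 0)
    (hx : x ∈ P.1.nonunits) : Transcendental k x := by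
  apply transc_of_notMem
  rintro ⟨c, rfl⟩
  have := P.const_nonunit hx
  simp [this] at h0

theorem Pl.exists_nonunit (P : Pl k C) : ∃ t : C, t ≠ 0 ∧ t ∈ P.1.nonunits := by
  have h := P.2.2
  have : ∃ x : C, x ∉ P.1 := by
    by_contra hh; push Not at hh
    exact h (eq_top_iff.mpr fun x _ => hh x)
  obtain ⟨x, hx⟩ := this
  refine ⟨x⁻¹, ?_, ?_⟩
  · rintro h; rw [inv_eq_zero] at h; exact hx (h ▸ P.1.zero_mem)
  · rw [ValuationSubring.mem_nonunits_iff, map_inv₀]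
    rw [← P.1.valuation_le_one_iff, not_le] at hx
    exact inv_lt_one_of_one_lt₀ hx

variable [FF k C] [IsAlgClosed k]

theorem Pl.finite_quot (P : Pl k C) {t : P.1} (h0 : t ≠ 0) (ht : (t : C) ∈ P.1.nonunits) (n : ℕ)
    (z : Fin n → C) (hz : ∀ i, z i ∈ P.1)
    (h : ∀ c : Fin n → k, (∃ r ∈ P.1, ∑ i, c i • z i = t * r) → c = 0) :
    n ≤ Module.finrank k⟮(t : C)⟯ C := by
  have h0' : (t : C) ≠ 0 := by simpa using h0
  have := FF.fin (t : C) (P.transc_of_nonunit h0' ht)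
  simpa using card_le_finrank h0' P.alg t.2 z hz h

theorem Pl.exists_residue (P : Pl k C) {x : C} (hx : x ∈ P.1) :
    ∃ c : k, x - algebraMap k C c ∈ P.1.nonunits := by
  obtain ⟨t, h0, ht⟩ := P.exists_nonunit
  have htO : t ∈ P.1 := P.1.nonunits_subset ht
  set n := Module.finrank k⟮t⟯ C
  by_contra hcon; push Not at hcon
  have : ∃ c : Fin (n+1) → k, (∃ r ∈ P.1, ∑ i, c i • x ^ (i : ℕ) = t * r) ∧ c ≠ 0 := by
    by_contra hh; push Not at hh
    have := P.finite_quot (t := ⟨t, htO⟩) (by simpa [Subtype.ext_iff] using h0) ht (n+1)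
      (fun i => x ^ (i : ℕ)) (fun i => pow_mem hx _) (by
        rintro c ⟨r, hr, h⟩; exact hh c ⟨r, hr, h⟩)
    exact absurd this (by simp [n])
  obtain ⟨c, ⟨r, hr, hc⟩, hc0⟩ := this
  let p : Polynomial k := ∑ i : Fin (n+1), Polynomial.monomial (i : ℕ) (c i)
  have hp0 : p ≠ 0 := by
    intro hp
    apply hc0
    funext i
    have := congrArg (fun q => Polynomial.coeff q (i : ℕ)) hp
    simpa [p, Polynomial.finsetSum_coeff, Polynomial.coeff_monomial, Fin.val_inj] using this
  have hpx : Polynomial.aeval x p = t * r := by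
    rw [← hc]; simp [p, Algebra.smul_def, Polynomial.aeval_monomial]
  have hsp := (IsAlgClosed.splits p).eq_prod_roots
  have hlt : P.1.valuation (Polynomial.aeval x p) < 1 := by
    rw [hpx, map_mul]
    have h1 : P.1.valuation t < 1 := ht
    have h2 : P.1.valuation r ≤ 1 := (P.1.valuation_le_one_iff r).mpr hr
    exact mul_lt_one_of_lt_of_le h1 h2
  have hval : ∀ m : Multiset k, P.1.valuation (Polynomial.aeval x
      (m.map fun a => Polynomial.X - Polynomial.C a).prod) = 1 := by
    intro m
    induction m using Multiset.induction with
    | empty => simp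
    | cons a m ih =>
      simp only [Multiset.map_cons, Multiset.prod_cons, map_mul, ih, mul_one]
      have h1 := hcon a
      rw [ValuationSubring.mem_nonunits_iff, not_lt] at h1
      have h2 := (P.1.valuation_le_one_iff _).mpr (sub_mem hx (P.2.1 a))
      simpa using le_antisymm h2 h1
  rw [hsp, map_mul, map_mul, hval, mul_one, Polynomial.aeval_C] at hlt
  have := P.const_nonunit hlt
  exact hp0 (by simpa using this)

theorem Pl.isDVR (P : Pl k C) : IsDiscreteValuationRing P.1 := by
  have hnoeth : IsNoetherianRing P.1 := by
    rw [isNoetherianRing_iff_ideal_fg]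
    intro I
    by_cases hI : I = ⊥
    · rw [hI]; exact Submodule.fg_bot
    obtain ⟨t, htI, ht0⟩ := Submodule.exists_mem_ne_zero_of_ne_bot hI
    by_cases htu : IsUnit t
    · rw [Ideal.eq_top_of_isUnit_mem I htI htu]; exact ⟨{1}, by simp⟩
    have htn : (t : C) ∈ P.1.nonunits := by
      rw [ValuationSubring.mem_nonunits_iff_exists_mem_maximalIdeal]
      exact ⟨t.2, htu⟩
    let _ : Algebra k P.1 := inferInstanceAs (Algebra k P.alg)
    have hfin : Module.Finite k (P.1 ⧸ Ideal.span {t}) := by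
      rw [← Module.rank_lt_aleph0_iff]
      refine lt_of_le_of_lt (rank_le (n := Module.finrank k⟮(t : C)⟯ C) ?_) (Cardinal.natCast_lt_aleph0)
      intro s hs
      choose z hz using (Ideal.Quotient.mk_surjective (I := Ideal.span {t}))
      let e := s.equivFin
      refine P.finite_quot ht0 htn s.card (fun i => (z (e.symm i) : C)) (fun i => (z _).2) ?_
      rintro c ⟨r, hr, h⟩
      rw [Fintype.linearIndependent_iff] at hs
      have h1 : ∑ i, c i • z (e.symm i) = t * ⟨r, hr⟩ := by
        apply Subtype.ext
        rw [MulMemClass.coe_mul, ← h]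
        rw [AddSubmonoidClass.coe_finsetSum]
        rfl
      have h2 := congrArg (Ideal.Quotient.mk (Ideal.span {t})) h1
      rw [map_sum, map_mul, Ideal.Quotient.eq_zero_iff_mem.mpr (Ideal.mem_span_singleton_self t), zero_mul] at h2
      have h3 := hs (fun i => c (e i)) (by
        rw [← h2, ← e.symm.sum_comp]
        refine Finset.sum_congr rfl fun i _ => ?_
        rw [e.apply_symm_apply]
        conv_lhs => rw [← hz (e.symm i : P.1 ⧸ Ideal.span {t})]
        rfl)
      funext i
      simpa using h3 (e.symm i)
    have : IsNoetherian P.1 (P.1 ⧸ Ideal.span {t}) := isNoetherian_of_tower k inferInstance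
    refine Submodule.fg_of_fg_map_of_fg_inf_ker (Ideal.span {t}).mkQ (IsNoetherian.noetherian _) ?_
    rw [Submodule.ker_mkQ, inf_eq_right.mpr]
    · exact ⟨{t}, by simp⟩
    · rwa [Ideal.span_singleton_le_iff_mem]
  have hnf : ¬ IsField P.1 := by
    intro hf
    obtain ⟨t, h0, ht⟩ := P.exists_nonunit
    rw [ValuationSubring.mem_nonunits_iff_exists_mem_maximalIdeal] at ht
    obtain ⟨h1, h2⟩ := ht
    obtain ⟨u, hu⟩ := hf.mul_inv_cancel (a := ⟨t, h1⟩) (by simpa [Subtype.ext_iff] using h0)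
    exact h2 (IsUnit.of_mul_eq_one u hu)
  exact ((IsDiscreteValuationRing.TFAE P.1 hnf).out 0 1).mpr (inferInstance : ValuationRing P.1)

theorem Pl.exists_ord (P : Pl k C) : ∃ v : C → ℤ,
    (∀ x y, x ≠ 0 → y ≠ 0 → v (x * y) = v x + v y) ∧
    (∀ x, x ≠ 0 → (x ∈ P.1 ↔ 0 ≤ v x)) ∧ ∃ π, π ≠ 0 ∧ v π = 1 := by
  have := P.isDVR
  obtain ⟨π, hπ⟩ := IsDiscreteValuationRing.exists_irreducible P.1
  have hπ0 : (π : C) ≠ 0 := by simpa using hπ.ne_zero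
  have hval : P.1.valuation (π : C) < 1 := by
    rw [← ValuationSubring.mem_nonunits_iff,
      ValuationSubring.mem_nonunits_iff_exists_mem_maximalIdeal]
    exact ⟨π.2, hπ.not_isUnit⟩
  have ex : ∀ x : C, x ≠ 0 → ∃ n : ℤ, P.1.valuation x = P.1.valuation (π : C) ^ n := by
    have ex1 : ∀ x : C, x ≠ 0 → x ∈ P.1 → ∃ n : ℕ, P.1.valuation x = P.1.valuation (π : C) ^ n := by
      intro x hx hxO
      obtain ⟨n, hn⟩ := IsDiscreteValuationRing.associated_pow_irreducible
        (x := (⟨x, hxO⟩ : P.1)) (by simpa [Subtype.ext_iff] using hx) hπ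
      obtain ⟨u, hu⟩ := hn
      refine ⟨n, ?_⟩
      have h1 : x * ((u : P.1) : C) = (π : C) ^ n := by
        simpa using congrArg Subtype.val hu
      rw [← map_pow, ← h1, map_mul, (P.1.valuation_eq_one_iff u.1).mp u.isUnit, mul_one]
    intro x hx
    rcases P.1.mem_or_inv_mem x with h | h
    · obtain ⟨n, hn⟩ := ex1 x hx h
      exact ⟨n, by simpa using hn⟩
    · obtain ⟨n, hn⟩ := ex1 _ (inv_ne_zero hx) h
      refine ⟨-n, ?_⟩
      rw [map_inv₀] at hn
      rw [zpow_neg, zpow_natCast, ← hn, inv_inv]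
  have hpos : 0 < P.1.valuation (π : C) := zero_lt_iff.mpr ((Valuation.ne_zero_iff _).mpr hπ0)
  have inj : ∀ m n : ℤ, P.1.valuation (π : C) ^ m = P.1.valuation (π : C) ^ n → m = n := by
    intro m n h
    exact (zpow_right_strictAnti₀ hpos hval).injective h
  classical
  choose! v hv using ex
  refine ⟨v, ?_, ?_, (π : C), hπ0, ?_⟩
  · intro x y hx hy
    apply inj
    rw [← hv _ (mul_ne_zero hx hy), map_mul, hv x hx, hv y hy, zpow_add₀ hpos.ne']
  · intro x hx
    rw [← P.1.valuation_le_one_iff, hv x hx]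
    constructor
    · intro h
      by_contra hn
      exact absurd h (not_le.mpr (one_lt_zpow_of_neg₀ hpos hval (not_le.mp hn)))
    · intro h
      obtain ⟨n, hn⟩ := Int.eq_ofNat_of_zero_le h
      rw [hn, zpow_natCast]
      exact pow_le_one₀ hpos.le hval.le
  · apply inj
    rw [← hv _ hπ0, zpow_one]

end A
end RatCurve

open IntermediateField

namespace RatCurve

section B
variable {k C : Type*} [Field k] [Field C] [Algebra k C] [FF k C] [IsAlgClosed k]

/-- normalised order function at a place -/
noncomputable def ord (P : Pl k C) : C → ℤ := Classical.choose P.exists_ord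

theorem ord_mul (P : Pl k C) {x y : C} (hx : x ≠ 0) (hy : y ≠ 0) :
    ord P (x * y) = ord P x + ord P y := (Classical.choose_spec P.exists_ord).1 x y hx hy

theorem mem_iff_ord (P : Pl k C) {x : C} (hx : x ≠ 0) : x ∈ P.1 ↔ 0 ≤ ord P x :=
  (Classical.choose_spec P.exists_ord).2.1 x hx

theorem exists_unif (P : Pl k C) : ∃ π : C, π ≠ 0 ∧ ord P π = 1 :=
  (Classical.choose_spec P.exists_ord).2.2

theorem ord_one (P : Pl k C) : ord P (1 : C) = 0 := by
  have := ord_mul P (one_ne_zero (α := C)) one_ne_zero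
  rw [mul_one] at this; omega

theorem ord_inv (P : Pl k C) {x : C} (hx : x ≠ 0) : ord P x⁻¹ = - ord P x := by
  have := ord_mul P hx (inv_ne_zero hx)
  rw [mul_inv_cancel₀ hx, ord_one] at this; omega

theorem ord_pow (P : Pl k C) {x : C} (hx : x ≠ 0) (n : ℕ) : ord P (x ^ n) = n * ord P x := by
  induction n with
  | zero => simp [ord_one]
  | succ n ih => rw [pow_succ, ord_mul P (pow_ne_zero n hx) hx, ih]; push_cast; ring

theorem ord_zpow (P : Pl k C) {x : C} (hx : x ≠ 0) (n : ℤ) : ord P (x ^ n) = n * ord P x := by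
  cases n with
  | ofNat n => simpa using ord_pow P hx n
  | negSucc n =>
    rw [zpow_negSucc, ord_inv P (pow_ne_zero _ hx), ord_pow P hx, Int.negSucc_eq]; push_cast; ring

theorem ord_const (P : Pl k C) {c : k} (hc : c ≠ 0) : ord P (algebraMap k C c) = 0 := by
  have h1 : algebraMap k C c ≠ 0 := by simpa using hc
  have h2 : algebraMap k C c⁻¹ ≠ 0 := by simpa using hc
  have := ord_mul P h1 h2
  rw [← map_mul, mul_inv_cancel₀ hc, map_one, ord_one] at this
  have h3 := (mem_iff_ord P h1).mp (P.2.1 _)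
  have h4 := (mem_iff_ord P h2).mp (P.2.1 _)
  omega

theorem ord_unique (P : Pl k C) (v : C → ℤ)
    (h1 : ∀ x y, x ≠ 0 → y ≠ 0 → v (x * y) = v x + v y)
    (h2 : ∀ x, x ≠ 0 → (x ∈ P.1 ↔ 0 ≤ v x)) (h3 : ∃ π, π ≠ 0 ∧ v π = 1)
    {x : C} (hx : x ≠ 0) : v x = ord P x := by
  have hv1 : v 1 = 0 := by
    have := h1 1 1 one_ne_zero one_ne_zero
    rw [mul_one] at this; omega
  have hvinv : ∀ y, y ≠ 0 → v y⁻¹ = - v y := by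
    intro y hy
    have := h1 y y⁻¹ hy (inv_ne_zero hy)
    rw [mul_inv_cancel₀ hy, hv1] at this; omega
  have hz : ∀ y, y ≠ 0 → (v y = 0 ↔ ord P y = 0) := by
    intro y hy
    have a1 := h2 y hy
    have a2 := h2 _ (inv_ne_zero hy)
    rw [mem_iff_ord P hy] at a1
    rw [mem_iff_ord P (inv_ne_zero hy), hvinv y hy, ord_inv P hy] at a2
    constructor <;> intro h <;> omega
  have hpow : ∀ y, y ≠ 0 → ∀ n : ℕ, v (y ^ n) = n * v y := by
    intro y hy n
    induction n with
    | zero => simp [hv1]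
    | succ n ih => rw [pow_succ, h1 _ _ (pow_ne_zero n hy) hy, ih]; push_cast; ring
  have hzpow : ∀ y, y ≠ 0 → ∀ n : ℤ, v (y ^ n) = n * v y := by
    intro y hy n
    cases n with
    | ofNat n => simpa using hpow y hy n
    | negSucc n =>
      rw [zpow_negSucc, hvinv _ (pow_ne_zero _ hy), hpow y hy, Int.negSucc_eq]; push_cast; ring
  obtain ⟨π, hπ0, hπ⟩ := h3
  obtain ⟨ϖ, hϖ0, hϖ⟩ := exists_unif P
  -- ϖ = π ^ (v ϖ) * unit
  have e : ∀ y, y ≠ 0 → ord P y = v y * ord P π := by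
    intro y hy
    have : v (y * π ^ (- v y)) = 0 := by
      rw [h1 _ _ hy (zpow_ne_zero _ hπ0), hzpow π hπ0, hπ]; ring
    rw [hz _ (mul_ne_zero hy (zpow_ne_zero _ hπ0)), ord_mul P hy (zpow_ne_zero _ hπ0),
      ord_zpow P hπ0] at this
    linarith
  have e1 := e ϖ hϖ0
  rw [hϖ] at e1
  have hpos : 0 ≤ ord P π := by
    rw [← mem_iff_ord P hπ0, h2 π hπ0, hπ]; norm_num
  have : ord P π = 1 := by
    have := Int.eq_one_or_neg_one_of_mul_eq_one (u := ord P π) (v := v ϖ) (by rw [mul_comm]; exact e1.symm)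
    omega
  have e2 := e x hx
  rw [this, mul_one] at e2
  exact e2.symm

theorem mem_M_aux (P : Pl k C) {π : C} (h0 : π ≠ 0) (hπ : ord P π = 1) (n : ℤ) (x : C) :
    (x = 0 ∨ n ≤ ord P x) ↔ x * π ^ (-n) ∈ P.1 := by
  by_cases hx : x = 0
  · simp [hx, P.1.zero_mem]
  · rw [mem_iff_ord P (mul_ne_zero hx (zpow_ne_zero _ h0)), ord_mul P hx (zpow_ne_zero _ h0),
      ord_zpow P h0, hπ]
    simp only [hx, false_or]
    constructor <;> intro h <;> linarith

/-- elements of order at least `n` -/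
noncomputable def M (P : Pl k C) (n : ℤ) : Submodule k C where
  carrier := {x | x = 0 ∨ n ≤ ord P x}
  zero_mem' := Or.inl rfl
  add_mem' := by
    obtain ⟨π, h0, hπ⟩ := exists_unif P
    intro x y hx hy
    simp only [Set.mem_ofPred_eq, mem_M_aux P h0 hπ] at *
    rw [add_mul]; exact add_mem hx hy
  smul_mem' := by
    obtain ⟨π, h0, hπ⟩ := exists_unif P
    intro c x hx
    simp only [Set.mem_ofPred_eq, mem_M_aux P h0 hπ] at *
    rw [Algebra.smul_def, mul_assoc]
    exact mul_mem (P.2.1 c) hx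

theorem mem_M {P : Pl k C} {n : ℤ} {x : C} : x ∈ M P n ↔ x = 0 ∨ n ≤ ord P x := Iff.rfl

theorem mem_M' {P : Pl k C} {n : ℤ} {x : C} (hx : x ≠ 0) : x ∈ M P n ↔ n ≤ ord P x := by
  simp [mem_M, hx]

theorem mem_M_ord (P : Pl k C) (x : C) : x ∈ M P (ord P x) := Or.inr le_rfl

theorem M_anti {P : Pl k C} {m n : ℤ} (h : m ≤ n) : M P n ≤ M P m := by
  intro x hx
  rcases hx with h0 | h0
  · exact Or.inl h0
  · exact Or.inr (h.trans h0)

theorem mul_mem_M {P : Pl k C} {m n : ℤ} {x y : C} (hx : x ∈ M P m) (hy : y ∈ M P n) :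
    x * y ∈ M P (m + n) := by
  by_cases hx0 : x = 0
  · simp [hx0]
  by_cases hy0 : y = 0
  · simp [hy0]
  rw [mem_M' hx0] at hx
  rw [mem_M' hy0] at hy
  rw [mem_M' (mul_ne_zero hx0 hy0), ord_mul P hx0 hy0]; omega

theorem mem_M_zero {P : Pl k C} {x : C} : x ∈ M P 0 ↔ x ∈ P.1 := by
  by_cases hx : x = 0
  · simp [hx, P.1.zero_mem]
  · rw [mem_M' hx, mem_iff_ord P hx]

theorem one_mem_M (P : Pl k C) : (1 : C) ∈ M P 0 := mem_M_zero.mpr P.1.one_mem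

theorem pow_mem_M {P : Pl k C} {x : C} {m : ℤ} (hx : x ∈ M P m) (n : ℕ) : x ^ n ∈ M P (n * m) := by
  induction n with
  | zero => simpa using one_mem_M P
  | succ n ih =>
    rw [pow_succ]
    have := mul_mem_M ih hx
    convert this using 2
    push_cast; ring

theorem ord_add_of_lt {P : Pl k C} {x y : C} (hx : x ≠ 0) (hy : y ∈ M P (ord P x + 1)) :
    x + y ≠ 0 ∧ ord P (x + y) = ord P x := by
  have h1 : x + y ∈ M P (ord P x) :=
    add_mem (mem_M_ord P x) (M_anti (by omega) hy)
  have h2 : x + y ∉ M P (ord P x + 1) := by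
    intro h
    have := sub_mem h hy
    rw [add_sub_cancel_right, mem_M' hx] at this
    omega
  have h0 : x + y ≠ 0 := fun h => h2 (by rw [h]; exact zero_mem _)
  refine ⟨h0, ?_⟩
  rw [mem_M' h0] at h1 h2
  omega

theorem mem_nonunits {P : Pl k C} {x : C} : x ∈ P.1.nonunits ↔ x ∈ M P 1 := by
  by_cases hx : x = 0
  · simp [hx, ValuationSubring.mem_nonunits_iff]
  · have := mem_iff_ord P (inv_ne_zero hx)
    rw [ord_inv P hx, ← P.1.valuation_le_one_iff, map_inv₀] at this
    rw [mem_M' hx, ValuationSubring.mem_nonunits_iff]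
    have h0 : 0 < P.1.valuation x := zero_lt_iff.mpr ((Valuation.ne_zero_iff _).mpr hx)
    rw [inv_le_one₀ h0] at this
    rw [← not_le, this]; omega

theorem exists_coeff {P : Pl k C} {t x : C} (ht : t ≠ 0) (hx : x ∈ M P (ord P t)) :
    ∃ c : k, x - c • t ∈ M P (ord P t + 1) := by
  have h1 : x * t⁻¹ ∈ M P 0 := by
    have := mul_mem_M hx (mem_M_ord P t⁻¹)
    rwa [ord_inv P ht, add_neg_cancel] at this
  obtain ⟨c, hc⟩ := P.exists_residue (mem_M_zero.mp h1)
  refine ⟨c, ?_⟩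
  rw [mem_nonunits] at hc
  have := mul_mem_M hc (mem_M_ord P t)
  rw [sub_mul, inv_mul_cancel_right₀ ht, add_comm] at this
  rwa [Algebra.smul_def]

theorem coeff_zero {P : Pl k C} {t : C} (ht : t ≠ 0) {c : k} (h : c • t ∈ M P (ord P t + 1)) :
    c = 0 := by
  by_contra hc
  have h0 : algebraMap k C c ≠ 0 := by simpa using hc
  rw [Algebra.smul_def, mem_M' (mul_ne_zero h0 ht), ord_mul P h0 ht, ord_const P hc] at h
  omega

theorem eq_of_le {P Q : Pl k C} (h : ∀ x, x ∈ P.1 → x ∈ Q.1) : P = Q := by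
  apply Subtype.ext
  refine le_antisymm h ?_
  intro x hx
  by_contra hxP
  apply Q.2.2
  refine eq_top_iff.mpr fun y _ => ?_
  have hx0 : x ≠ 0 := by rintro rfl; exact hxP P.1.zero_mem
  by_cases hy : y = 0
  · rw [hy]; exact Q.1.zero_mem
  rw [mem_iff_ord P hx0, not_le] at hxP
  have h1 : y * (x⁻¹) ^ (ord P y).natAbs ∈ P.1 := by
    rw [mem_iff_ord P (mul_ne_zero hy (pow_ne_zero _ (inv_ne_zero hx0))),
      ord_mul P hy (pow_ne_zero _ (inv_ne_zero hx0)), ord_pow P (inv_ne_zero hx0), ord_inv P hx0]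
    have h2 : (1 : ℤ) ≤ - ord P x := by omega
    have h3 := le_mul_of_one_le_right (Int.natCast_nonneg (ord P y).natAbs) h2
    omega
  have h4 := mul_mem (h _ h1) (pow_mem hx (ord P y).natAbs)
  rwa [mul_assoc, ← mul_pow, inv_mul_cancel₀ hx0, one_pow, mul_one] at h4

theorem approx1 {P Q : Pl k C} (h : P ≠ Q) : ∃ f : C, f ≠ 0 ∧ 0 < ord P f ∧ ord Q f < 0 := by
  have h1 : ∃ a, a ∈ P.1 ∧ a ∉ Q.1 := by
    by_contra hh; push Not at hh; exact h (eq_of_le hh)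
  have h2 : ∃ a, a ∈ Q.1 ∧ a ∉ P.1 := by
    by_contra hh; push Not at hh; exact h (eq_of_le hh).symm
  obtain ⟨a, ha, ha'⟩ := h1
  obtain ⟨b, hb, hb'⟩ := h2
  have ha0 : a ≠ 0 := by rintro rfl; exact ha' Q.1.zero_mem
  have hb0 : b ≠ 0 := by rintro rfl; exact hb' P.1.zero_mem
  rw [mem_iff_ord _ ha0] at ha ha'
  rw [mem_iff_ord _ hb0] at hb hb'
  refine ⟨a * b⁻¹, mul_ne_zero ha0 (inv_ne_zero hb0), ?_, ?_⟩ <;>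
  rw [ord_mul _ ha0 (inv_ne_zero hb0), ord_inv _ hb0] <;> omega

theorem approx2 (P : Pl k C) (S : Finset (Pl k C)) (hS : P ∉ S) :
    ∃ f : C, f ≠ 0 ∧ 0 < ord P f ∧ ∀ Q ∈ S, ord Q f < 0 := by
  classical
  induction S using Finset.induction with
  | empty =>
    obtain ⟨π, h0, h⟩ := exists_unif P
    exact ⟨π, h0, by omega, by simp⟩
  | insert Q S hQ ih =>
    simp only [Finset.mem_insert, not_or] at hS
    obtain ⟨f, hf0, hfP, hfS⟩ := ih hS.2
    by_cases hfQ : ord Q f < 0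
    · refine ⟨f, hf0, hfP, ?_⟩
      intro R hR
      rcases Finset.mem_insert.mp hR with rfl | h
      · exact hfQ
      · exact hfS R h
    obtain ⟨g, hg0, hgP, hgQ⟩ := approx1 hS.1
    set m : ℕ := ∑ R ∈ S, (ord R f).natAbs + 1 with hm
    have hgm := pow_ne_zero m hg0
    have key : ∀ R : Pl k C, ord R f ≠ ord R (g ^ m) →
        f + g ^ m ≠ 0 ∧ ord R (f + g ^ m) = min (ord R f) (ord R (g ^ m)) := by
      intro R hne
      rcases lt_or_gt_of_ne hne with h | h
      · rw [min_eq_left h.le]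
        exact ord_add_of_lt hf0 ((mem_M' hgm).mpr (by omega))
      · rw [min_eq_right h.le, add_comm]
        exact ord_add_of_lt hgm ((mem_M' hf0).mpr (by omega))
    have hQm : ord Q (g ^ m) < 0 := by
      rw [ord_pow Q hg0]
      exact mul_neg_of_pos_of_neg (by omega) hgQ
    have hQ' := key Q (by omega)
    refine ⟨f + g ^ m, hQ'.1, ?_, ?_⟩
    · have : f + g ^ m ∈ M P 1 := by
        refine add_mem ((mem_M' hf0).mpr (by omega)) ((mem_M' hgm).mpr ?_)
        rw [ord_pow P hg0]
        have h1 : (1 : ℤ) ≤ m := by omega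
        nlinarith
      rw [mem_M' hQ'.1] at this; omega
    · intro R hR
      rcases Finset.mem_insert.mp hR with rfl | h
      · rw [hQ'.2]; exact min_lt_of_right_lt hQm
      · have h1 := hfS R h
        have h2 : (ord R f).natAbs ≤ ∑ R ∈ S, (ord R f).natAbs :=
          Finset.single_le_sum (f := fun R => (ord R f).natAbs) (fun _ _ => Nat.zero_le _) h
        have hne : ord R f ≠ ord R (g ^ m) := by
          rw [ord_pow R hg0]
          intro he
          have h5 : (ord R f).natAbs = m * (ord R g).natAbs := by
            rw [he, Int.natAbs_mul, Int.natAbs_natCast]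
          have h6 : (ord R g).natAbs ≠ 0 := by
            intro h7; rw [h7] at h5; omega
          have h8 : m ≤ m * (ord R g).natAbs := Nat.le_mul_of_pos_right m (by omega)
          omega
        rw [(key R hne).2]; exact min_lt_of_left_lt h1

theorem approx3 (P : Pl k C) (S : Finset (Pl k C)) (hS : P ∉ S) (N : ℕ) :
    ∃ u : C, u - 1 ∈ M P N ∧ ∀ Q ∈ S, u ∈ M Q N := by
  obtain ⟨f, hf0, hfP, hfS⟩ := approx2 P S hS
  have hfN : ∀ Q : Pl k C, ord Q (f ^ (N+1)) = (N+1 : ℕ) * ord Q f := fun Q => ord_pow Q hf0 _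
  have hp0 := pow_ne_zero (N+1) hf0
  have hP : (N : ℤ) + 1 ≤ ord P (f ^ (N+1)) := by
    rw [hfN]; push_cast; nlinarith
  have h1 : (1 : C) + f ^ (N+1) ≠ 0 ∧ ord P (1 + f ^ (N+1)) = ord P (1 : C) :=
    ord_add_of_lt one_ne_zero ((mem_M' hp0).mpr (by rw [ord_one]; omega))
  rw [ord_one] at h1
  refine ⟨(1 + f ^ (N+1))⁻¹, ?_, ?_⟩
  · have e : (1 + f ^ (N+1))⁻¹ - 1 = -(f ^ (N+1) * (1 + f ^ (N+1))⁻¹) := by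
      have := h1.1
      field_simp; ring
    rw [e]
    refine neg_mem ?_
    rw [mem_M' (mul_ne_zero hp0 (inv_ne_zero h1.1)), ord_mul P hp0 (inv_ne_zero h1.1),
      ord_inv P h1.1]; omega
  · intro Q hQ
    have h2 := hfS Q hQ
    have hQ : ord Q (f ^ (N+1)) ≤ - (N + 1) := by
      rw [hfN]; push_cast; nlinarith
    have h3 := ord_add_of_lt (P := Q) hp0 (y := 1) ((mem_M' one_ne_zero).mpr (by rw [ord_one]; omega))
    rw [mem_M' (inv_ne_zero h1.1), ord_inv Q h1.1, add_comm, h3.2]; omega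

theorem approx (P : Pl k C) (S : Finset (Pl k C)) (hS : P ∉ S) (y : C) (n : ℤ) :
    ∃ z : C, z - y ∈ M P n ∧ ∀ Q ∈ S, z ∈ M Q n := by
  obtain ⟨u, hu1, hu2⟩ := approx3 P S hS
    ((n - ord P y).natAbs + ∑ Q ∈ S, (n - ord Q y).natAbs)
  refine ⟨u * y, ?_, ?_⟩
  · have := mul_mem_M hu1 (mem_M_ord P y)
    rw [sub_mul, one_mul] at this
    refine M_anti ?_ this
    push_cast
    have : (0:ℤ) ≤ ∑ Q ∈ S, |n - ord Q y| := Finset.sum_nonneg fun _ _ => abs_nonneg _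
    have := le_abs_self (n - ord P y)
    omega
  · intro Q hQ
    refine M_anti ?_ (mul_mem_M (hu2 Q hQ) (mem_M_ord Q y))
    have h2 : (n - ord Q y).natAbs ≤ ∑ R ∈ S, (n - ord R y).natAbs :=
          Finset.single_le_sum (f := fun R => (n - ord R y).natAbs) (fun _ _ => Nat.zero_le _) hQ
    omega

theorem local_indep (P : Pl k C) {π : C} (h0 : π ≠ 0) (hπ : ord P π = 1) (e : ℕ) (c : Fin e → k)
    (h : ∑ a, c a • π ^ (a : ℕ) ∈ M P e) : c = 0 := by
  have hpow : ∀ n : ℕ, ord P (π ^ n) = n := fun n => by rw [ord_pow P h0, hπ, mul_one]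
  have : ∀ n : ℕ, ∀ a : Fin e, (a : ℕ) = n → c a = 0 := by
    intro n
    induction n using Nat.strong_induction_on with
    | _ n ih =>
      intro a ha
      have h1 : ∑ b ∈ Finset.univ.erase a, c b • π ^ (b : ℕ) ∈ M P (n + 1) := by
        refine sum_mem fun b hb => ?_
        have hba : (b : ℕ) ≠ a := by
          simpa [Fin.ext_iff] using (Finset.mem_erase.mp hb).1
        rcases lt_or_gt_of_ne hba with hlt | hgt
        · rw [ih b (by omega) b rfl, zero_smul]; exact zero_mem _
        · refine Submodule.smul_mem _ _ ((mem_M' (pow_ne_zero _ h0)).mpr ?_)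
          rw [hpow]; omega
      have h2 : c a • π ^ (a : ℕ) ∈ M P (n + 1) := by
        have h3 : ∑ a, c a • π ^ (a : ℕ) ∈ M P (n + 1) := M_anti (by have := a.2; omega) h
        rw [← Finset.add_sum_erase _ _ (Finset.mem_univ a)] at h3
        simpa using sub_mem h3 h1
      refine coeff_zero (P := P) (pow_ne_zero _ h0) (t := π ^ (a : ℕ)) ?_
      rw [hpow, ha]; rw [ha] at h2; exact h2
  funext a
  exact this _ a rfl

theorem transc_ne_zero {x : C} (hx : Transcendental k x) : x ≠ 0 := by
  rintro rfl; exact hx isAlgebraic_zero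

theorem deg_bound_aux {x : C} (hx : Transcendental k x) (S : Finset (Pl k C))
    (hS : ∀ P ∈ S, 0 < ord P x) :
    ∑ P ∈ S, (ord P x).toNat ≤ Module.finrank k⟮x⟯ C := by
  classical
  have := FF.fin x hx
  have hx0 : x ≠ 0 := transc_ne_zero hx
  set e : Pl k C → ℕ := fun P => (ord P x).toNat with he
  have heP : ∀ P ∈ S, (e P : ℤ) = ord P x := fun P hP => by
    have := hS P hP
    simp only [he]; omega
  choose π hπ0 hπ using fun P : Pl k C => exists_unif P
  let N : ℕ := ∑ P ∈ S, e P
  have hN : ∀ P ∈ S, e P ≤ N := fun P hP =>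
    Finset.single_le_sum (f := e) (fun _ _ => Nat.zero_le _) hP
  choose z hz1 hz2 using fun (P : Pl k C) (a : ℕ) =>
    approx P (S.erase P) (Finset.notMem_erase P S) (π P ^ a) N
  let R : Subalgebra k C := ⨅ P ∈ S, P.alg
  have hR : ∀ y, y ∈ R ↔ ∀ P ∈ S, y ∈ P.1 := by
    intro y; simp only [R, Algebra.mem_iInf]; rfl
  have hpow : ∀ P : Pl k C, ∀ n : ℕ, ord P (π P ^ n) = n := fun P n => by
    rw [ord_pow P (hπ0 P), hπ, mul_one]
  have key := card_le_finrank hx0 R ((hR x).mpr fun P hP => (mem_iff_ord P hx0).mpr (hS P hP).le)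
    (ι := Σ P : S, Fin (e P)) (fun i => z i.1 i.2) ?_ ?_
  · refine le_trans (le_of_eq ?_) key
    rw [Fintype.card_sigma]
    simp only [Fintype.card_fin]
    exact (Finset.sum_coe_sort S e).symm
  · rintro ⟨P, a⟩
    rw [hR]
    intro Q hQ
    rw [← mem_M_zero]
    by_cases hPQ : Q = P
    · subst hPQ
      have h1 : z P a - π P ^ (a : ℕ) ∈ M P.1 0 := M_anti (by omega) (hz1 P a)
      have h2 : π P ^ (a : ℕ) ∈ M P.1 0 := (mem_M' (pow_ne_zero _ (hπ0 _))).mpr (by rw [hpow]; omega)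
      simpa using add_mem h1 h2
    · exact M_anti (by omega) (hz2 P a Q (Finset.mem_erase.mpr ⟨hPQ, hQ⟩))
  · rintro c ⟨r, hr, hsum⟩
    rw [hR] at hr
    funext ⟨P, a⟩
    have hP := P.2
    rw [Fintype.sum_sigma] at hsum
    have h1 : ∑ Q : S, ∑ b : Fin (e Q), c ⟨Q, b⟩ • z Q b ∈ M P.1 (e P) := by
      rw [hsum, heP P hP]
      simpa using mul_mem_M (mem_M_ord P.1 x) (mem_M_zero.mpr (hr P hP))
    rw [← Finset.add_sum_erase _ _ (Finset.mem_univ P)] at h1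
    have h2 : ∑ Q ∈ Finset.univ.erase P, ∑ b : Fin (e Q), c ⟨Q, b⟩ • z Q b ∈ M P.1 (e P) := by
      refine sum_mem fun Q hQ => sum_mem fun b _ => Submodule.smul_mem _ _ ?_
      have hQP : P.1 ≠ Q.1 := fun h => (Finset.mem_erase.mp hQ).1 (Subtype.ext h.symm)
      exact M_anti (by exact_mod_cast hN P hP) (hz2 Q b P (Finset.mem_erase.mpr ⟨hQP, hP⟩))
    have h3 : ∑ b : Fin (e P), c ⟨P, b⟩ • z P b ∈ M P.1 (e P) := by simpa using sub_mem h1 h2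
    have h4 : ∑ b : Fin (e P), c ⟨P, b⟩ • (z P b - π P ^ (b : ℕ)) ∈ M P.1 (e P) :=
      sum_mem fun b _ => Submodule.smul_mem _ _ (M_anti (by exact_mod_cast hN P hP) (hz1 P b))
    have h5 : ∑ b : Fin (e P), c ⟨P, b⟩ • π P ^ (b : ℕ) ∈ M P.1 (e P) := by
      have := sub_mem h3 h4
      rw [← Finset.sum_sub_distrib] at this
      simpa [← smul_sub] using this
    exact congrFun (local_indep P.1 (hπ0 P) (hπ P) (e P) (fun b => c ⟨P, b⟩) h5) a

theorem deg_bound {x : C} (hx : Transcendental k x) (S : Finset (Pl k C)) :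
    ∑ P ∈ S, (ord P x).toNat ≤ Module.finrank k⟮x⟯ C := by
  classical
  refine le_trans (le_of_eq ?_) (deg_bound_aux hx (S.filter fun P => 0 < ord P x)
    (fun P hP => (Finset.mem_filter.mp hP).2))
  refine (Finset.sum_subset (Finset.filter_subset _ _) ?_).symm
  intro P hP hP'
  simp only [Finset.mem_filter, hP, true_and] at hP'
  omega

theorem zeros_finite {x : C} (hx : Transcendental k x) : {P : Pl k C | 0 < ord P x}.Finite := by
  by_contra hinf
  obtain ⟨S, hS, hc⟩ := Set.Infinite.exists_subset_card_eq hinf (Module.finrank k⟮x⟯ C + 1)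
  have h1 := deg_bound hx S
  have h2 : ∑ P ∈ S, 1 ≤ ∑ P ∈ S, (ord P x).toNat :=
    Finset.sum_le_sum fun P hP => by have : 0 < ord P x := hS hP; omega
  simp only [Finset.sum_const, smul_eq_mul, mul_one] at h2
  omega

theorem transc_inv {x : C} (hx : Transcendental k x) : Transcendental k x⁻¹ := by
  intro h; exact hx (inv_inv x ▸ h.inv)

theorem supp_finite {x : C} (hx0 : x ≠ 0) : {P : Pl k C | ord P x ≠ 0}.Finite := by
  rcases mem_range_or_transc (k := k) x with ⟨c, rfl⟩ | hx
  · have hc : c ≠ 0 := by rintro rfl; simp at hx0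
    simp [ord_const _ hc]
  · refine ((zeros_finite hx).union (zeros_finite (transc_inv hx))).subset ?_
    intro P hP
    simp only [Set.mem_ofPred_eq, Set.mem_union, ord_inv P hx0] at *
    omega

theorem exists_zero {x : C} (hx : Transcendental k x) : ∃ P : Pl k C, 0 < ord P x := by
  let A := Algebra.adjoin k {x}
  let I : Ideal A.toSubring := Ideal.span {⟨x, Algebra.self_mem_adjoin_singleton k x⟩}
  have hI : I ≠ ⊤ := by
    intro h
    rw [Ideal.eq_top_iff_one, Ideal.mem_span_singleton'] at h
    obtain ⟨a, ha⟩ := h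
    have ha' : (a : C) * x = 1 := by simpa using congrArg Subtype.val ha
    have ha2 : (a : C) ∈ Algebra.adjoin k {x} := a.2
    obtain ⟨p, hp⟩ : ∃ p : Polynomial k, Polynomial.aeval x p = (a : C) := by
      have h3 : ∀ y ∈ Algebra.adjoin k {x}, ∃ p : Polynomial k, Polynomial.aeval x p = y := by
        intro y hy
        rw [Algebra.adjoin_singleton_eq_range_aeval] at hy
        exact hy
      exact h3 _ ha2
    have h4 : Polynomial.aeval x (p * Polynomial.X - 1) = 0 := by
      simp [hp, ha']
    have h5 := (transcendental_iff.mp hx) _ h4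
    have h6 := congrArg (Polynomial.coeff · 0) h5
    simp at h6
  obtain ⟨O, hO, hOI⟩ := Ideal.image_subset_nonunits_valuationSubring I hI
  have hxO : x ∈ O.nonunits := hOI ⟨⟨x, Algebra.self_mem_adjoin_singleton k x⟩,
    Ideal.mem_span_singleton_self _, rfl⟩
  have hx0 : x ≠ 0 := transc_ne_zero hx
  let P : Pl k C := ⟨O, fun c => hO (A.algebraMap_mem c), by
    rintro rfl
    have h1 : (⊤ : ValuationSubring C).valuation x < 1 := hxO
    have h2 : (⊤ : ValuationSubring C).valuation x⁻¹ ≤ 1 :=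
      (ValuationSubring.valuation_le_one_iff _ _).mpr trivial
    rw [map_inv₀] at h2
    have h0 : 0 < (⊤ : ValuationSubring C).valuation x := zero_lt_iff.mpr ((Valuation.ne_zero_iff _).mpr hx0)
    rw [inv_le_one₀ h0] at h2
    exact absurd h1 (not_lt.mpr h2)⟩
  refine ⟨P, ?_⟩
  have := (mem_nonunits (P := P)).mp hxO
  rw [mem_M' hx0] at this; omega

end B
end RatCurve

open IntermediateField

namespace RatCurve

section CC
set_option linter.unusedSectionVars false
variable {k C : Type*} [Field k] [Field C] [Algebra k C] [FF k C] [IsAlgClosed k]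

/-- principal divisor -/
noncomputable def dv (k : Type*) {C : Type*} [Field k] [Field C] [Algebra k C] [FF k C]
    [IsAlgClosed k] (f : C) : Pl k C →₀ ℤ :=
  open Classical in
  if h : f = 0 then 0 else Finsupp.ofSupportFinite (fun P => ord P f) (supp_finite h)

theorem dv_apply {f : C} (hf : f ≠ 0) (P : Pl k C) : dv k f P = ord P f := by
  rw [dv, dif_neg hf]; rfl

theorem dv_mul {f g : C} (hf : f ≠ 0) (hg : g ≠ 0) : dv k (f * g) = dv k f + dv k g := by
  ext P
  simp [dv_apply, hf, hg, ord_mul]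

theorem dv_inv {f : C} (hf : f ≠ 0) : dv k (f⁻¹) = - dv k f := by
  ext P
  simp [dv_apply, hf, ord_inv]

theorem dv_pow {f : C} (hf : f ≠ 0) (n : ℕ) : dv k (f ^ n) = n • dv k f := by
  ext P
  simp [dv_apply, hf, ord_pow]

theorem dv_const {c : k} (hc : c ≠ 0) : dv k (algebraMap k C c) = 0 := by
  ext P
  rw [dv_apply (by simpa using hc), ord_const P hc]; rfl

/-- degree of a divisor -/
noncomputable def dg : (Pl k C →₀ ℤ) →+ ℤ := Finsupp.degree

theorem dg_single (P : Pl k C) (n : ℤ) : dg (Finsupp.single P n) = n := Finsupp.degree_single _ _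

theorem dg_nonneg {D : Pl k C →₀ ℤ} (h : 0 ≤ D) : 0 ≤ dg D := by
  rw [dg, Finsupp.degree_apply]
  exact Finset.sum_nonneg fun i _ => h i

theorem dg_mono {D E : Pl k C →₀ ℤ} (h : D ≤ E) : dg D ≤ dg E := by
  have := dg_nonneg (sub_nonneg.mpr h)
  rw [map_sub] at this; linarith

theorem eq_of_dg {D E : Pl k C →₀ ℤ} (h : D ≤ E) (hd : dg E ≤ dg D) : D = E := by
  have h1 := sub_nonneg.mpr h
  have h2 : dg (E - D) = 0 := by
    have := dg_nonneg h1
    rw [map_sub] at *; linarith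
  rw [dg, Finsupp.degree_apply, Finset.sum_eq_zero_iff_of_nonneg (fun i _ => h1 i)] at h2
  ext P
  by_contra hne
  have h3 : (E - D) P ≠ 0 := by
    simp only [Finsupp.coe_sub, Pi.sub_apply]; omega
  exact h3 (h2 P (Finsupp.mem_support_iff.mpr h3))

theorem div_induct {p : (Pl k C →₀ ℤ) → Prop} {D E : Pl k C →₀ ℤ} (h : D ≤ E) (h0 : p D)
    (hs : ∀ F P, D ≤ F → F + Finsupp.single P 1 ≤ E → p F → p (F + Finsupp.single P 1)) : p E := by
  classical
  suffices H : ∀ n : ℕ, ∀ E', D ≤ E' → E' ≤ E → dg (E' - D) = n → p E' by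
    exact H (dg (E - D)).toNat E h le_rfl
      (Int.toNat_of_nonneg (dg_nonneg (sub_nonneg.mpr h))).symm
  intro n
  induction n with
  | zero =>
    intro E' h1 _ h2
    have : D = E' := eq_of_dg h1 (by rw [map_sub] at h2; push_cast at h2; linarith)
    rwa [← this]
  | succ n ih =>
    intro E' h1 h1' h2
    have hne : ∃ P, D P < E' P := by
      by_contra hh; push Not at hh
      have : E' = D := le_antisymm hh h1
      rw [this, sub_self, map_zero] at h2; push_cast at h2; omega
    obtain ⟨P, hP⟩ := hne
    have e : E' = (E' - Finsupp.single P 1) + Finsupp.single P 1 := by abel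
    have hle : D ≤ E' - Finsupp.single P 1 := by
      intro Q
      have := h1 Q
      by_cases hQ : P = Q
      · subst hQ; simp; omega
      · simpa [Finsupp.single_apply, hQ] using this
    rw [e]
    refine hs _ P hle (by rwa [← e]) (ih _ hle (le_trans ?_ h1') ?_)
    · intro Q
      by_cases hQ : P = Q
      · subst hQ; simp
      · simp [Finsupp.single_apply, hQ]
    · have : E' - Finsupp.single P 1 - D = (E' - D) - Finsupp.single P 1 := by abel
      rw [this, map_sub, h2, dg_single]; push_cast; ring

/-- Riemann-Roch space -/
noncomputable def Ls (D : Pl k C →₀ ℤ) : Submodule k C := ⨅ P, M P (- D P)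

theorem mem_Ls {D : Pl k C →₀ ℤ} {f : C} : f ∈ Ls D ↔ ∀ P, f ∈ M P (- D P) := by
  simp [Ls, Submodule.mem_iInf]

theorem mem_Ls' {D : Pl k C →₀ ℤ} {f : C} (hf : f ≠ 0) : f ∈ Ls D ↔ 0 ≤ D + dv k f := by
  rw [mem_Ls]
  refine forall_congr' fun P => ?_
  rw [mem_M' hf]
  simp only [Finsupp.coe_add, Pi.add_apply, dv_apply hf, Finsupp.coe_zero, Pi.zero_apply]
  omega

theorem Ls_mono {D E : Pl k C →₀ ℤ} (h : D ≤ E) : Ls D ≤ Ls E := by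
  intro f hf
  rw [mem_Ls] at *
  intro P
  exact M_anti (neg_le_neg (h P)) (hf P)

theorem mul_mem_Ls {D E : Pl k C →₀ ℤ} {f g : C} (hf : f ∈ Ls D) (hg : g ∈ Ls E) :
    f * g ∈ Ls (D + E) := by
  rw [mem_Ls] at *
  intro P
  have := mul_mem_M (hf P) (hg P)
  refine M_anti (le_of_eq ?_) this
  simp only [Finsupp.coe_add, Pi.add_apply]; ring

theorem Ls_zero : Ls (0 : Pl k C →₀ ℤ) = Submodule.span k {(1 : C)} := by
  ext f
  rw [Submodule.mem_span_singleton]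
  constructor
  · intro hf
    rcases mem_range_or_transc (k := k) f with ⟨c, rfl⟩ | hx
    · exact ⟨c, by rw [Algebra.smul_def, mul_one]⟩
    · exfalso
      obtain ⟨P, hP⟩ := exists_zero (transc_inv hx)
      rw [ord_inv P (transc_ne_zero hx)] at hP
      have := mem_Ls.mp hf P
      rw [mem_M' (transc_ne_zero hx)] at this
      simp at this; omega
  · rintro ⟨c, rfl⟩
    refine Submodule.smul_mem _ _ (mem_Ls.mpr fun P => ?_)
    simpa using one_mem_M P

theorem Ls_step (D : Pl k C →₀ ℤ) (P : Pl k C) {x : C} (hx : x ∈ Ls (D + Finsupp.single P 1))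
    (hx' : x ∉ Ls D) : Ls (D + Finsupp.single P 1) = Ls D ⊔ Submodule.span k {x} := by
  classical
  have hle : Ls D ≤ Ls (D + Finsupp.single P 1) := Ls_mono (by
    simp [Finsupp.single_nonneg])
  have hx0 : x ≠ 0 := by rintro rfl; exact hx' (zero_mem _)
  have key : ∀ y ∈ Ls (D + Finsupp.single P 1), y ∈ M P (- D P) → y ∈ Ls D := by
    intro y hy hyP
    rw [mem_Ls] at *
    intro Q
    by_cases hQ : P = Q
    · subst hQ; exact hyP
    · simpa [Finsupp.single_apply, hQ] using hy Q
  have hxP : ord P x = - D P - 1 := by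
    have h1 := mem_Ls.mp hx P
    rw [mem_M' hx0] at h1
    have h2 : x ∉ M P (- D P) := fun h => hx' (key x hx h)
    rw [mem_M' hx0] at h2
    simp at h1; omega
  refine le_antisymm ?_ (sup_le hle ((Submodule.span_singleton_le_iff_mem _ _).mpr hx))
  intro y hy
  have h1 : y ∈ M P (ord P x) := by
    have := mem_Ls.mp hy P
    rw [hxP]; convert this using 2; simp; ring
  obtain ⟨c, hc⟩ := exists_coeff hx0 h1
  rw [hxP] at hc
  have h3 : y - c • x ∈ Ls D := by
    refine key _ (sub_mem hy (Submodule.smul_mem _ _ hx)) ?_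
    convert hc using 2; ring
  rw [Submodule.mem_sup]
  exact ⟨_, h3, c • x, Submodule.smul_mem _ _ (Submodule.mem_span_singleton_self x), by abel⟩

/-- dimension of the Riemann-Roch space -/
noncomputable def ll (D : Pl k C →₀ ℤ) : ℤ := Module.finrank k (Ls D)

theorem Ls_fin_step (D : Pl k C →₀ ℤ) (P : Pl k C) [FiniteDimensional k (Ls D)] :
    FiniteDimensional k (Ls (D + Finsupp.single P 1)) ∧
      ll (D + Finsupp.single P 1) ≤ ll D + 1 := by
  have hle : Ls D ≤ Ls (D + Finsupp.single P 1) := Ls_mono (by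
    simp [Finsupp.single_nonneg])
  by_cases h : ∃ x ∈ Ls (D + Finsupp.single P 1), x ∉ Ls D
  · obtain ⟨x, hx, hx'⟩ := h
    have hx0 : x ≠ 0 := by rintro rfl; exact hx' (zero_mem _)
    have e := Ls_step D P hx hx'
    unfold ll
    rw [e]
    refine ⟨inferInstance, ?_⟩
    have := Submodule.finrank_add_le_finrank_add_finrank (Ls D) (Submodule.span k {x})
    rw [finrank_span_singleton hx0] at this
    exact_mod_cast this
  · push Not at h
    have e : Ls (D + Finsupp.single P 1) = Ls D := le_antisymm h hle
    unfold ll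
    rw [e]
    exact ⟨inferInstance, by omega⟩

theorem Ls_fin_mono {D E : Pl k C →₀ ℤ} (h : D ≤ E) [FiniteDimensional k (Ls D)] :
    FiniteDimensional k (Ls E) ∧ ll E - dg E ≤ ll D - dg D := by
  refine div_induct (p := fun E => FiniteDimensional k (Ls E) ∧ ll E - dg E ≤ ll D - dg D) h
    ⟨inferInstance, le_rfl⟩ ?_
  rintro F P _ _ ⟨h1, h2⟩
  obtain ⟨h3, h4⟩ := Ls_fin_step F P
  refine ⟨h3, ?_⟩
  rw [map_add, dg_single]; linarith

instance Ls_zero_fin : FiniteDimensional k (Ls (0 : Pl k C →₀ ℤ)) := by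
  rw [Ls_zero]; infer_instance

theorem ll_zero : ll (0 : Pl k C →₀ ℤ) = 1 := by
  rw [ll, Ls_zero, finrank_span_singleton one_ne_zero]; rfl

instance Ls_fin (D : Pl k C →₀ ℤ) : FiniteDimensional k (Ls D) := by
  have h1 : FiniteDimensional k (Ls (D ⊔ 0)) := (Ls_fin_mono le_sup_right).1
  exact Submodule.finiteDimensional_of_le (Ls_mono (le_sup_left (b := 0)))

theorem ll_nonneg (D : Pl k C →₀ ℤ) : 0 ≤ ll D := Int.natCast_nonneg _

theorem ll_mono {D E : Pl k C →₀ ℤ} (h : D ≤ E) : ll D ≤ ll E := by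
  unfold ll
  exact_mod_cast Submodule.finrank_mono (Ls_mono h)

/-- degree minus dimension -/
noncomputable def gm (D : Pl k C →₀ ℤ) : ℤ := dg D - ll D

theorem gm_mono {D E : Pl k C →₀ ℤ} (h : D ≤ E) : gm D ≤ gm E := by
  have := (Ls_fin_mono h).2
  unfold gm; linarith

theorem exists_of_ll_pos {D : Pl k C →₀ ℤ} (h : 0 < ll D) : ∃ f : C, f ≠ 0 ∧ f ∈ Ls D := by
  have : Ls D ≠ ⊥ := by
    intro h1
    rw [ll, h1, finrank_bot] at h; simp at h
  obtain ⟨f, hf, h0⟩ := Submodule.exists_mem_ne_zero_of_ne_bot this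
  exact ⟨f, h0, hf⟩

theorem ll_pos_of {D : Pl k C →₀ ℤ} {f : C} (h0 : f ≠ 0) (hf : f ∈ Ls D) : 0 < ll D := by
  by_contra h
  have h1 : Module.finrank k (Ls D) = 0 := by unfold ll at h; omega
  rw [Submodule.finrank_eq_zero] at h1
  rw [h1, Submodule.mem_bot] at hf
  exact h0 hf

theorem Ls_map {f : C} (hf : f ≠ 0) (D : Pl k C →₀ ℤ) (x : C) :
    x ∈ Ls (D + dv k f) ↔ x * f ∈ Ls D := by
  by_cases hx : x = 0
  · simp [hx]
  · rw [mem_Ls' hx, mem_Ls' (mul_ne_zero hx hf), dv_mul hx hf, add_assoc, add_comm (dv k f)]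

theorem ll_dv {f : C} (hf : f ≠ 0) (D : Pl k C →₀ ℤ) : ll (D + dv k f) = ll D := by
  unfold ll
  let e : C ≃ₗ[k] C := LinearEquiv.ofBijective (LinearMap.mulRight k f) ⟨
    fun x y h => mul_right_cancel₀ hf (by simpa using h),
    fun y => ⟨y * f⁻¹, by simp [hf]⟩⟩
  have : Ls D = (Ls (D + dv k f)).map (e : C →ₗ[k] C) := by
    ext y
    rw [Submodule.mem_map]
    constructor
    · intro hy
      exact ⟨y * f⁻¹, (Ls_map hf D _).mpr (by simpa [hf] using hy), show y * f⁻¹ * f = y by rw [mul_assoc, inv_mul_cancel₀ hf, mul_one]⟩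
    · rintro ⟨x, hx, rfl⟩
      exact (Ls_map hf D _).mp hx
  rw [this, LinearEquiv.finrank_map_eq]

theorem adjoin_inv (x : C) : k⟮x⁻¹⟯ = k⟮x⟯ := by
  apply le_antisymm <;> rw [adjoin_simple_le_iff]
  · exact inv_mem (mem_adjoin_simple_self k x)
  · simpa using inv_mem (mem_adjoin_simple_self k x⁻¹)

/-- pole divisor -/
noncomputable def poles (k : Type*) {C : Type*} [Field k] [Field C] [Algebra k C] [FF k C]
    [IsAlgClosed k] (x : C) : Pl k C →₀ ℤ := dv k x⁻¹ ⊔ 0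

theorem poles_nonneg (x : C) : 0 ≤ poles k x := le_sup_right

theorem mem_Ls_poles (x : C) : x ∈ Ls (poles k x) := by
  by_cases hx : x = 0
  · simp [hx]
  rw [mem_Ls' hx]
  intro P
  simp [poles, dv_apply hx, dv_apply (inv_ne_zero hx), ord_inv P hx]
  have := le_max_left (-ord P x) 0
  omega

theorem dg_poles_le {x : C} (hx : Transcendental k x) :
    dg (poles k x) ≤ Module.finrank k⟮x⟯ C := by
  have h := deg_bound (transc_inv hx) (poles k x).support
  rw [adjoin_inv] at h
  rw [dg, Finsupp.degree_apply]
  refine le_trans (le_of_eq ?_) (Int.ofNat_le.mpr h)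
  rw [Nat.cast_sum]
  refine Finset.sum_congr rfl fun P _ => ?_
  simp [poles, dv_apply (inv_ne_zero (transc_ne_zero hx))]

theorem indep_pow {x : C} (hx : Transcendental k x) (m : ℕ) :
    LinearIndependent k (fun i : Fin m => (⟨x, mem_adjoin_simple_self k x⟩ : k⟮x⟯) ^ (i : ℕ)) := by
  have h1 : LinearIndependent k (fun i : ℕ => x ^ i) := by
    have := (Polynomial.basisMonomials k).linearIndependent.map'
      (Polynomial.aeval x).toLinearMap (LinearMap.ker_eq_bot.mpr
        (transcendental_iff_injective.mp hx))
    have e : (fun i : ℕ => x ^ i) = (Polynomial.aeval x).toLinearMap ∘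
        (Polynomial.basisMonomials k) := by
      funext i
      simp
    rw [e]; exact this
  have h2 : LinearIndependent k (fun i : Fin m => x ^ (i : ℕ)) :=
    h1.comp _ Fin.val_injective
  refine LinearIndependent.of_comp (k⟮x⟯.val.toLinearMap) ?_
  exact h2

theorem riemann_lower {x : C} (hx : Transcendental k x) : ∃ D0 : Pl k C →₀ ℤ, ∀ m : ℕ,
    (Module.finrank k⟮x⟯ C : ℤ) * (m + 1) ≤ ll (m • poles k x + D0) := by
  have := FF.fin x hx
  let b := Module.finBasis k⟮x⟯ C
  refine ⟨∑ j, poles k (b j), fun m => ?_⟩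
  have h1 := linearIndependent_smul (indep_pow hx (m + 1)) b.linearIndependent
  have h2 : ∀ p : Fin (m+1) × Fin (Module.finrank k⟮x⟯ C),
      ((⟨x, mem_adjoin_simple_self k x⟩ : k⟮x⟯) ^ (p.1 : ℕ)) • b p.2 ∈
        Ls (m • poles k x + ∑ j, poles k (b j)) := by
    intro p
    have h3 : ((⟨x, mem_adjoin_simple_self k x⟩ : k⟮x⟯) ^ (p.1 : ℕ)) • b p.2 =
      x ^ (p.1 : ℕ) * b p.2 := by
      rw [Algebra.smul_def]; rfl
    rw [h3]
    refine Ls_mono (add_le_add ?_ ?_) (mul_mem_Ls (D := (p.1 : ℕ) • poles k x)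
      (E := poles k (b p.2)) ?_ (mem_Ls_poles _))
    · exact nsmul_le_nsmul_left (poles_nonneg x) (by have := p.1.2; omega)
    · exact Finset.single_le_sum (f := fun j => poles k (b j)) (fun j _ => poles_nonneg _)
        (Finset.mem_univ p.2)
    · generalize (p.1 : ℕ) = i
      induction i with
      | zero => simp only [pow_zero, zero_smul, Ls_zero]; exact Submodule.mem_span_singleton_self _
      | succ i ih => rw [pow_succ, succ_nsmul]; exact mul_mem_Ls ih (mem_Ls_poles x)
  have h4 : LinearIndependent k (fun p : Fin (m+1) × Fin (Module.finrank k⟮x⟯ C) =>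
      (⟨_, h2 p⟩ : Ls (m • poles k x + ∑ j, poles k (b j)))) :=
    LinearIndependent.of_comp (Submodule.subtype _) h1
  have h5 := h4.fintype_card_le_finrank
  simp only [Fintype.card_prod, Fintype.card_fin] at h5
  unfold ll
  rw [mul_comm]
  exact_mod_cast h5

theorem dg_poles {x : C} (hx : Transcendental k x) :
    dg (poles k x) = Module.finrank k⟮x⟯ C := by
  refine le_antisymm (dg_poles_le hx) ?_
  by_contra hlt
  push Not at hlt
  obtain ⟨D0, h⟩ := riemann_lower hx
  have h1 : ∀ m : ℕ, ll (m • poles k x + D0) ≤ m * dg (poles k x) + dg (D0 ⊔ 0) + 1 := by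
    intro m
    have h2 : ll (m • poles k x + D0) ≤ ll (m • poles k x + (D0 ⊔ 0)) :=
      ll_mono (add_le_add le_rfl le_sup_left)
    have h3 := (Ls_fin_mono (D := 0) (E := m • poles k x + (D0 ⊔ 0))
      (add_nonneg (nsmul_nonneg (poles_nonneg x) m) le_sup_right)).2
    rw [ll_zero, map_zero, map_add, map_nsmul] at h3
    simp at h3; linarith
  have h3 := h (dg (D0 ⊔ 0) + 1).toNat
  have h4 := h1 (dg (D0 ⊔ 0) + 1).toNat
  have h5 : 0 ≤ dg (D0 ⊔ 0) := dg_nonneg le_sup_right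
  have h6 : 0 ≤ dg (poles k x) := dg_nonneg (poles_nonneg x)
  rw [Int.toNat_of_nonneg (by omega)] at h3 h4
  nlinarith [mul_nonneg (show (0:ℤ) ≤ dg (D0 ⊔ 0) + 1 by omega)
    (show 0 ≤ (Module.finrank k⟮x⟯ C : ℤ) - 1 - dg (poles k x) by omega)]

theorem dg_dv {f : C} (hf : f ≠ 0) : dg (dv k f) = 0 := by
  rcases mem_range_or_transc (k := k) f with ⟨c, rfl⟩ | hx
  · rw [dv_const (by rintro rfl; simp at hf), map_zero]
  · have h1 := dg_poles hx
    have h2 := dg_poles (transc_inv hx)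
    rw [adjoin_inv] at h2
    have : dv k f = poles k f⁻¹ - poles k f := by
      ext P
      simp only [poles, dv_inv hf, inv_inv, Finsupp.coe_sub, Pi.sub_apply, Finsupp.sup_apply,
        Finsupp.coe_neg, Pi.neg_apply, Finsupp.coe_zero, Pi.zero_apply]
      rcases le_total (dv k f P) 0 with h | h
      · rw [sup_eq_right.mpr h, sup_eq_left.mpr (by omega)]; omega
      · rw [sup_eq_left.mpr h, sup_eq_right.mpr (by omega)]; omega
    rw [this, map_sub, h1, h2, sub_self]

theorem gm_dv {f : C} (hf : f ≠ 0) (D : Pl k C →₀ ℤ) : gm (D + dv k f) = gm D := by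
  rw [gm, gm, ll_dv hf, map_add, dg_dv hf, add_zero]

theorem gm_bdd : ∃ b : ℤ, ∀ D : Pl k C →₀ ℤ, gm D ≤ b := by
  obtain ⟨x, hx⟩ := FF.exT (k := k) (C := C)
  obtain ⟨D0, h⟩ := riemann_lower hx
  have := FF.fin x hx
  have hn : 0 < Module.finrank k⟮x⟯ C := Module.finrank_pos
  refine ⟨dg D0 - Module.finrank k⟮x⟯ C, fun D => ?_⟩
  have hD : 0 ≤ dg (D ⊔ 0) := dg_nonneg le_sup_right
  let m := (dg (D ⊔ 0)).toNat
  have hm : (m : ℤ) = dg (D ⊔ 0) := Int.toNat_of_nonneg hD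
  have h1 := (Ls_fin_mono (D := m • poles k x + D0 - (D ⊔ 0)) (E := m • poles k x + D0)
    (sub_le_self _ le_sup_right)).2
  rw [map_sub] at h1
  have h2 := h m
  obtain ⟨f, hf0, hf⟩ := exists_of_ll_pos (D := m • poles k x + D0 - (D ⊔ 0)) (by nlinarith)
  rw [mem_Ls' hf0] at hf
  have h3 : D ≤ m • poles k x + D0 + dv k f := by
    refine le_trans (le_sup_left (b := 0)) ?_
    have e := add_le_add hf (le_refl (D ⊔ 0))
    rw [zero_add] at e; refine e.trans (le_of_eq ?_); abel
  have h4 := gm_mono h3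
  rw [gm_dv hf0] at h4
  refine h4.trans ?_
  rw [gm, map_add, map_nsmul, dg_poles hx]
  simp; linarith

theorem exists_genus (k C : Type*) [Field k] [Field C] [Algebra k C] [FF k C] [IsAlgClosed k] :
    ∃ g : ℤ, (∃ D : Pl k C →₀ ℤ, gm D = g) ∧ ∀ D : Pl k C →₀ ℤ, gm D ≤ g := by
  obtain ⟨b, hb⟩ := gm_bdd (k := k) (C := C)
  obtain ⟨g, h1, h2⟩ := Int.exists_greatest_of_bdd (P := fun z => ∃ D : Pl k C →₀ ℤ, gm D = z)
    ⟨b, by rintro z ⟨D, rfl⟩; exact hb D⟩ ⟨_, 0, rfl⟩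
  exact ⟨g, h1, fun D => h2 _ ⟨D, rfl⟩⟩

/-- genus minus one -/
noncomputable def gg (k C : Type*) [Field k] [Field C] [Algebra k C] [FF k C] [IsAlgClosed k] : ℤ :=
  Classical.choose (exists_genus k C)

theorem gm_le (D : Pl k C →₀ ℤ) : gm D ≤ gg k C := (Classical.choose_spec (exists_genus k C)).2 D

theorem riemann (k C : Type*) [Field k] [Field C] [Algebra k C] [FF k C] [IsAlgClosed k] :
    ∃ N : ℤ, ∀ D : Pl k C →₀ ℤ, N ≤ dg D → gm D = gg k C := by
  obtain ⟨D1, h1⟩ := (Classical.choose_spec (exists_genus k C)).1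
  refine ⟨dg D1 + gg k C + 1, fun D hD => le_antisymm (gm_le D) ?_⟩
  have h2 := gm_le (D - D1)
  rw [gm, map_sub] at h2
  obtain ⟨f, hf0, hf⟩ := exists_of_ll_pos (D := D - D1) (by linarith)
  rw [mem_Ls' hf0] at hf
  have h3 : D1 ≤ D + dv k f := by
    have e := add_le_add hf (le_refl D1)
    rw [zero_add] at e; refine e.trans (le_of_eq ?_); abel
  have h4 := gm_mono h3
  rw [gm_dv hf0, h1] at h4
  exact h4

end CC
end RatCurve

open IntermediateField

namespace RatCurve

section DD
set_option linter.unusedSectionVars false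
variable {k C : Type*} [Field k] [Field C] [Algebra k C] [FF k C] [IsAlgClosed k]

theorem bad_finite (D : Pl k C →₀ ℤ) (c : C) : {P : Pl k C | c ∉ M P (- D P)}.Finite := by
  by_cases hc : c = 0
  · simp [hc]
  · refine ((supp_finite (k := k) hc).union D.hasFiniteSupport).subset ?_
    intro P hP
    by_contra h
    simp only [Set.mem_union, Set.mem_ofPred_eq, Function.mem_support, not_or, not_not] at h
    apply hP
    rw [mem_M' hc, h.1, h.2]; simp

theorem om_supp {D : Pl k C →₀ ℤ} {ω : Pl k C → Module.Dual k C}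
    (h : ∀ P, ∀ c ∈ M P (- D P), ω P c = 0) (c : C) :
    (Function.support fun P => ω P c).Finite := by
  refine (bad_finite D c).subset ?_
  intro P hP hc
  exact hP (h P c hc)

/-- differentials -/
noncomputable def Om (D : Pl k C →₀ ℤ) : Submodule k (Pl k C → Module.Dual k C) where
  carrier := {ω | (∀ P, ∀ c ∈ M P (- D P), ω P c = 0) ∧ ∀ c, ∑ᶠ P, ω P c = 0}
  zero_mem' := ⟨fun _ _ _ => rfl, fun c => by simp⟩
  add_mem' := by
    rintro a b ⟨ha, ha'⟩ ⟨hb, hb'⟩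
    refine ⟨fun P c hc => by simp [ha P c hc, hb P c hc], fun c => ?_⟩
    have := finsum_add_distrib (om_supp ha c) (om_supp hb c)
    simp only [Pi.add_apply, LinearMap.add_apply]
    rw [this, ha', hb', add_zero]
  smul_mem' := by
    rintro r a ⟨ha, ha'⟩
    refine ⟨fun P c hc => by simp [ha P c hc], fun c => ?_⟩
    simp only [Pi.smul_apply, LinearMap.smul_apply]
    rw [← smul_finsum' r (om_supp ha c), ha', smul_zero]

theorem Om_anti {D E : Pl k C →₀ ℤ} (h : D ≤ E) : Om E ≤ Om D := by
  rintro ω ⟨h1, h2⟩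
  exact ⟨fun P c hc => h1 P c (M_anti (neg_le_neg (h P)) hc), h2⟩

theorem Om_sup {D E : Pl k C →₀ ℤ} {ω : Pl k C → Module.Dual k C} (h1 : ω ∈ Om D) (h2 : ω ∈ Om E) :
    ω ∈ Om (D ⊔ E) := by
  refine ⟨fun P c hc => ?_, h1.2⟩
  rw [Finsupp.sup_apply] at hc
  rcases le_total (D P) (E P) with h | h
  · rw [sup_eq_right.mpr h] at hc; exact h2.1 P c hc
  · rw [sup_eq_left.mpr h] at hc; exact h1.1 P c hc

/-- multiplication of differentials by functions -/
noncomputable def mulOm (ω : Pl k C → Module.Dual k C) : C →ₗ[k] (Pl k C → Module.Dual k C) where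
  toFun f := fun P => (ω P).comp (LinearMap.mulLeft k f)
  map_add' f g := by funext P; ext c; simp [add_mul]
  map_smul' r f := by funext P; ext c; simp

theorem mulOm_apply (ω : Pl k C → Module.Dual k C) (f : C) (P : Pl k C) (c : C) :
    mulOm ω f P c = ω P (f * c) := rfl

theorem mulOm_mem {D E : Pl k C →₀ ℤ} {ω : Pl k C → Module.Dual k C} (h : ω ∈ Om D) {f : C}
    (hf : f ∈ Ls E) : mulOm ω f ∈ Om (D - E) := by
  refine ⟨fun P c hc => ?_, fun c => h.2 (f * c)⟩
  rw [mulOm_apply]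
  apply h.1
  have := mul_mem_M (mem_Ls.mp hf P) hc
  refine M_anti (le_of_eq ?_) this
  simp only [Finsupp.coe_sub, Pi.sub_apply]; ring

theorem mulOm_mem' {D : Pl k C →₀ ℤ} {ω : Pl k C → Module.Dual k C} (h : ω ∈ Om D) {f : C}
    (hf : f ≠ 0) : mulOm ω f ∈ Om (D + dv k f) := by
  have := mulOm_mem (E := - dv k f) h (f := f) ((mem_Ls' hf).mpr (by simp))
  rwa [sub_neg_eq_add] at this

theorem single_le (D : Pl k C →₀ ℤ) (P : Pl k C) {n : ℤ} (hn : 0 ≤ n) :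
    D ≤ D + Finsupp.single P n := by
  simp [Finsupp.single_nonneg, hn]

theorem mem_Ls_of_step {D : Pl k C →₀ ℤ} {P : Pl k C} {n : ℤ} {f : C}
    (hf : f ∈ Ls (D + Finsupp.single P n)) {Q : Pl k C} (hQ : Q ≠ P) : f ∈ M Q (- D Q) := by
  have := mem_Ls.mp hf Q
  simpa [Finsupp.single_apply, hQ.symm] using this

theorem om_step {D : Pl k C →₀ ℤ} {P : Pl k C} {ω : Pl k C → Module.Dual k C} (h : ω ∈ Om D)
    {n : ℤ} {f : C} (hf : f ∈ Ls (D + Finsupp.single P n)) : ω P f = 0 := by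
  have h1 := h.2 f
  rwa [finsum_eq_single (fun Q => ω Q f) P
    (fun Q hQ => h.1 Q f (mem_Ls_of_step hf hQ))] at h1

theorem Om_nonspecial {D : Pl k C →₀ ℤ} (hD : gm D = gg k C) : Om D = ⊥ := by
  rw [eq_bot_iff]
  intro ω hω
  rw [Submodule.mem_bot]
  funext P
  ext c
  simp only [Pi.zero_apply, LinearMap.zero_apply]
  suffices H : ∀ n : ℕ, ∀ c ∈ M P (- D P - n), ω P c = 0 by
    by_cases hc : c = 0
    · simp [hc]
    refine H (- ord P c - D P).toNat c ((mem_M' hc).mpr ?_)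
    have := Int.self_le_toNat (- ord P c - D P)
    omega
  intro n
  induction n with
  | zero => intro c hc; exact hω.1 P c (by simpa using hc)
  | succ n ih =>
    intro c hc
    have hg : gm (D + Finsupp.single P (n : ℤ)) = gg k C :=
      le_antisymm (gm_le _) (hD ▸ gm_mono (single_le D P (by positivity)))
    have hg' : gm (D + Finsupp.single P (n : ℤ) + Finsupp.single P 1) = gg k C :=
      le_antisymm (gm_le _) (hg ▸ gm_mono (single_le _ P (by norm_num)))
    have hl : ll (D + Finsupp.single P (n : ℤ)) <
        ll (D + Finsupp.single P (n : ℤ) + Finsupp.single P 1) := by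
      rw [gm] at hg hg'
      rw [map_add, dg_single] at hg'
      linarith
    have : ∃ f ∈ Ls (D + Finsupp.single P (n : ℤ) + Finsupp.single P 1),
        f ∉ Ls (D + Finsupp.single P (n : ℤ)) := by
      by_contra hh; push Not at hh
      have : Ls (D + Finsupp.single P (n : ℤ) + Finsupp.single P 1) ≤
        Ls (D + Finsupp.single P (n : ℤ)) := hh
      have := Submodule.finrank_mono this
      unfold ll at hl; omega
    obtain ⟨f, hf, hf'⟩ := this
    have hf0 : f ≠ 0 := by rintro rfl; exact hf' (zero_mem _)
    rw [add_assoc, ← Finsupp.single_add] at hf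
    have hfP : ord P f = - D P - (n + 1) := by
      have h1 := mem_Ls.mp hf P
      rw [mem_M' hf0] at h1
      have h2 : f ∉ M P (- (D P + n)) := by
        intro h
        apply hf'
        rw [mem_Ls]
        intro Q
        by_cases hQ : Q = P
        · subst hQ; simpa using h
        · have := mem_Ls_of_step hf hQ
          simpa [Finsupp.single_apply, Ne.symm hQ] using this
      rw [mem_M' hf0] at h2
      simp at h1; omega
    obtain ⟨a, ha⟩ := exists_coeff hf0 (x := c) (by
      rw [hfP]; push_cast at hc; exact hc)
    have h3 := ih _ (M_anti (le_of_eq (by rw [hfP]; ring)) ha)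
    rw [map_sub, map_smul, om_step hω hf, smul_zero, sub_zero] at h3
    exact h3

theorem exists_ord_eq (P : Pl k C) (n : ℤ) : ∃ t : C, t ≠ 0 ∧ ord P t = n := by
  obtain ⟨π, h0, h1⟩ := exists_unif P
  exact ⟨π ^ n, zpow_ne_zero _ h0, by rw [ord_zpow P h0, h1, mul_one]⟩

instance pl_nonempty : Nonempty (Pl k C) := by
  obtain ⟨x, hx⟩ := FF.exT (k := k) (C := C)
  exact ⟨(exists_zero hx).choose⟩

theorem mem_Om_step {D : Pl k C →₀ ℤ} {P : Pl k C} {t : C} (ht0 : t ≠ 0) (ht : ord P t = - D P - 1)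
    {ω : Pl k C → Module.Dual k C} (h : ω ∈ Om D) (hω : ω P t = 0) :
    ω ∈ Om (D + Finsupp.single P 1) := by
  refine ⟨fun Q c hc => ?_, h.2⟩
  by_cases hQ : Q = P
  · subst hQ
    obtain ⟨a, ha⟩ := exists_coeff ht0 (x := c) (by
      rw [ht]; convert hc using 2; simp; ring)
    have := h.1 Q _ (M_anti (le_of_eq (by rw [ht]; ring)) ha)
    rwa [map_sub, map_smul, hω, smul_zero, sub_zero] at this
  · exact h.1 Q c (by simpa [Finsupp.single_apply, Ne.symm hQ] using hc)

theorem Om_fin_aux (N : ℤ) (hN : ∀ D : Pl k C →₀ ℤ, N ≤ dg D → gm D = gg k C) :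
    ∀ n : ℕ, ∀ D : Pl k C →₀ ℤ, N - dg D ≤ n →
      FiniteDimensional k (Om D) ∧ (Module.finrank k (Om D) : ℤ) ≤ gg k C - gm D := by
  intro n
  induction n with
  | zero =>
    intro D hD
    have h := hN D (by push_cast at hD; linarith)
    rw [Om_nonspecial h, h]
    exact ⟨inferInstance, by simp⟩
  | succ n ih =>
    intro D hD
    obtain ⟨P⟩ := (pl_nonempty : Nonempty (Pl k C))
    obtain ⟨h1, h2⟩ := ih (D + Finsupp.single P 1) (by
      rw [map_add, dg_single]; push_cast at hD; linarith)
    obtain ⟨t, ht0, ht⟩ := exists_ord_eq P (- D P - 1)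
    have hle : Om (D + Finsupp.single P 1) ≤ Om D := Om_anti (single_le D P (by norm_num))
    have hll := ll_mono (single_le D P (n := 1) (by norm_num))
    have hg : gm D ≤ gm (D + Finsupp.single P 1) := gm_mono (single_le D P (by norm_num))
    by_cases hex : ∃ ω ∈ Om D, ω P t ≠ 0
    · obtain ⟨ω, hω, hωt⟩ := hex
      have e : Om D = Om (D + Finsupp.single P 1) ⊔ Submodule.span k {ω} := by
        refine le_antisymm ?_ (sup_le hle ((Submodule.span_singleton_le_iff_mem _ _).mpr hω))
        intro η hη
        rw [Submodule.mem_sup]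
        refine ⟨η - (η P t / ω P t) • ω, mem_Om_step ht0 ht
          (sub_mem hη (Submodule.smul_mem _ _ hω)) ?_, (η P t / ω P t) • ω,
          Submodule.smul_mem _ _ (Submodule.mem_span_singleton_self _), by abel⟩
        simp [hωt]
      have hle2 : Ls (D + Finsupp.single P 1) ≤ Ls D := by
        intro f hf
        by_contra hf'
        apply hωt
        have hf0 : f ≠ 0 := by rintro rfl; exact hf' (zero_mem _)
        have hωf := om_step hω hf
        have hfP : f ∈ M P (- D P - 1) := by
          have := mem_Ls.mp hf P
          convert this using 2; simp; ring
        have hfP' : f ∉ M P (- D P) := by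
          intro h
          apply hf'
          rw [mem_Ls]
          intro Q
          by_cases hQ : Q = P
          · subst hQ; exact h
          · exact mem_Ls_of_step hf hQ
        rw [mem_M' hf0] at hfP hfP'
        have hfo : ord P f = - D P - 1 := by omega
        obtain ⟨a, ha⟩ := exists_coeff hf0 (x := t) (P := P) (by
          rw [hfo, ← ht]; exact mem_M_ord P t)
        have := hω.1 P _ (M_anti (le_of_eq (by rw [hfo]; ring)) ha)
        rwa [map_sub, map_smul, hωf, smul_zero, sub_zero] at this
      have hll2 : ll (D + Finsupp.single P 1) ≤ ll D := by
        have := Submodule.finrank_mono hle2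
        unfold ll; exact_mod_cast this
      have h3 := Submodule.finrank_add_le_finrank_add_finrank (Om (D + Finsupp.single P 1))
        (Submodule.span k {ω})
      rw [finrank_span_singleton (by rintro rfl; simp at hωt), ← e] at h3
      refine ⟨by rw [e]; infer_instance, ?_⟩
      have h4 : gm (D + Finsupp.single P 1) = gm D + 1 := by
        rw [gm, gm, map_add, dg_single]; linarith
      have : (Module.finrank k (Om D) : ℤ) ≤ Module.finrank k (Om (D + Finsupp.single P 1)) + 1 := by
        exact_mod_cast h3
      linarith
    · push Not at hex
      have e : Om D = Om (D + Finsupp.single P 1) :=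
        le_antisymm (fun ω hω => mem_Om_step ht0 ht hω (hex ω hω)) hle
      rw [e]
      exact ⟨h1, by linarith⟩

theorem Om_fin (D : Pl k C →₀ ℤ) :
    FiniteDimensional k (Om D) ∧ (Module.finrank k (Om D) : ℤ) ≤ gg k C - gm D := by
  obtain ⟨N, hN⟩ := riemann k C
  exact Om_fin_aux N hN (N - dg D).toNat D (Int.self_le_toNat _)

theorem exists_om {D : Pl k C →₀ ℤ} {P : Pl k C} (h : Ls (D + Finsupp.single P 1) ≤ Ls D) :
    ∃ ω ∈ Om D, ω ≠ 0 := by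
  classical
  obtain ⟨t, ht0, ht⟩ := exists_ord_eq P (- D P - 1)
  let N : Submodule k (Pl k C →₀ C) :=
    { carrier := {x | ∃ c : C, ∀ Q, x Q - c ∈ M Q (- D Q)}
      zero_mem' := ⟨0, fun Q => by simp⟩
      add_mem' := by
        rintro x y ⟨a, ha⟩ ⟨b, hb⟩
        refine ⟨a + b, fun Q => ?_⟩
        have := add_mem (ha Q) (hb Q)
        rwa [Finsupp.add_apply, add_sub_add_comm]
      smul_mem' := by
        rintro r x ⟨a, ha⟩
        refine ⟨r • a, fun Q => ?_⟩
        have := Submodule.smul_mem _ r (ha Q)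
        rwa [smul_sub] at this }
  have hN : Finsupp.single P t ∉ N := by
    rintro ⟨c, hc⟩
    have h1 : ∀ Q, Q ≠ P → c ∈ M Q (- D Q) := fun Q hQ => by
      have := neg_mem (hc Q)
      simpa [Finsupp.single_apply, Ne.symm hQ] using this
    have h2 : t - c ∈ M P (- D P) := by simpa using hc P
    have h3 : c ∈ Ls (D + Finsupp.single P 1) := by
      rw [mem_Ls]
      intro Q
      by_cases hQ : Q = P
      · subst hQ
        have h4 : t ∈ M Q (- D Q - 1) := ht ▸ mem_M_ord Q t
        have h5 := sub_mem h4 (M_anti (by omega) h2)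
        rw [sub_sub_cancel] at h5
        convert h5 using 2; simp; ring
      · simpa [Finsupp.single_apply, Ne.symm hQ] using h1 Q hQ
    have h4 := add_mem h2 (mem_Ls.mp (h h3) P)
    rw [sub_add_cancel, mem_M' ht0, ht] at h4
    omega
  obtain ⟨l, hl, hlN⟩ := Submodule.exists_le_ker_of_notMem hN
  refine ⟨fun Q => l.comp (Finsupp.lsingle Q), ⟨fun Q c hc => ?_, fun c => ?_⟩, ?_⟩
  · have : Finsupp.single Q c ∈ N := ⟨0, fun R => by
      by_cases hR : Q = R
      · subst hR; simpa using hc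
      · simp [Finsupp.single_apply, hR]⟩
    exact hlN this
  · have hfin := bad_finite D c
    have hx : ∑ Q ∈ hfin.toFinset, Finsupp.single Q c ∈ N := by
      refine ⟨c, fun R => ?_⟩
      rw [Finsupp.finsetSum_apply]
      by_cases hR : c ∈ M R (- D R)
      · rw [Finset.sum_eq_zero, zero_sub]
        · exact neg_mem hR
        · intro Q hQ
          rw [Finsupp.single_apply, if_neg]
          rintro rfl
          simp at hQ; exact hQ hR
      · rw [Finset.sum_eq_single R]
        · simp
        · intro Q _ hQ; simp [Finsupp.single_apply, hQ]
        · intro hh; simp at hh; exact absurd hh hR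
    have h1 := hlN hx
    rw [LinearMap.mem_ker, map_sum] at h1
    rw [finsum_eq_sum_of_support_subset (s := hfin.toFinset)]
    · exact h1
    · intro Q hQ
      simp only [Set.Finite.coe_toFinset, Set.mem_ofPred_eq]
      intro hc
      apply hQ
      have : Finsupp.single Q c ∈ N := ⟨0, fun R => by
        by_cases hR : Q = R
        · subst hR; simpa using hc
        · simp [Finsupp.single_apply, hR]⟩
      exact hlN this
  · intro h0
    apply hl
    have := congrFun h0 P
    have := LinearMap.congr_fun this t
    simpa using this

theorem ll_neg {D : Pl k C →₀ ℤ} (h : dg D < 0) : ll D = 0 := by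
  by_contra hne
  obtain ⟨f, hf0, hf⟩ := exists_of_ll_pos (lt_of_le_of_ne (ll_nonneg D) (Ne.symm hne))
  rw [mem_Ls' hf0] at hf
  have := dg_nonneg hf
  rw [map_add, dg_dv hf0] at this
  linarith

theorem exists_om_of_max {D : Pl k C →₀ ℤ} (hD : gm D ≠ gg k C)
    (hmax : ∀ E : Pl k C →₀ ℤ, dg D < dg E → gm E = gg k C) : ∃ ω ∈ Om D, ω ≠ 0 := by
  obtain ⟨P⟩ := (pl_nonempty : Nonempty (Pl k C))
  apply exists_om (P := P)
  have h1 := hmax (D + Finsupp.single P 1) (by rw [map_add, dg_single]; linarith)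
  have h2 := lt_of_le_of_ne (gm_le D) hD
  have hle := Ls_mono (single_le D P (n := 1) (by norm_num))
  have h3 : ll (D + Finsupp.single P 1) ≤ ll D := by
    rw [gm, map_add, dg_single] at h1
    rw [gm] at h2
    linarith
  refine (Submodule.eq_of_le_of_finrank_le hle ?_).ge
  unfold ll at h3; exact_mod_cast h3

/-- dimension of the differentials at the maximal special class -/
theorem ll_max {D : Pl k C →₀ ℤ} (hD : gm D ≠ gg k C)
    (hmax : ∀ E : Pl k C →₀ ℤ, dg D < dg E → gm E = gg k C) : gm D = gg k C - 1 := by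
  obtain ⟨P⟩ := (pl_nonempty : Nonempty (Pl k C))
  have h1 := hmax (D + Finsupp.single P 1) (by rw [map_add, dg_single]; linarith)
  have h2 := lt_of_le_of_ne (gm_le D) hD
  have h3 := ll_mono (single_le D P (n := 1) (by norm_num))
  rw [gm, map_add, dg_single] at h1
  rw [gm] at *
  linarith

theorem mulOm_inj {η : Pl k C → Module.Dual k C} (hη : η ≠ 0) : Function.Injective (mulOm η) := by
  rw [← LinearMap.ker_eq_bot, eq_bot_iff]
  intro g hg
  by_contra hg0
  apply hη
  funext Q; ext c
  have := LinearMap.congr_fun (congrFun (LinearMap.mem_ker.mp hg) Q) (g⁻¹ * c)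
  rw [mulOm_apply, mul_inv_cancel_left₀ hg0] at this
  exact this

theorem om_common {D D' F : Pl k C →₀ ℤ} {ω ω' : Pl k C → Module.Dual k C} (hω : ω ∈ Om D)
    (hω' : ω' ∈ Om D') (h0 : ω ≠ 0) (h0' : ω' ≠ 0)
    (hlt : gg k C - gm F < ll (D - F) + ll (D' - F)) :
    ∃ f f' : C, f ≠ 0 ∧ f' ≠ 0 ∧ mulOm ω f = mulOm ω' f' := by
  obtain ⟨hfin, hrk⟩ := Om_fin F
  have h1 : (Ls (D - F)).map (mulOm ω) ≤ Om F := by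
    rintro _ ⟨f, hf, rfl⟩
    have := mulOm_mem hω hf
    rwa [sub_sub_cancel] at this
  have h2 : (Ls (D' - F)).map (mulOm ω') ≤ Om F := by
    rintro _ ⟨f, hf, rfl⟩
    have := mulOm_mem hω' hf
    rwa [sub_sub_cancel] at this
  have e1 : Module.finrank k ((Ls (D - F)).map (mulOm ω)) = Module.finrank k (Ls (D - F)) :=
    (Submodule.equivMapOfInjective _ (mulOm_inj h0) _).finrank_eq.symm
  have e2 : Module.finrank k ((Ls (D' - F)).map (mulOm ω')) = Module.finrank k (Ls (D' - F)) :=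
    (Submodule.equivMapOfInjective _ (mulOm_inj h0') _).finrank_eq.symm
  have h3 := Submodule.finrank_sup_add_finrank_inf_eq ((Ls (D - F)).map (mulOm ω))
    ((Ls (D' - F)).map (mulOm ω'))
  have h4 := Submodule.finrank_mono (sup_le h1 h2)
  rw [e1, e2] at h3
  have h5 : (Ls (D - F)).map (mulOm ω) ⊓ (Ls (D' - F)).map (mulOm ω') ≠ ⊥ := by
    intro h
    rw [h, finrank_bot] at h3
    unfold ll at hlt
    omega
  obtain ⟨w, ⟨⟨f, hf, hfw⟩, ⟨f', hf', hfw'⟩⟩, hw⟩ := Submodule.exists_mem_ne_zero_of_ne_bot h5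
  refine ⟨f, f', ?_, ?_, hfw.trans hfw'.symm⟩
  · rintro rfl; exact hw (by rw [← hfw, map_zero])
  · rintro rfl; exact hw (by rw [← hfw', map_zero])

theorem max_special_unique {D D' : Pl k C →₀ ℤ} (hd : dg D' = dg D) (hD : gm D ≠ gg k C)
    (hD' : gm D' ≠ gg k C)
    (hmax : ∀ E : Pl k C →₀ ℤ, dg D < dg E → gm E = gg k C) :
    ∃ f : C, f ≠ 0 ∧ D' = D + dv k f := by
  obtain ⟨ω, hω, hω0⟩ := exists_om_of_max hD hmax
  obtain ⟨ω', hω', hω0'⟩ := exists_om_of_max hD' (hd ▸ hmax)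
  obtain ⟨P⟩ := (pl_nonempty : Nonempty (Pl k C))
  -- a very negative divisor
  obtain ⟨m, hm⟩ : ∃ m : ℤ, m = |dg D| * 2 + |gg k C| * 3 + 1 := ⟨_, rfl⟩
  have hdF : dg (Finsupp.single P (- m)) = - m := dg_single _ _
  obtain ⟨f, f', hf0, hf0', e⟩ := om_common (F := Finsupp.single P (- m)) hω hω' hω0 hω0' (by
    have h1 := gm_le (D - Finsupp.single P (- m))
    have h2 := gm_le (D' - Finsupp.single P (- m))
    have := abs_nonneg (dg D); have := abs_nonneg (gg k C)
    have h3 := ll_neg (D := Finsupp.single P (- m)) (by rw [hdF]; linarith)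
    have h4 : gm (Finsupp.single P (- m)) = - m := by rw [gm, hdF, h3, sub_zero]
    rw [h4]
    rw [gm, map_sub, hdF] at h1 h2
    have := neg_abs_le (dg D); have := le_abs_self (gg k C)
    rw [hd] at h2
    linarith)
  set h := f * f'⁻¹ with hh
  have hh0 : h ≠ 0 := mul_ne_zero hf0 (inv_ne_zero hf0')
  have e2 : ω' = mulOm ω h := by
    funext Q; ext c
    have := LinearMap.congr_fun (congrFun e Q) (f'⁻¹ * c)
    rw [mulOm_apply, mulOm_apply, mul_inv_cancel_left₀ hf0', ← mul_assoc] at this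
    exact this.symm
  have h1 : ω' ∈ Om (D + dv k h) := e2 ▸ mulOm_mem' hω hh0
  have h2 := Om_sup hω' h1
  have h3 : ¬ dg D < dg (D' ⊔ (D + dv k h)) := by
    intro hlt
    have := Om_nonspecial (hmax _ hlt)
    rw [this, Submodule.mem_bot] at h2
    exact hω0' h2
  push Not at h3
  refine ⟨h, hh0, ?_⟩
  have e3 : D' = D' ⊔ (D + dv k h) := eq_of_dg le_sup_left (by rw [hd]; exact h3)
  have e4 : D + dv k h = D' ⊔ (D + dv k h) := eq_of_dg le_sup_right (by
    rw [map_add, dg_dv hh0, add_zero]; exact h3)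
  rw [e3]; exact e4.symm

end DD
end RatCurve

namespace RatCurve

section FFF
set_option linter.unusedSectionVars false
open Polynomial
variable {k : Type*} [Field k] [IsAlgClosed k]

/-- auxiliary polynomials -/
noncomputable def bpol (a : ℕ → k) (q : ℕ) : ℕ → k[X]
  | 0 => Polynomial.C (a 0) * X ^ q
  | i + 1 => (bpol a q i) ^ q + Polynomial.C (a (i + 1)) * X ^ q

theorem bpol_dvd (a : ℕ → k) {q : ℕ} (hq : 2 ≤ q) (i : ℕ) : X ^ 2 ∣ bpol a q i := by
  induction i with
  | zero => exact Dvd.dvd.mul_left (pow_dvd_pow _ hq) _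
  | succ i ih =>
    exact dvd_add (dvd_pow ih (by omega)) (Dvd.dvd.mul_left (pow_dvd_pow _ hq) _)

theorem bpol_ne (a : ℕ → k) {q : ℕ} (hq : 2 ≤ q) (i : ℕ) (h : ∃ j ≤ i, a j ≠ 0) :
    bpol a q i ≠ 0 := by
  induction i with
  | zero =>
    obtain ⟨j, hj, hj'⟩ := h
    obtain rfl : j = 0 := by omega
    simp [bpol, hj']
  | succ i ih =>
    by_cases hb : bpol a q i = 0
    · have : a (i + 1) ≠ 0 := by
        obtain ⟨j, hj, hj'⟩ := h
        by_cases hji : j = i + 1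
        · rwa [← hji]
        · exact absurd hb (ih ⟨j, by omega, hj'⟩)
      simp [bpol, hb, this, show q ≠ 0 by omega]
    · intro h0
      obtain ⟨r, hr⟩ := bpol_dvd a hq i
      have h1 : (bpol a q i) ^ q = - (Polynomial.C (a (i + 1)) * X ^ q) := by
        rw [bpol] at h0; exact eq_neg_of_add_eq_zero_left h0
      have h2 := congrArg natDegree h1
      rw [natDegree_neg, natDegree_pow] at h2
      have h3 := natDegree_C_mul_X_pow_le (a (i+1)) q
      have h4 : 2 ≤ (bpol a q i).natDegree := by
        have := natDegree_le_of_dvd (bpol_dvd a hq i) hb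
        simpa using this
      rw [← h2] at h3
      nlinarith

variable {V : Type*} [AddCommGroup V] [Module k V] [FiniteDimensional k V]
  {σ : k →+* k} {q : ℕ}

theorem exists_fixed (hσ : ∀ c, σ c = c ^ q) (hq : 2 ≤ q) (ψ : V →ₛₗ[σ] V)
    (hψ : Function.Injective ψ) [Nontrivial V] : ∃ v : V, v ≠ 0 ∧ ψ v = v := by
  classical
  obtain ⟨w, hw⟩ := exists_ne (0 : V)
  let f : ℕ → V := fun i => ψ^[i] w
  have hfs : ∀ i, ψ (f i) = f (i + 1) := fun i => (Function.iterate_succ_apply' ψ i w).symm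
  have hf0 : ∀ i, f i ≠ 0 := by
    intro i
    induction i with
    | zero => exact hw
    | succ i ih =>
      rw [← hfs]; intro h; exact ih (hψ (by rw [h, map_zero]))
  have hex : ∃ m, f m ∈ Submodule.span k (f '' (Set.Iio m)) := by
    by_contra hh
    push Not at hh
    have hli : LinearIndependent k (fun i : Fin (Module.finrank k V + 1) => f i) := by
      have : ∀ n : ℕ, LinearIndependent k (fun i : Fin n => f i) := by
        intro n
        induction n with
        | zero => exact linearIndependent_empty_type
        | succ n ih =>
          rw [linearIndependent_finSucc']
          refine ⟨ih, ?_⟩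
          simp only [Fin.val_last]
          intro hm
          apply hh n
          refine Submodule.span_mono ?_ hm
          rintro _ ⟨i, rfl⟩
          exact ⟨i, by simp, rfl⟩
      exact this _
    have := hli.fintype_card_le_finrank
    simp at this
  let m := Nat.find hex
  have hm : f m ∈ Submodule.span k (f '' (Set.Iio m)) := Nat.find_spec hex
  have hm0 : m ≠ 0 := by
    intro h
    rw [h] at hm
    simp at hm
    exact hf0 0 hm
  obtain ⟨n, hn⟩ := Nat.exists_eq_succ_of_ne_zero hm0
  have hn' : f n ∉ Submodule.span k (f '' (Set.Iio n)) := Nat.find_min hex (by omega)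
  rw [hn] at hm
  have hsum : ∃ a : ℕ → k, f (n + 1) = ∑ i ∈ Finset.range (n + 1), a i • f i := by
    have e : (Set.Iio (n + 1)) = ((Finset.range (n + 1) : Finset ℕ) : Set ℕ) := by
      ext; simp
    rw [Nat.succ_eq_add_one, e, Submodule.mem_span_image_finset_iff_exists_fun] at hm
    obtain ⟨a, ha⟩ := hm
    refine ⟨fun i => if h : i ∈ Finset.range (n + 1) then a ⟨i, h⟩ else 0, ?_⟩
    rw [← ha, ← Finset.sum_coe_sort (Finset.range (n + 1))]
    exact Finset.sum_congr rfl fun i _ => by simp only [dif_pos i.2]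
  obtain ⟨a, ha⟩ := hsum
  have hane : ∃ j ≤ n, a j ≠ 0 := by
    by_contra hh
    push Not at hh
    refine hf0 (n + 1) (ha.trans (Finset.sum_eq_zero fun i hi => ?_))
    rw [hh i (by simp at hi; omega), zero_smul]
  obtain ⟨r, hr⟩ := bpol_dvd a hq n
  have hr0 : r ≠ 0 := by
    rintro rfl
    exact bpol_ne a hq n hane (by rw [hr, mul_zero])
  obtain ⟨t, ht⟩ := IsAlgClosed.exists_root (X * r - 1 : k[X]) (by
    intro h
    have h1 : (X * r : k[X]).degree = 0 := by
      have h2 := (X * r - 1 : k[X])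
      have : X * r = (X * r - 1) + 1 := by ring
      have h3 := degree_add_le (X * r - 1 : k[X]) 1
      rw [← this, h, degree_one, max_self] at h3
      rw [degree_mul, degree_X, degree_eq_natDegree hr0] at h3
      norm_cast at h3
      omega
    rw [degree_mul, degree_X, degree_eq_natDegree hr0] at h1
    norm_cast at h1
    omega)
  have ht1 : t * r.eval t = 1 := by
    simpa [sub_eq_zero] using ht
  have ht0 : t ≠ 0 := by rintro rfl; simp at ht1
  have hbt : (bpol a q n).eval t = t := by
    rw [hr]; simp only [eval_mul, eval_pow, eval_X]
    rw [pow_two, mul_assoc, ht1, mul_one]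
  let b : ℕ → k := fun i => (bpol a q i).eval t
  have hb0 : b 0 = a 0 * t ^ q := by simp [b, bpol]
  have hbs : ∀ i, b (i + 1) = b i ^ q + a (i + 1) * t ^ q := fun i => by simp [b, bpol]
  have hbn : b n = t := hbt
  refine ⟨∑ i ∈ Finset.range (n + 1), b i • f i, ?_, ?_⟩
  · intro h0
    rw [Finset.sum_range_succ, hbn] at h0
    apply hn'
    have : f n = - (t⁻¹ • ∑ i ∈ Finset.range n, b i • f i) := by
      have h1 := eq_neg_of_add_eq_zero_right h0
      rw [← smul_neg, ← h1, smul_smul, inv_mul_cancel₀ ht0, one_smul]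
    rw [this]
    refine neg_mem (Submodule.smul_mem _ _ (sum_mem fun i hi => Submodule.smul_mem _ _
      (Submodule.subset_span ⟨i, by simpa using hi, rfl⟩)))
  · rw [map_sum]
    have : ∀ i, ψ (b i • f i) = b i ^ q • f (i + 1) := fun i => by
      rw [LinearMap.map_smulₛₗ, hσ, hfs]
    simp only [this]
    rw [Finset.sum_range_succ, hbn, ha, Finset.smul_sum, Finset.sum_range_succ',
      Finset.sum_range_succ' (fun i => b i • f i), ← add_assoc, ← Finset.sum_add_distrib]
    congr 1
    · refine Finset.sum_congr rfl fun i _ => ?_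
      rw [hbs, smul_smul, ← add_smul, mul_comm (t ^ q)]
    · rw [hb0, smul_smul, mul_comm]

theorem card_roots (hq : 2 ≤ q) (hqk : (q : k) = 0) : Nat.card {a : k // a ^ q = a} = q := by
  classical
  have hsep : (X ^ q - X : k[X]).Separable := by
    rw [Polynomial.separable_def]
    refine ⟨0, -1, ?_⟩
    simp [derivative_X_pow, hqk]
  have hne : (X ^ q - X : k[X]) ≠ 0 := FiniteField.X_pow_card_sub_X_ne_zero k (by omega)
  have h1 := card_rootSet_eq_natDegree (K := k) hsep (IsAlgClosed.splits _)
  rw [FiniteField.X_pow_card_sub_X_natDegree_eq k (by omega)] at h1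
  refine Eq.trans ?_ h1
  rw [← Nat.card_eq_fintype_card]
  refine Nat.card_congr (Equiv.subtypeEquivRight fun a => ?_)
  rw [mem_rootSet_of_ne hne]
  simp [sub_eq_zero]

theorem exists_as (hq : 2 ≤ q) (c : k) : ∃ a : k, a ^ q + c = a := by
  obtain ⟨a, ha⟩ := IsAlgClosed.exists_root (X ^ q - X + Polynomial.C c : k[X]) (by
    have h1 : (X ^ q - X + Polynomial.C c : k[X]).natDegree = q := by
      rw [natDegree_add_C, FiniteField.X_pow_card_sub_X_natDegree_eq k (by omega)]
    intro h
    have h2 := natDegree_eq_zero_iff_degree_le_zero.mpr h.le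
    omega)
  refine ⟨a, ?_⟩
  simp at ha
  linear_combination ha

theorem lang_card (hσ : ∀ c, σ c = c ^ q) (hq : 2 ≤ q) (hqk : (q : k) = 0) (n : ℕ) :
    ∀ (V : Type*) [AddCommGroup V] [Module k V] [FiniteDimensional k V] (ψ : V →ₛₗ[σ] V),
    Function.Injective ψ → Module.finrank k V = n → Nat.card {v : V // ψ v = v} = q ^ n := by
  induction n with
  | zero =>
    intro V _ _ _ ψ _ h
    have := Module.finrank_zero_iff.mp h
    have : Unique {v : V // ψ v = v} := ⟨⟨⟨0, map_zero _⟩⟩, fun v => Subtype.ext (Subsingleton.elim _ _)⟩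
    simp
  | succ n ih =>
    intro V _ _ _ ψ hψ h
    have : Nontrivial V := Module.nontrivial_of_finrank_pos (R := k) (by omega)
    obtain ⟨v, hv0, hv⟩ := exists_fixed hσ hq ψ hψ
    have hsm : ∀ (c : k) (x : V), ψ (c • x) = c ^ q • ψ x := fun c x => by
      rw [LinearMap.map_smulₛₗ, hσ]
    let L := Submodule.span k {v}
    have hL : L ≤ L.comap ψ := by
      rw [Submodule.span_singleton_le_iff_mem, Submodule.mem_comap, hv]
      exact Submodule.mem_span_singleton_self v
    let ψ' : (V ⧸ L) →ₛₗ[σ] (V ⧸ L) := L.mapQ L ψ hL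
    have hψ'mk : ∀ x, ψ' (L.mkQ x) = L.mkQ (ψ x) := fun x => rfl
    have hinj : Function.Injective ψ' := by
      rw [injective_iff_map_eq_zero]
      intro x
      obtain ⟨x, rfl⟩ := L.mkQ_surjective x
      intro hx
      rw [hψ'mk, Submodule.mkQ_apply, Submodule.Quotient.mk_eq_zero,
        Submodule.mem_span_singleton] at hx
      obtain ⟨c, hc⟩ := hx
      obtain ⟨d, hd⟩ := IsAlgClosed.exists_pow_nat_eq c (n := q) (by omega)
      rw [Submodule.mkQ_apply, Submodule.Quotient.mk_eq_zero, Submodule.mem_span_singleton]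
      exact ⟨d, hψ (by rw [hsm, hv, hd, hc])⟩
    have hdim : Module.finrank k (V ⧸ L) = n := by
      have := L.finrank_quotient_add_finrank
      rw [finrank_span_singleton hv0] at this
      omega
    have hW := ih (V ⧸ L) ψ' hinj hdim
    have hlift : ∀ y : {y : V ⧸ L // ψ' y = y}, ∃ w : V, ψ w = w ∧ L.mkQ w = y.1 := by
      rintro ⟨y, hy⟩
      obtain ⟨x, rfl⟩ := L.mkQ_surjective y
      rw [hψ'mk, ← sub_eq_zero, ← map_sub, Submodule.mkQ_apply, Submodule.Quotient.mk_eq_zero,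
        Submodule.mem_span_singleton] at hy
      obtain ⟨c, hc⟩ := hy
      obtain ⟨a, ha⟩ := exists_as (k := k) hq c
      refine ⟨x + a • v, ?_, ?_⟩
      · rw [map_add, hsm, hv, ← sub_add_cancel (ψ x) x, ← hc]
        have : a • v = a ^ q • v + c • v := by rw [← add_smul, ha]
        rw [this]; abel
      · rw [map_add, add_eq_left, Submodule.mkQ_apply, Submodule.Quotient.mk_eq_zero]
        exact Submodule.smul_mem _ _ (Submodule.mem_span_singleton_self v)
    choose s hs1 hs2 using hlift
    let T : {y : V ⧸ L // ψ' y = y} × {a : k // a ^ q = a} → {v : V // ψ v = v} := fun p =>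
      ⟨s p.1 + p.2.1 • v, by rw [map_add, hs1, hsm, hv, p.2.2]⟩
    have hTq : ∀ p, L.mkQ (T p).1 = p.1.1 := by
      intro p
      have : L.mkQ (p.2.1 • v) = 0 := by
        rw [Submodule.mkQ_apply, Submodule.Quotient.mk_eq_zero]
        exact Submodule.smul_mem _ _ (Submodule.mem_span_singleton_self v)
      simp only [T]
      rw [map_add, hs2, this, add_zero]
    have hT : Function.Bijective T := by
      constructor
      · intro p p' hpp
        have h1 : p.1 = p'.1 := Subtype.ext (by rw [← hTq, ← hTq, hpp])
        have h2 := congrArg Subtype.val hpp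
        simp only [T, h1, add_right_inj] at h2
        exact Prod.ext h1 (Subtype.ext (smul_left_injective k hv0 h2))
      · rintro ⟨w, hw⟩
        let y : {y : V ⧸ L // ψ' y = y} := ⟨L.mkQ w, by rw [hψ'mk, hw]⟩
        have : w - s y ∈ L := by
          rw [← Submodule.Quotient.mk_eq_zero, ← Submodule.mkQ_apply, map_sub, hs2, sub_self]
        rw [Submodule.mem_span_singleton] at this
        obtain ⟨a, ha⟩ := this
        have haq : a ^ q = a := by
          apply smul_left_injective k hv0
          simp only
          have := congrArg ψ ha
          rw [hsm, hv, map_sub, hw, hs1, ← ha] at this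
          exact this
        exact ⟨(y, ⟨a, haq⟩), Subtype.ext (by simp [T, ha])⟩
    rw [← Nat.card_congr (Equiv.ofBijective T hT), Nat.card_prod, hW, card_roots hq hqk, pow_succ]

end FFF
end RatCurve

namespace RatCurve

section GGG
set_option linter.unusedSectionVars false
open PowerSeries

/-- invariant effective divisors of given degree -/
abbrev XD {α : Type*} (σ : Equiv.Perm α) (d : ℕ) : Type _ :=
  {D : α →₀ ℤ // 0 ≤ D ∧ (∀ x, D (σ x) = D x) ∧ D.degree = d}

/-- orbits -/
def Orb {α : Type*} (σ : Equiv.Perm α) : Type _ := Quotient (Equiv.Perm.SameCycle.setoid σ)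

def orb {α : Type*} (σ : Equiv.Perm α) (x : α) : Orb σ := Quotient.mk _ x

variable {α : Type*}

theorem orb_eq {σ : Equiv.Perm α} {x y : α} : orb σ x = orb σ y ↔ σ.SameCycle x y :=
  Quotient.eq (r := Equiv.Perm.SameCycle.setoid σ)

theorem orb_surj (σ : Equiv.Perm α) : Function.Surjective (orb σ) := Quotient.mk_surjective

noncomputable def wt (σ : Equiv.Perm α) (o : Orb σ) : ℕ := Nat.card {x // orb σ x = o}

theorem wt_orb [Finite α] (σ : Equiv.Perm α) (x : α) : wt σ (orb σ x) = Function.minimalPeriod σ x := by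
  classical
  have := Fintype.ofFinite α
  have h := MulAction.minimalPeriod_eq_card (a := σ) (b := x)
  have h2 : (fun y : α => σ • y) = σ := rfl
  rw [h2] at h
  rw [h, ← Nat.card_eq_fintype_card, wt]
  refine Nat.card_congr (Equiv.subtypeEquivRight fun y => ?_)
  rw [orb_eq, Equiv.Perm.sameCycle_comm, MulAction.mem_orbit_iff]
  constructor
  · rintro ⟨i, hi⟩
    exact ⟨⟨σ ^ i, i, rfl⟩, hi⟩
  · rintro ⟨⟨_, i, rfl⟩, hi⟩
    exact ⟨i, hi⟩

theorem wt_pos [Finite α] (σ : Equiv.Perm α) (o : Orb σ) : 0 < wt σ o := by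
  obtain ⟨x, rfl⟩ := orb_surj σ o
  exact Nat.card_pos_iff.mpr ⟨⟨x, rfl⟩, inferInstance⟩

instance [Finite α] (σ : Equiv.Perm α) : Finite (Orb σ) := Finite.of_surjective _ (orb_surj σ)

theorem sum_orb [Fintype α] (σ : Equiv.Perm α) [Fintype (Orb σ)] (g : Orb σ → ℤ) :
    ∑ x, g (orb σ x) = ∑ o, (wt σ o : ℤ) * g o := by
  classical
  rw [← Finset.sum_fiberwise Finset.univ (orb σ)]
  refine Finset.sum_congr rfl fun o _ => ?_
  rw [Finset.sum_congr rfl (g := fun _ => g o) (fun x hx => by rw [(Finset.mem_filter.mp hx).2]),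
    Finset.sum_const, nsmul_eq_mul, wt, Nat.card_eq_fintype_card, Fintype.card_subtype]

theorem inv_orb {σ : Equiv.Perm α} {β : Type*} {D : α → β} (h : ∀ x, D (σ x) = D x) {x y : α}
    (hxy : orb σ x = orb σ y) : D x = D y := by
  obtain ⟨i, rfl⟩ := orb_eq.mp hxy
  have h1 : ∀ (n : ℕ) x, D ((σ ^ n) x) = D x := by
    intro n
    induction n with
    | zero => intro x; rfl
    | succ n ih => intro x; rw [pow_succ', Equiv.Perm.mul_apply, h, ih]
  obtain ⟨n, rfl | rfl⟩ := i.eq_nat_or_neg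
  · rw [zpow_natCast, h1]
  · have := h1 n ((σ ^ (-(n:ℤ))) x)
    rw [← this, ← Equiv.Perm.mul_apply, ← zpow_natCast, ← zpow_add]; simp

theorem orb_apply (σ : Equiv.Perm α) (x : α) : orb σ (σ x) = orb σ x :=
  orb_eq.mpr ⟨-1, by simp⟩

variable {K : Type*} [Field K]

theorem coeff_orb [Fintype α] (σ : Equiv.Perm α) [Fintype (Orb σ)] (d : ℕ) :
    coeff d (∏ o : Orb σ, PowerSeries.mk (fun m => if wt σ o ∣ m then (1:K) else 0)) =
      (Nat.card (XD σ d) : K) := by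
  classical
  rw [coeff_prod]
  simp only [coeff_mk, Finset.prod_ite_zero, Finset.prod_const_one]
  rw [Finset.sum_boole]
  congr 1
  symm
  rw [← Nat.card_eq_finsetCard]
  let T : {l // l ∈ (Finset.finsuppAntidiag Finset.univ d).filter
      (fun l : Orb σ →₀ ℕ => ∀ o ∈ Finset.univ, wt σ o ∣ l o)} → XD σ d := fun l =>
    ⟨Finsupp.equivFunOnFinite.symm (fun x => ((l.1 (orb σ x) / wt σ (orb σ x) : ℕ) : ℤ)),
      fun x => Int.natCast_nonneg _, fun x => by simp [orb_apply], by
        have h := Finset.mem_filter.mp l.2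
        have h1 := (Finset.mem_finsuppAntidiag.mp h.1).1
        rw [Finsupp.degree_eq_sum]
        simp only [Finsupp.equivFunOnFinite_symm_apply_apply]
        rw [sum_orb σ (fun o => ((l.1 o / wt σ o : ℕ) : ℤ))]
        refine Eq.trans ?_ (congrArg Nat.cast h1)
        rw [Nat.cast_sum]
        refine Finset.sum_congr rfl fun o _ => ?_
        rw [← Nat.cast_mul, Nat.mul_div_cancel' (h.2 o (Finset.mem_univ _))]⟩
  symm
  refine Nat.card_congr (Equiv.ofBijective T ⟨?_, ?_⟩)
  · intro l l' hl
    have h := (Finset.mem_filter.mp l.2).2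
    have h' := (Finset.mem_filter.mp l'.2).2
    refine Subtype.ext (Finsupp.ext fun o => ?_)
    obtain ⟨x, rfl⟩ := orb_surj σ o
    have e := DFunLike.congr_fun (congrArg Subtype.val hl) x
    simp only [T, Finsupp.equivFunOnFinite_symm_apply_apply] at e
    have e' := Int.natCast_inj.mp e
    rw [← Nat.mul_div_cancel' (h (orb σ x) (Finset.mem_univ _)), e',
      Nat.mul_div_cancel' (h' (orb σ x) (Finset.mem_univ _))]
  · rintro ⟨D, h0, h1, h2⟩
    let l : Orb σ →₀ ℕ := Finsupp.equivFunOnFinite.symm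
      (fun o => wt σ o * (D (Function.surjInv (orb_surj σ) o)).toNat)
    have hl : ∀ o, l o = wt σ o * (D (Function.surjInv (orb_surj σ) o)).toNat := fun o => rfl
    have hs : ∀ x, D (Function.surjInv (orb_surj σ) (orb σ x)) = D x := fun x =>
      inv_orb h1 (Function.surjInv_eq _ _)
    refine ⟨⟨l, ?_⟩, ?_⟩
    · rw [Finset.mem_filter, Finset.mem_finsuppAntidiag]
      refine ⟨⟨?_, Finset.subset_univ _⟩, fun o _ => ⟨_, hl o⟩⟩
      rw [← Int.natCast_inj, ← h2, Finsupp.degree_eq_sum, Nat.cast_sum]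
      have := sum_orb σ (fun o => D (Function.surjInv (orb_surj σ) o))
      simp only [hs] at this
      rw [this]
      refine Finset.sum_congr rfl fun o _ => ?_
      rw [hl, Nat.cast_mul, Int.toNat_of_nonneg (h0 _)]
    · refine Subtype.ext (Finsupp.ext fun x => ?_)
      simp only [T, Finsupp.equivFunOnFinite_symm_apply_apply]
      rw [hl, Nat.mul_div_cancel_left _ (wt_pos _ _), Int.toNat_of_nonneg (h0 _), hs]

theorem mk_dvd_mul {w : ℕ} (hw : 0 < w) :
    PowerSeries.mk (fun m => if w ∣ m then (1:K) else 0) * (1 - X ^ w) = 1 := by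
  ext m
  rw [mul_sub, mul_one, map_sub, coeff_mul_X_pow', coeff_mk, coeff_one]
  by_cases h0 : m = 0
  · subst h0; simp; omega
  · simp only [h0, if_false, coeff_mk]
    by_cases hm : w ≤ m
    · have : w ∣ m - w ↔ w ∣ m := by
        conv_rhs => rw [← Nat.sub_add_cancel hm]
        exact (Nat.dvd_add_self_right).symm
      simp [hm, this]
    · have : ¬ w ∣ m := fun h => hm (Nat.le_of_dvd (by omega) h)
      simp [hm, this]

theorem zfin [Fintype α] (σ : Equiv.Perm α) [Fintype (Orb σ)] :
    PowerSeries.mk (fun d => (Nat.card (XD σ d) : K)) * ∏ o : Orb σ, (1 - X ^ wt σ o) = 1 := by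
  have : PowerSeries.mk (fun d => (Nat.card (XD σ d) : K)) =
      ∏ o : Orb σ, PowerSeries.mk (fun m => if wt σ o ∣ m then (1:K) else 0) := by
    ext d; rw [coeff_orb, coeff_mk]
  rw [this, ← Finset.prod_mul_distrib]
  exact Finset.prod_eq_one fun o _ => mk_dvd_mul (wt_pos _ _)

theorem prod_period {R : Type*} [CommMonoid R] (f : ℕ → R) (m g : ℕ) (hf : ∀ i, f (i + m) = f i) :
    ∏ i ∈ Finset.range (m * g), f i = (∏ i ∈ Finset.range m, f i) ^ g := by
  induction g with
  | zero => simp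
  | succ g ih =>
    have hf' : ∀ j i, f (m * j + i) = f i := by
      intro j
      induction j with
      | zero => intro i; simp
      | succ j ihj => intro i; rw [← ihj i, ← hf (m * j + i)]; congr 1; ring
    rw [Nat.mul_succ, Finset.prod_range_add, ih, pow_succ]
    congr 1
    exact Finset.prod_congr rfl fun i _ => hf' g i

theorem prod_prim {R : Type*} [CommRing R] [IsDomain R] {ζ : R} {n : ℕ} (hn : 0 < n)
    (h : IsPrimitiveRoot ζ n) (x : R) : ∏ i ∈ Finset.range n, (1 - ζ ^ i * x) = 1 - x ^ n := by
  classical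
  have := h.pow_sub_pow_eq_prod_sub_mul 1 x hn
  rw [one_pow] at this
  rw [this]
  refine Finset.prod_bij (fun i _ => ζ ^ i) ?_ ?_ ?_ ?_
  · intro i _
    rw [Polynomial.mem_nthRootsFinset hn, ← pow_mul, mul_comm, pow_mul, h.pow_eq_one, one_pow]
  · intro i hi j hj hij
    exact h.pow_inj (Finset.mem_range.mp hi) (Finset.mem_range.mp hj) hij
  · intro y hy
    rw [Polynomial.mem_nthRootsFinset hn] at hy
    have : NeZero n := ⟨hn.ne'⟩
    obtain ⟨i, hi, e⟩ := h.eq_pow_of_pow_eq_one hy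
    exact ⟨i, Finset.mem_range.mpr hi, e⟩
  · intro i _; rfl

theorem prod_prim_gcd {R : Type*} [CommRing R] [IsDomain R] {ζ : R} {n : ℕ} (hn : 0 < n)
    (h : IsPrimitiveRoot ζ n) (w : ℕ) (x : R) :
    ∏ i ∈ Finset.range n, (1 - (ζ ^ i * x) ^ w) = (1 - x ^ (n * (w / Nat.gcd w n))) ^ (Nat.gcd w n) := by
  set g := Nat.gcd w n with hg
  have hg0 : 0 < g := Nat.gcd_pos_of_pos_right _ hn
  obtain ⟨m, hm⟩ : g ∣ n := Nat.gcd_dvd_right _ _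
  obtain ⟨v, hv⟩ : g ∣ w := Nat.gcd_dvd_left _ _
  have hm0 : 0 < m := Nat.pos_of_ne_zero (by rintro rfl; omega)
  have hp : IsPrimitiveRoot (ζ ^ w) m := by
    have h1 : IsPrimitiveRoot (ζ ^ g) m := h.pow hn hm
    rw [hv, pow_mul]
    refine h1.pow_of_coprime v ?_
    have h2 : Nat.gcd (g * v) (g * m) = g := by rw [← hv, ← hm]
    rw [Nat.gcd_mul_left] at h2
    exact Nat.eq_of_mul_eq_mul_left hg0 (by rw [h2, mul_one])
  have e1 : ∀ i, (1 - (ζ ^ i * x) ^ w) = 1 - (ζ ^ w) ^ i * x ^ w := fun i => by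
    rw [mul_pow, ← pow_mul, ← pow_mul, mul_comm i]
  simp only [e1]
  have e2 : Finset.range n = Finset.range (m * g) := by rw [hm, mul_comm]
  rw [e2, prod_period _ m g, prod_prim hm0 hp, ← pow_mul]
  · congr 3
    rw [hv, Nat.mul_div_cancel_left _ hg0, hm]; ring
  · intro i
    rw [pow_add, hp.pow_eq_one, mul_one]

/-- orbits of a power -/
def orbPow (σ : Equiv.Perm α) (n : ℕ) : Orb (σ ^ n) → Orb σ :=
  Quotient.lift (orb σ) fun x y h => by
    obtain ⟨i, hi⟩ : (σ ^ n).SameCycle x y := h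
    refine orb_eq.mpr ⟨n * i, ?_⟩
    rw [zpow_mul, zpow_natCast, hi]

theorem orbPow_orb (σ : Equiv.Perm α) (n : ℕ) (x : α) : orbPow σ n (orb (σ ^ n) x) = orb σ x := rfl

theorem wt_pow [Finite α] (σ : Equiv.Perm α) {n : ℕ} (hn : 0 < n) (o : Orb (σ ^ n)) :
    wt (σ ^ n) o = wt σ (orbPow σ n o) / Nat.gcd (wt σ (orbPow σ n o)) n := by
  obtain ⟨x, rfl⟩ := orb_surj _ o
  rw [orbPow_orb, wt_orb, wt_orb, ← Function.minimalPeriod_iterate_eq_div_gcd hn.ne',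
    Equiv.Perm.coe_pow]

theorem card_fib [Fintype α] (σ : Equiv.Perm α) {n : ℕ} (hn : 0 < n) [Fintype (Orb (σ ^ n))]
    [DecidableEq (Orb σ)] (o : Orb σ) :
    (Finset.univ.filter (fun o' => orbPow σ n o' = o)).card = Nat.gcd (wt σ o) n := by
  classical
  have h1 : wt σ o = ∑ o' ∈ Finset.univ.filter (fun o' => orbPow σ n o' = o), wt (σ ^ n) o' := by
    rw [wt, Nat.card_eq_fintype_card, Fintype.card_subtype,
      Finset.card_eq_sum_card_fiberwise (f := orb (σ ^ n))
        (t := Finset.univ.filter (fun o' => orbPow σ n o' = o))]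
    · refine Finset.sum_congr rfl fun o' ho' => ?_
      rw [wt, Nat.card_eq_fintype_card, Fintype.card_subtype, Finset.filter_filter]
      congr 1
      ext x
      simp only [Finset.mem_filter, Finset.mem_univ, true_and] at ho' ⊢
      constructor
      · exact fun h => h.2
      · rintro rfl; exact ⟨ho', rfl⟩
    · intro x hx
      simpa [orbPow_orb] using hx
  rw [Finset.sum_congr rfl (g := fun _ => wt σ o / Nat.gcd (wt σ o) n)
    (fun o' ho' => by rw [wt_pow σ hn, (Finset.mem_filter.mp ho').2]), Finset.sum_const,
    smul_eq_mul] at h1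
  have hg : Nat.gcd (wt σ o) n ∣ wt σ o := Nat.gcd_dvd_left _ _
  have h2 := Nat.mul_div_cancel' hg
  have h3 : 0 < wt σ o / Nat.gcd (wt σ o) n :=
    Nat.div_pos (Nat.le_of_dvd (wt_pos _ _) hg) (Nat.gcd_pos_of_pos_left _ (wt_pos _ _))
  exact Nat.eq_of_mul_eq_mul_right h3 (h1.symm.trans h2.symm)

theorem zprod_fin [Finite α] (σ : Equiv.Perm α) {n : ℕ} (hn : 0 < n) {ζ : K}
    (h : IsPrimitiveRoot ζ n) :
    expand n hn.ne' (PowerSeries.mk (fun d => (Nat.card (XD (σ ^ n) d) : K))) =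
      ∏ i ∈ Finset.range n, rescale (ζ ^ i) (PowerSeries.mk (fun d => (Nat.card (XD σ d) : K))) := by
  classical
  have := Fintype.ofFinite α
  have := Fintype.ofFinite (Orb σ)
  have := Fintype.ofFinite (Orb (σ ^ n))
  have hC : IsPrimitiveRoot (PowerSeries.C ζ) n :=
    h.map_of_injective (f := PowerSeries.C (R := K)) PowerSeries.C_injective
  have e1 : expand n hn.ne' (∏ o : Orb (σ ^ n), (1 - X ^ wt (σ ^ n) o) : PowerSeries K) =
      ∏ i ∈ Finset.range n, rescale (ζ ^ i) (∏ o : Orb σ, (1 - X ^ wt σ o)) := by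
    simp only [map_prod, map_sub, map_one, map_pow, expand_X, rescale_X]
    rw [Finset.prod_comm, ← Finset.prod_fiberwise Finset.univ (orbPow σ n)]
    refine Finset.prod_congr rfl fun o _ => ?_
    rw [prod_prim_gcd hn hC, ← card_fib σ hn o, ← Finset.prod_const, card_fib σ hn o]
    refine Finset.prod_congr rfl fun o' ho' => ?_
    rw [wt_pow σ hn, (Finset.mem_filter.mp ho').2, ← pow_mul]
  have e2 := congrArg (expand n hn.ne') (zfin (K := K) (σ ^ n))
  rw [map_mul, e1, map_one] at e2
  have e3 : (∏ i ∈ Finset.range n, rescale (ζ ^ i) (PowerSeries.mk (fun d => (Nat.card (XD σ d) : K)))) *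
      ∏ i ∈ Finset.range n, rescale (ζ ^ i) (∏ o : Orb σ, (1 - X ^ wt σ o)) = 1 := by
    rw [← Finset.prod_mul_distrib]
    refine Finset.prod_eq_one fun i _ => ?_
    rw [← map_mul, zfin, map_one]
  exact (eq_comm.mp (left_inv_eq_right_inv e3 ((mul_comm _ _).trans e2)))

end GGG
end RatCurve

namespace RatCurve

section GG2
set_option linter.unusedSectionVars false
open PowerSeries
variable {α : Type*} {K : Type*} [Field K]

theorem XD_card_supp {σ : Equiv.Perm α} {d : ℕ} (D : XD σ d) : D.1.support.card ≤ d := by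
  have h := D.2.2.2
  rw [Finsupp.degree_apply] at h
  have : ∑ x ∈ D.1.support, (1 : ℤ) ≤ ∑ x ∈ D.1.support, D.1 x := by
    refine Finset.sum_le_sum fun x hx => ?_
    have h1 := D.2.1 x
    have h2 := Finsupp.mem_support_iff.mp hx
    simp only [Finsupp.coe_zero, Pi.zero_apply] at h1
    omega
  rw [h] at this
  simpa using this

theorem XD_period {σ : Equiv.Perm α} {d : ℕ} (D : XD σ d) {x : α} (hx : D.1 x ≠ 0) :
    ∃ m, 0 < m ∧ m ≤ d ∧ (σ ^ m) x = x := by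
  classical
  have hpow : ∀ i : ℕ, D.1 ((σ ^ i) x) = D.1 x := fun i =>
    inv_orb D.2.2.1 (orb_eq.mpr ⟨-i, by simp⟩)
  obtain ⟨i, hi, j, hj, hij, e⟩ := Finset.exists_ne_map_eq_of_card_lt_of_maps_to
    (s := Finset.range (d + 1)) (t := D.1.support) (f := fun i => (σ ^ i) x)
    (by have := XD_card_supp D; simp; omega)
    (fun i _ => by simp [hpow, hx])
  have key : ∀ i j : ℕ, i < j → j ≤ d → (σ ^ i) x = (σ ^ j) x → ∃ m, 0 < m ∧ m ≤ d ∧ (σ ^ m) x = x := by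
    intro i j hij hj e
    refine ⟨j - i, by omega, by omega, ?_⟩
    apply (σ ^ i).injective
    rw [e, ← Equiv.Perm.mul_apply, ← pow_add]
    congr 2; omega
  simp at hi hj
  rcases lt_or_gt_of_ne hij with h | h
  · exact key i j h (by omega) e
  · exact key j i h (by omega) e.symm

theorem XD_restrict (σ : Equiv.Perm α) (S : Set α) (hS : ∀ x, σ x ∈ S ↔ x ∈ S) (d : ℕ)
    (hd : ∀ m x, 0 < m → m ≤ d → (σ ^ m) x = x → x ∈ S) :
    Nonempty (XD σ d ≃ XD (σ.subtypePerm hS) d) := by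
  classical
  have hsupp : ∀ D : XD σ d, ∀ x, D.1 x ≠ 0 → x ∈ S := by
    intro D x hx
    obtain ⟨m, h1, h2, h3⟩ := XD_period D hx
    exact hd m x h1 h2 h3
  let T : XD σ d → XD (σ.subtypePerm hS) d := fun D => ⟨D.1.subtypeDomain (· ∈ S),
    fun x => D.2.1 x.1, fun x => D.2.2.1 x.1, by
      refine Eq.trans ?_ D.2.2.2
      have := Finsupp.sum_subtypeDomain_index (p := (· ∈ S)) (v := D.1) (h := fun _ n => n)
        (fun x hx => hsupp D x (Finsupp.mem_support_iff.mp hx))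
      rw [Finsupp.degree_apply, Finsupp.degree_apply]
      exact this⟩
  refine ⟨Equiv.ofBijective T ⟨?_, ?_⟩⟩
  · intro D D' h
    refine Subtype.ext (Finsupp.ext fun x => ?_)
    by_cases hx : x ∈ S
    · exact DFunLike.congr_fun (congrArg Subtype.val h) ⟨x, hx⟩
    · rw [not_not.mp (mt (hsupp D x) hx), not_not.mp (mt (hsupp D' x) hx)]
  · rintro ⟨D, h0, h1, h2⟩
    have hin : ∀ (x) (hx : x ∈ S), (Finsupp.extendDomain D) x = D ⟨x, hx⟩ := fun x hx => by
      simp [Finsupp.extendDomain, hx]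
    have hout : ∀ (x) (hx : x ∉ S), (Finsupp.extendDomain D) x = 0 := fun x hx => by
      simp [Finsupp.extendDomain, hx]
    refine ⟨⟨D.extendDomain, ?_, ?_, ?_⟩, ?_⟩
    · intro x
      by_cases hx : x ∈ S
      · rw [hin x hx]; exact h0 _
      · rw [hout x hx]; rfl
    · intro x
      by_cases hx : x ∈ S
      · rw [hin x hx, hin (σ x) ((hS x).mpr hx)]; exact h1 ⟨x, hx⟩
      · rw [hout x hx, hout (σ x) (fun h => hx ((hS x).mp h))]
    · rw [← h2]
      have := Finsupp.sum_subtypeDomain_index (p := (· ∈ S)) (v := D.extendDomain) (h := fun _ n => n)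
        (fun x hx => by
          by_contra hxS
          exact (Finsupp.mem_support_iff.mp hx) (hout x hxS))
      rw [Finsupp.subtypeDomain_extendDomain] at this
      rw [Finsupp.degree_apply, Finsupp.degree_apply]
      exact this.symm
    · exact Subtype.ext (Finsupp.subtypeDomain_extendDomain D)

theorem XD_finite_fin [Finite α] (σ : Equiv.Perm α) (d : ℕ) : Finite (XD σ d) := by
  have := Fintype.ofFinite α
  have hle : ∀ (D : XD σ d) x, D.1 x ≤ d := by
    intro D x
    refine le_of_le_of_eq ?_ D.2.2.2
    rw [Finsupp.degree_eq_sum]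
    exact Finset.single_le_sum (f := fun x => D.1 x) (fun y _ => D.2.1 y) (Finset.mem_univ x)
  refine Finite.of_injective (β := α → Set.Icc (0:ℤ) d) (fun D x => ⟨D.1 x, D.2.1 x, hle D x⟩) ?_
  intro D D' h
  refine Subtype.ext (Finsupp.ext fun x => ?_)
  exact congrArg Subtype.val (congrFun h x)

/-- points of bounded period -/
def SN (σ : Equiv.Perm α) (N : ℕ) : Set α := {x | ∃ m, 0 < m ∧ m ≤ N ∧ (σ ^ m) x = x}

theorem SN_inv (σ : Equiv.Perm α) (N : ℕ) (x : α) : σ x ∈ SN σ N ↔ x ∈ SN σ N := by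
  have : ∀ m : ℕ, (σ ^ m) (σ x) = σ x ↔ (σ ^ m) x = x := fun m => by
    rw [← Equiv.Perm.mul_apply, ← pow_succ, pow_succ', Equiv.Perm.mul_apply]
    exact σ.injective.eq_iff
  simp only [SN, Set.mem_ofPred_eq, this]

theorem SN_fin {σ : Equiv.Perm α} (hfin : ∀ m, 0 < m → {x | (σ ^ m) x = x}.Finite) (N : ℕ) :
    (SN σ N).Finite := by
  refine ((Set.finite_Icc 1 N).biUnion (t := fun m => {x | (σ ^ m) x = x})
    (fun m hm => hfin m (by simp at hm; omega))).subset ?_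
  rintro x ⟨m, h1, h2, h3⟩
  exact Set.mem_biUnion (x := m) (by simp; omega) h3

theorem XD_finite {σ : Equiv.Perm α} (hfin : ∀ m, 0 < m → {x | (σ ^ m) x = x}.Finite) (d : ℕ) :
    Finite (XD σ d) := by
  obtain ⟨e⟩ := XD_restrict σ (SN σ d) (SN_inv σ d) d (fun m x h1 h2 h3 => ⟨m, h1, h2, h3⟩)
  have := (SN_fin hfin d).to_subtype
  have := XD_finite_fin (σ.subtypePerm (SN_inv σ d)) d
  exact Finite.of_equiv _ e.symm

theorem zprod {σ : Equiv.Perm α} (hfin : ∀ m, 0 < m → {x | (σ ^ m) x = x}.Finite)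
    {n : ℕ} (hn : 0 < n) {ζ : K} (h : IsPrimitiveRoot ζ n) :
    expand n hn.ne' (PowerSeries.mk (fun d => (Nat.card (XD (σ ^ n) d) : K))) =
      ∏ i ∈ Finset.range n, rescale (ζ ^ i) (PowerSeries.mk (fun d => (Nat.card (XD σ d) : K))) := by
  ext M
  let S := SN σ (n * M)
  have hS := SN_inv σ (n * M)
  have : Finite S := (SN_fin hfin _).to_subtype
  let τ := σ.subtypePerm hS
  have h1 : ∀ d, d ≤ M → Nat.card (XD σ d) = Nat.card (XD τ d) := fun d hd => by
    obtain ⟨e⟩ := XD_restrict σ S hS d (fun m x h1 h2 h3 => ⟨m, h1, by nlinarith, h3⟩)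
    exact Nat.card_congr e
  have h2 : ∀ d, d ≤ M → Nat.card (XD (σ ^ n) d) = Nat.card (XD (τ ^ n) d) := fun d hd => by
    have hS' : ∀ x, (σ ^ n) x ∈ S ↔ x ∈ S := by
      have : ∀ n x, (σ ^ n) x ∈ S ↔ x ∈ S := by
        intro n
        induction n with
        | zero => intro x; simp
        | succ n ih => intro x; rw [pow_succ', Equiv.Perm.mul_apply, hS, ih]
      exact this n
    obtain ⟨e⟩ := XD_restrict (σ ^ n) S hS' d
      (fun m x h1 h2 h3 => ⟨n * m, by positivity, by nlinarith, by rw [pow_mul]; exact h3⟩)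
    rw [Nat.card_congr e]
    have : (σ ^ n).subtypePerm hS' = τ ^ n := by
      simp [τ, Equiv.Perm.subtypePerm_pow]
    rw [this]
  have h3 := congrArg (coeff M) (zprod_fin τ hn h)
  have h4 : coeff M (expand n hn.ne' (PowerSeries.mk (fun d => (Nat.card (XD (σ ^ n) d) : K)))) =
     coeff M (expand n hn.ne' (PowerSeries.mk (fun d => (Nat.card (XD (τ ^ n) d) : K)))) := by
    rw [coeff_expand, coeff_expand, coeff_mk, coeff_mk, h2 _ (Nat.div_le_self _ _)]
  rw [h4, h3]
  rw [coeff_prod, coeff_prod]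
  refine Finset.sum_congr rfl fun l hl => Finset.prod_congr rfl fun i hi => ?_
  rw [coeff_rescale, coeff_rescale, coeff_mk, coeff_mk, h1]
  have := (Finset.mem_finsuppAntidiag.mp hl).1
  rw [← this]
  exact Finset.single_le_sum (f := fun i => l i) (fun _ _ => Nat.zero_le _) hi

theorem XD_zero (σ : Equiv.Perm α) : Nat.card (XD σ 0) = 1 := by
  have : Unique (XD σ 0) := 
    { default := ⟨0, le_refl _, fun x => rfl, by simp⟩
      uniq := fun D => Subtype.ext (by
        have := XD_card_supp D
        have h : D.1.support = ∅ := by rw [← Finset.card_eq_zero]; omega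
        exact Finsupp.support_eq_empty.mp h) }
  exact Nat.card_unique

end GG2
end RatCurve

namespace RatCurve

section GG3
set_option linter.unusedSectionVars false
open PowerSeries
variable {α : Type*} {K : Type*} [Field K]

theorem poly_of_ev {A : PowerSeries K} {h g : K} {N : ℕ}
    (hA : ∀ d, N ≤ d → coeff d A = h * (d - g)) :
    A * (1 - X) ^ 2 = ((trunc N (A - PowerSeries.mk (fun d => h * (d - g))) * (1 - Polynomial.X) ^ 2 +
      Polynomial.C h * (Polynomial.C (-g) + Polynomial.C (g + 1) * Polynomial.X) : Polynomial K) :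
        PowerSeries K) := by
  have e1 : A = (trunc N (A - PowerSeries.mk (fun d => h * (d - g))) : Polynomial K) +
      PowerSeries.mk (fun d => h * (d - g)) := by
    ext d
    rw [map_add, Polynomial.coeff_coe, coeff_trunc, coeff_mk]
    split_ifs with hd
    · simp
    · rw [hA d (by omega), zero_add]
  have e2 : PowerSeries.mk (fun d : ℕ => h * (d - g)) * (1 - X) ^ 2 =
      PowerSeries.C h * (PowerSeries.C (-g) + PowerSeries.C (g + 1) * X) := by
    have : (1 - X : PowerSeries K) ^ 2 = 1 - PowerSeries.C 2 * X ^ 1 + X ^ 2 := by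
      rw [map_ofNat]; ring
    rw [this]
    ext d
    rw [mul_add, mul_sub, ← mul_assoc, mul_one, map_add, map_sub, coeff_mul_X_pow',
      coeff_mul_X_pow', coeff_C_mul, map_add, ← pow_one X, coeff_C_mul_X_pow]
    rcases d with _ | _ | d
    · simp
    · simp; ring
    · simp; ring
  conv_lhs => rw [e1, add_mul, e2]
  simp

theorem zeta_abs {σ : Equiv.Perm α} (hfin : ∀ m, 0 < m → {x | (σ ^ m) x = x}.Finite)
    (ℓ : ℕ) [Fact ℓ.Prime] (h : ℕ → ℕ) (g : ℤ) (d0 : ℕ)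
    (H1 : ∀ n, 0 < n → ∃ N, ∀ d : ℕ, N ≤ d → (Nat.card (XD (σ ^ n) d) : ZMod ℓ) = h n * (d - g))
    (H2 : ∀ d, d0 < d → (Nat.card (XD σ d) : ZMod ℓ) = h 1 * (d - g))
    (H3 : (Nat.card (XD σ d0) : ZMod ℓ) = h 1 * (d0 - g) + 1) :
    ∃ n, 0 < n ∧ (h n : ZMod ℓ) = 0 := by
  let K := AlgebraicClosure (ZMod ℓ)
  let A : ℕ → PowerSeries K := fun n => PowerSeries.mk (fun d => (Nat.card (XD (σ ^ n) d) : K))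
  have hcast : ∀ {x y : ZMod ℓ}, x = y → algebraMap (ZMod ℓ) K x = algebraMap (ZMod ℓ) K y :=
    fun e => by rw [e]
  have hP : ∀ n, 0 < n → ∃ P : Polynomial K, A n * (1 - X) ^ 2 = (P : PowerSeries K) ∧ P.eval 1 = (h n : K) := by
    intro n hn
    obtain ⟨N, hN⟩ := H1 n hn
    refine ⟨_, poly_of_ev (h := (h n : K)) (g := (g : K)) (N := N) ?_, ?_⟩
    · intro d hd
      have := hcast (hN d hd)
      simpa [A] using this
    · simp
  choose! P hP1 hP2 using hP
  have hP1' := hP1 1 one_pos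
  have hA1 : A 1 = PowerSeries.mk (fun d => (Nat.card (XD σ d) : K)) := by
    simp only [A, pow_one]
  -- the first polynomial is not constant
  have hP0 : (P 1).coeff 0 = 1 := by
    rw [← Polynomial.coeff_coe, ← hP1', coeff_zero_eq_constantCoeff_apply, map_mul,
      ← coeff_zero_eq_constantCoeff_apply, hA1, coeff_mk, XD_zero]
    simp
  have hPd : (P 1).coeff (d0 + 2) = 1 := by
    have : (1 - X : PowerSeries K) ^ 2 = 1 - PowerSeries.C 2 * X ^ 1 + X ^ 2 := by
      rw [map_ofNat]; ring
    rw [← Polynomial.coeff_coe, ← hP1', this, mul_add, mul_sub, mul_one, map_add, map_sub,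
      mul_left_comm, coeff_C_mul, coeff_mul_X_pow', coeff_mul_X_pow', hA1]
    simp only [coeff_mk]
    have h2 := hcast (H2 (d0 + 2) (by omega))
    have h1 := hcast (H2 (d0 + 1) (by omega))
    have h0 := hcast H3
    have h22 : algebraMap (ZMod ℓ) K 2 = 2 := map_ofNat _ 2
    simp [h22] at h0 h1 h2
    simp [h0, h1, h2]
    ring
  obtain ⟨β, hβ⟩ := IsAlgClosed.exists_root (P 1) (by
    intro hd
    have := Polynomial.natDegree_eq_zero_iff_degree_le_zero.mpr hd.le
    rw [Polynomial.coeff_eq_zero_of_natDegree_lt (by omega)] at hPd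
    exact zero_ne_one hPd)
  have hβ0 : β ≠ 0 := by
    rintro rfl
    rw [Polynomial.IsRoot, ← Polynomial.coeff_zero_eq_eval_zero, hP0] at hβ
    exact one_ne_zero hβ
  -- root of unity
  have hord : IsOfFinOrder β := by
    have halg : IsAlgebraic (ZMod ℓ) β := Algebra.IsAlgebraic.isAlgebraic β
    have : FiniteDimensional (ZMod ℓ) (IntermediateField.adjoin (ZMod ℓ) {β}) :=
      IntermediateField.adjoin.finiteDimensional halg.isIntegral
    have : Finite (IntermediateField.adjoin (ZMod ℓ) {β}) := Module.finite_of_finite (ZMod ℓ)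
    let b : (IntermediateField.adjoin (ZMod ℓ) {β}) :=
      ⟨β, IntermediateField.mem_adjoin_simple_self _ _⟩
    have hb : b ≠ 0 := fun e => hβ0 (congrArg Subtype.val e)
    have h1 := isOfFinOrder_of_finite (Units.mk0 b hb)
    obtain ⟨n, hn, e⟩ := isOfFinOrder_iff_pow_eq_one.mp h1
    refine isOfFinOrder_iff_pow_eq_one.mpr ⟨n, hn, ?_⟩
    have e1 := congrArg (fun u : (IntermediateField.adjoin (ZMod ℓ) {β})ˣ => (u.1 : K)) e
    simpa [b] using e1
  let n := orderOf β
  have hn : 0 < n := hord.orderOf_pos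
  have hprim : IsPrimitiveRoot β n := IsPrimitiveRoot.orderOf β
  refine ⟨n, hn, ?_⟩
  have hz := zprod hfin hn hprim
  have hX : (∏ i ∈ Finset.range n, (1 - PowerSeries.C (β ^ i) * X : PowerSeries K)) = 1 - X ^ n := by
    have := prod_prim hn (hprim.map_of_injective (f := PowerSeries.C (R := K)) PowerSeries.C_injective) X
    simpa using this
  have key : expand n hn.ne' (P n : PowerSeries K) =
      ∏ i ∈ Finset.range n, rescale (β ^ i) (P 1 : PowerSeries K) := by
    rw [← hP1 n hn, ← hP1']
    simp only [map_mul, map_pow, map_sub, map_one, expand_X, rescale_X]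
    rw [Finset.prod_mul_distrib, Finset.prod_pow]
    simp only [map_pow] at hX
    rw [hX, hA1, ← hz]
  have key2 : Polynomial.expand K n (P n) =
      ∏ i ∈ Finset.range n, (P 1).comp (Polynomial.C (β ^ i) * Polynomial.X) := by
    apply Polynomial.coe_injective K
    have e1 : ((Polynomial.expand K n (P n) : Polynomial K) : PowerSeries K) =
        expand n hn.ne' (P n : PowerSeries K) := by
      ext d
      rw [Polynomial.coeff_coe, Polynomial.coeff_expand hn, coeff_expand, Polynomial.coeff_coe]
    have e2 : ∀ i, (((P 1).comp (Polynomial.C (β ^ i) * Polynomial.X) : Polynomial K) :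
        PowerSeries K) = rescale (β ^ i) (P 1 : PowerSeries K) := by
      intro i
      ext d
      rw [Polynomial.coeff_coe, Polynomial.comp_C_mul_X_coeff, coeff_rescale, Polynomial.coeff_coe,
        mul_comm]
    refine (e1.trans key).trans ?_
    have e3 := map_prod (Polynomial.coeToPowerSeries.ringHom (R := K))
      (fun i => (P 1).comp (Polynomial.C (β ^ i) * Polynomial.X)) (Finset.range n)
    simp only [Polynomial.coeToPowerSeries.ringHom_apply] at e3
    rw [e3]
    exact Finset.prod_congr rfl fun i _ => (e2 i).symm
  have key3 := congrArg (Polynomial.eval 1) key2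
  rw [Polynomial.expand_eval, one_pow, hP2 n hn, Polynomial.eval_prod,
    Finset.prod_eq_zero (i := 1 % n) (Finset.mem_range.mpr (Nat.mod_lt _ hn))] at key3
  · have : algebraMap (ZMod ℓ) K (h n) = algebraMap (ZMod ℓ) K 0 := by simpa using key3
    exact (algebraMap (ZMod ℓ) K).injective this
  · have : β ^ (1 % n) = β := by
      rw [pow_mod_orderOf, pow_one]
    rw [this]
    simpa using hβ

end GG3
end RatCurve

open IntermediateField

namespace RatCurve

section EE1
set_option linter.unusedSectionVars false
variable {k C : Type*} [Field k] [Field C] [Algebra k C] [FF k C] [IsAlgClosed k]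

/-- automorphism inducing a power map on constants -/
structure IsFr (k : Type*) {C : Type*} [Field k] [Field C] [Algebra k C] (φ : RingAut C) (q : ℕ) :
    Prop where
  pos : 0 < q
  map : ∀ c : k, φ (algebraMap k C c) = algebraMap k C (c ^ q)

theorem IsFr.symm_map {φ : RingAut C} {q : ℕ} (h : IsFr k φ q) (c : k) :
    ∃ d : k, φ.symm (algebraMap k C c) = algebraMap k C d := by
  obtain ⟨d, hd⟩ := IsAlgClosed.exists_pow_nat_eq c h.pos
  exact ⟨d, by rw [RingEquiv.symm_apply_eq, h.map, hd]⟩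

theorem IsFr.mul {φ ψ : RingAut C} {q r : ℕ} (h : IsFr k φ q) (h' : IsFr k ψ r) :
    IsFr k (φ * ψ) (r * q) :=
  ⟨Nat.mul_pos h'.pos h.pos, fun c => by rw [RingAut.mul_apply, h'.map, h.map, pow_mul]⟩

theorem IsFr.pow {φ : RingAut C} {q : ℕ} (h : IsFr k φ q) (n : ℕ) : IsFr k (φ ^ n) (q ^ n) := by
  induction n with
  | zero => exact ⟨by simp, fun c => by simp⟩
  | succ n ih => rw [pow_succ', pow_succ]; exact h.mul ih

/-- action on places -/
noncomputable def sg {φ : RingAut C} {q : ℕ} (h : IsFr k φ q) : Equiv.Perm (Pl k C) where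
  toFun P := ⟨P.1.comap (φ.symm : C →+* C), fun c => by
    obtain ⟨d, hd⟩ := h.symm_map c
    rw [ValuationSubring.mem_comap]
    exact hd ▸ P.2.1 d, fun e => P.2.2 (by
      rw [eq_top_iff]; intro x _
      have : φ x ∈ P.1.comap (φ.symm : C →+* C) := by rw [e]; trivial
      rw [ValuationSubring.mem_comap] at this
      simpa using this)⟩
  invFun P := ⟨P.1.comap (φ : C →+* C), fun c => by
    rw [ValuationSubring.mem_comap]
    exact (h.map c) ▸ P.2.1 _, fun e => P.2.2 (by
      rw [eq_top_iff]; intro x _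
      have : φ.symm x ∈ P.1.comap (φ : C →+* C) := by rw [e]; trivial
      rw [ValuationSubring.mem_comap] at this
      simpa using this)⟩
  left_inv P := Subtype.ext (by ext x; simp [ValuationSubring.mem_comap])
  right_inv P := Subtype.ext (by ext x; simp [ValuationSubring.mem_comap])

theorem mem_sg {φ : RingAut C} {q : ℕ} (h : IsFr k φ q) (P : Pl k C) (x : C) :
    φ x ∈ (sg h P).1 ↔ x ∈ P.1 := by
  have : φ x ∈ P.1.comap (φ.symm : C →+* C) ↔ x ∈ P.1 := by
    rw [ValuationSubring.mem_comap]; simp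
  exact this

theorem sg_pow {φ : RingAut C} {q : ℕ} (h : IsFr k φ q) (n : ℕ) : sg (h.pow n) = sg h ^ n := by
  have key : ∀ n (P : Pl k C) x, (φ ^ n) x ∈ ((sg h ^ n) P).1 ↔ x ∈ P.1 := by
    intro n
    induction n with
    | zero => intro P x; rfl
    | succ n ih =>
      intro P x
      rw [pow_succ', pow_succ', Equiv.Perm.mul_apply, RingAut.mul_apply, mem_sg, ih]
  ext P : 1
  refine Subtype.ext (SetLike.ext fun y => ?_)
  obtain ⟨x, rfl⟩ := (φ ^ n).surjective y
  rw [mem_sg, key]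

theorem ord_sg {φ : RingAut C} {q : ℕ} (h : IsFr k φ q) (P : Pl k C) {x : C} (hx : x ≠ 0) :
    ord (sg h P) (φ x) = ord P x := by
  have hs : ∀ {y : C}, y ≠ 0 → φ.symm y ≠ 0 := fun hy => by simpa using hy
  have := ord_unique (sg h P) (fun y => ord P (φ.symm y))
    (fun x y hx hy => by rw [map_mul, ord_mul P (hs hx) (hs hy)])
    (fun y hy => by
      rw [← mem_iff_ord P (hs hy), ← mem_sg h P (φ.symm y), RingEquiv.apply_symm_apply])
    (by
      obtain ⟨π, h0, hπ⟩ := exists_unif P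
      exact ⟨φ π, by simpa using h0, by simpa using hπ⟩)
    (x := φ x) (by simpa using hx)
  rw [← this]; simp

/-- action on divisors -/
noncomputable def tau {φ : RingAut C} {q : ℕ} (h : IsFr k φ q) : (Pl k C →₀ ℤ) ≃+ (Pl k C →₀ ℤ) :=
  Finsupp.domCongr (sg h)

theorem tau_sg {φ : RingAut C} {q : ℕ} (h : IsFr k φ q) (D : Pl k C →₀ ℤ) (P : Pl k C) :
    tau h D (sg h P) = D P := by
  simp [tau, Finsupp.domCongr, Finsupp.equivMapDomain_apply]

theorem tau_single {φ : RingAut C} {q : ℕ} (h : IsFr k φ q) (P : Pl k C) (n : ℤ) :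
    tau h (Finsupp.single P n) = Finsupp.single (sg h P) n := by
  simp [tau, Finsupp.domCongr]

theorem tau_eq {φ : RingAut C} {q : ℕ} (h : IsFr k φ q) (D : Pl k C →₀ ℤ) :
    tau h D = D ↔ ∀ P, D (sg h P) = D P := by
  constructor
  · intro e P
    conv_lhs => rw [← e]
    exact tau_sg h D P
  · intro e
    ext P
    obtain ⟨Q, rfl⟩ := (sg h).surjective P
    rw [tau_sg, e]

theorem tau_nonneg {φ : RingAut C} {q : ℕ} (h : IsFr k φ q) {D : Pl k C →₀ ℤ} :
    0 ≤ tau h D ↔ 0 ≤ D := by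
  constructor
  · intro hD P
    have := hD (sg h P)
    rwa [tau_sg] at this
  · intro hD P
    obtain ⟨Q, rfl⟩ := (sg h).surjective P
    rw [tau_sg]; exact hD Q

theorem tau_dv {φ : RingAut C} {q : ℕ} (h : IsFr k φ q) {f : C} (hf : f ≠ 0) :
    tau h (dv k f) = dv k (φ f) := by
  ext P
  obtain ⟨Q, rfl⟩ := (sg h).surjective P
  rw [tau_sg, dv_apply hf, dv_apply (by simpa using hf), ord_sg h Q hf]

theorem dg_tau {φ : RingAut C} {q : ℕ} (h : IsFr k φ q) (D : Pl k C →₀ ℤ) : dg (tau h D) = dg D := by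
  have : tau h D = D.mapDomain (sg h) := by
    simp [tau, Finsupp.domCongr, Finsupp.equivMapDomain_eq_mapDomain]
  rw [this]
  exact Finsupp.degree_mapDomain _ _

/-- principal divisors -/
noncomputable def Pr (k C : Type*) [Field k] [Field C] [Algebra k C] [FF k C] [IsAlgClosed k] :
    AddSubgroup (Pl k C →₀ ℤ) where
  carrier := {D | ∃ f : C, f ≠ 0 ∧ D = dv k f}
  zero_mem' := ⟨1, one_ne_zero, by
    have := dv_const (k := k) (C := C) (c := 1) one_ne_zero
    rw [map_one] at this; exact this.symm⟩
  add_mem' := by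
    rintro _ _ ⟨f, hf, rfl⟩ ⟨g, hg, rfl⟩
    exact ⟨f * g, mul_ne_zero hf hg, (dv_mul hf hg).symm⟩
  neg_mem' := by
    rintro _ ⟨f, hf, rfl⟩
    exact ⟨f⁻¹, inv_ne_zero hf, (dv_inv hf).symm⟩

theorem mem_Pr {D : Pl k C →₀ ℤ} : D ∈ Pr k C ↔ ∃ f : C, f ≠ 0 ∧ D = dv k f := Iff.rfl

theorem tau_Pr {φ : RingAut C} {q : ℕ} (h : IsFr k φ q) {D : Pl k C →₀ ℤ} (hD : D ∈ Pr k C) :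
    tau h D ∈ Pr k C := by
  obtain ⟨f, hf, rfl⟩ := hD
  exact ⟨φ f, by simpa using hf, tau_dv h hf⟩

theorem ll_Pr {D E : Pl k C →₀ ℤ} (h : D - E ∈ Pr k C) : ll D = ll E := by
  obtain ⟨f, hf, e⟩ := h
  rw [← ll_dv hf E, ← e, add_sub_cancel]

theorem dg_Pr {D E : Pl k C →₀ ℤ} (h : D - E ∈ Pr k C) : dg D = dg E := by
  obtain ⟨f, hf, e⟩ := h
  rw [← sub_eq_zero, ← map_sub, e, dg_dv hf]

/-- functions with trivial divisor are constants -/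
theorem const_of_dv {f : C} (hf : f ≠ 0) (h : dv k f = 0) : ∃ c : k, c ≠ 0 ∧ f = algebraMap k C c := by
  have h1 : f ∈ Ls (0 : Pl k C →₀ ℤ) := by rw [mem_Ls' hf, h, add_zero]
  rw [Ls_zero, Submodule.mem_span_singleton] at h1
  obtain ⟨c, rfl⟩ := h1
  refine ⟨c, ?_, by rw [Algebra.smul_def, mul_one]⟩
  rintro rfl
  simp at hf

theorem cnt_fib {φ : RingAut C} {q : ℕ} (h : IsFr k φ q) (hq : 2 ≤ q) (hqk : (q : k) = 0)
    {E : Pl k C →₀ ℤ} (hE : tau h E - E ∈ Pr k C) :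
    (q - 1) * Nat.card {D : Pl k C →₀ ℤ // 0 ≤ D ∧ tau h D = D ∧ D - E ∈ Pr k C} + 1 =
      q ^ (Module.finrank k (Ls E)) := by
  classical
  obtain ⟨g, hg, hgE⟩ := hE
  let σ : k →+* k :=
    { toFun := fun c => c ^ q
      map_one' := one_pow _
      map_mul' := fun a b => mul_pow _ _ _
      map_zero' := zero_pow (by omega)
      map_add' := fun a b => by
        apply (algebraMap k C).injective
        rw [← h.map, map_add, map_add, map_add, h.map, h.map] }
  have hσ : ∀ c, σ c = c ^ q := fun c => rfl
  have hφ0 : ∀ {f : C}, f ≠ 0 → φ f ≠ 0 := fun hf => by simpa using hf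
  have hdiv : ∀ {f : C}, f ≠ 0 → E + dv k (g * φ f) = tau h (E + dv k f) := by
    intro f hf
    rw [dv_mul hg (hφ0 hf), map_add, tau_dv h hf, ← hgE]; abel
  have hmem : ∀ f ∈ Ls E, g * φ f ∈ Ls E := by
    intro f hf
    by_cases h0 : f = 0
    · simp [h0]
    · rw [mem_Ls' (mul_ne_zero hg (hφ0 h0)), hdiv h0, tau_nonneg, ← mem_Ls' h0]
      exact hf
  have hsm : ∀ (c : k) (f : C), g * φ (c • f) = c ^ q • (g * φ f) := by
    intro c f
    rw [Algebra.smul_def, Algebra.smul_def, map_mul, h.map]; ring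
  let ψ : Ls E →ₛₗ[σ] Ls E :=
    { toFun := fun f => ⟨g * φ f, hmem _ f.2⟩
      map_add' := fun a b => Subtype.ext (by simp [mul_add])
      map_smul' := fun c f => Subtype.ext (by
        simp only [Submodule.coe_smul, hsm]
        rfl) }
  have hψ : ∀ f, (ψ f : C) = g * φ f := fun f => rfl
  have hinj : Function.Injective ψ := by
    intro a b hab
    have := congrArg Subtype.val hab
    rw [hψ, hψ] at this
    exact Subtype.ext (φ.injective (mul_left_cancel₀ hg this))
  have hcard := lang_card hσ hq hqk _ (Ls E) ψ hinj rfl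
  have hroots := card_roots (k := k) hq hqk
  set F := {D : Pl k C →₀ ℤ // 0 ≤ D ∧ tau h D = D ∧ D - E ∈ Pr k C} with hF
  -- section
  have hsec : ∀ D : F, ∃ v : C, v ≠ 0 ∧ v ∈ Ls E ∧ g * φ v = v ∧ D.1 = E + dv k v := by
    rintro ⟨D, h0, h1, f, hf, e⟩
    have e' : D = E + dv k f := by rw [← e]; abel
    have hne := mul_ne_zero hg (hφ0 hf)
    obtain ⟨c, hc, ec⟩ := const_of_dv (k := k) (f := g * φ f * f⁻¹) (mul_ne_zero hne (inv_ne_zero hf)) (by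
      have := hdiv hf
      rw [← e', h1, e'] at this
      rw [dv_mul hne (inv_ne_zero hf), dv_inv hf, add_left_cancel this, add_neg_cancel])
    have ec' : g * φ f = c • f := by
      rw [Algebra.smul_def, ← ec, inv_mul_cancel_right₀ hf]
    obtain ⟨a, ha⟩ := IsAlgClosed.exists_pow_nat_eq c⁻¹ (n := q - 1) (by omega)
    have ha0 : a ≠ 0 := by
      rintro rfl
      rw [zero_pow (by omega)] at ha
      exact hc (inv_eq_zero.mp ha.symm)
    have haC : algebraMap k C a ≠ 0 := by simpa using ha0
    have hD : D = E + dv k (a • f) := by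
      rw [Algebra.smul_def, dv_mul haC hf, dv_const ha0, zero_add, e']
    have hne : a • f ≠ 0 := smul_ne_zero ha0 hf
    refine ⟨a • f, hne, ?_, ?_, hD⟩
    · rw [mem_Ls' hne, ← hD]; exact h0
    · rw [hsm, ec', smul_smul]
      congr 1
      have : a ^ q = a ^ (q - 1) * a := by rw [← pow_succ]; congr 1; omega
      rw [this, ha]; field_simp
  choose s hs0 hsL hsf hsD using hsec
  -- counting
  let T : Option (F × {a : k // a ^ q = a ∧ a ≠ 0}) → {v : Ls E // ψ v = v} := fun o =>
    o.elim ⟨0, map_zero _⟩ fun p => ⟨⟨p.2.1 • s p.1, Submodule.smul_mem _ _ (hsL _)⟩,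
      Subtype.ext (by rw [hψ]; simp only; rw [hsm, p.2.2.1, hsf])⟩
  have hT0 : ((T none).1 : C) = 0 := rfl
  have hTs : ∀ p, ((T (some p)).1 : C) = p.2.1 • s p.1 := fun p => rfl
  have hTd : ∀ p, E + dv k ((T (some p)).1 : C) = p.1.1 := fun p => by
    rw [hTs, Algebra.smul_def, dv_mul (by simpa using p.2.2.2) (hs0 _), dv_const p.2.2.2, zero_add, hsD p.1]
  have hT : Function.Bijective T := by
    constructor
    · intro o o' e
      have e1 : ((T o).1 : C) = (T o').1 := by rw [e]
      rcases o with _ | p <;> rcases o' with _ | p'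
      · rfl
      · rw [hT0, hTs] at e1
        exact absurd e1.symm (smul_ne_zero p'.2.2.2 (hs0 _))
      · rw [hT0, hTs] at e1
        exact absurd e1 (smul_ne_zero p.2.2.2 (hs0 _))
      · have h1 : p.1 = p'.1 := Subtype.ext (by rw [← hTd, ← hTd, e1])
        rw [hTs, hTs, h1] at e1
        have h2 := smul_left_injective k (hs0 p'.1) e1
        exact congrArg some (Prod.ext h1 (Subtype.ext h2))
    · rintro ⟨⟨v, hv⟩, hfix⟩
      have hfix' : g * φ v = v := congrArg Subtype.val hfix
      by_cases h0 : v = 0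
      · refine ⟨none, ?_⟩
        apply Subtype.ext; apply Subtype.ext
        exact h0.symm
      · let D : F := ⟨E + dv k v, (mem_Ls' h0).mp hv, by rw [← hdiv h0, hfix'],
          ⟨v, h0, by abel⟩⟩
        have hd : dv k v = dv k (s D) := add_left_cancel (hsD D)
        obtain ⟨c, hc, ec⟩ := const_of_dv (k := k) (f := v * (s D)⁻¹)
          (mul_ne_zero h0 (inv_ne_zero (hs0 _))) (by
            rw [dv_mul h0 (inv_ne_zero (hs0 _)), dv_inv (hs0 _), hd, add_neg_cancel])
        have ec' : v = c • s D := by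
          rw [Algebra.smul_def, ← ec, inv_mul_cancel_right₀ (hs0 _)]
        have hcq : c ^ q = c := by
          apply smul_left_injective k (hs0 D)
          simp only
          rw [← ec']
          conv_rhs => rw [← hfix', ec', hsm, hsf]
        refine ⟨some (D, ⟨c, hcq, hc⟩), ?_⟩
        apply Subtype.ext; apply Subtype.ext
        exact ec'.symm
  have hfinR : Finite {a : k // a ^ q = a} := Nat.finite_of_card_ne_zero (by omega)
  have hR : Nat.card {a : k // a ^ q = a ∧ a ≠ 0} + 1 = q := by
    refine Eq.trans ?_ hroots
    have hfin' : Finite {a : k // a ^ q = a ∧ a ≠ 0} :=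
      Finite.of_injective (fun a => (⟨a.1, a.2.1⟩ : {a : k // a ^ q = a})) (fun a b e =>
        Subtype.ext (congrArg (fun z : {a : k // a ^ q = a} => z.1) e))
    rw [← Finite.card_option]
    let U : Option {a : k // a ^ q = a ∧ a ≠ 0} → {a : k // a ^ q = a} := fun o =>
      o.elim ⟨0, zero_pow (by omega)⟩ fun a => ⟨a.1, a.2.1⟩
    refine Nat.card_congr (Equiv.ofBijective U ⟨?_, ?_⟩)
    · intro o o' e
      rcases o with _ | p <;> rcases o' with _ | p'
      · rfl
      · exact absurd (congrArg Subtype.val e).symm p'.2.2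
      · exact absurd (congrArg Subtype.val e) p.2.2
      · exact congrArg some (Subtype.ext (congrArg (fun z : {a : k // a ^ q = a} => z.1) e))
    · rintro ⟨a, ha⟩
      by_cases h0 : a = 0
      · exact ⟨none, Subtype.ext h0.symm⟩
      · exact ⟨some ⟨a, ha, h0⟩, rfl⟩
  have hfinV : Finite {v : Ls E // ψ v = v} := Nat.finite_of_card_ne_zero (by
    rw [hcard]; positivity)
  have hfinO := Finite.of_injective T hT.1
  have hfinP : Finite (F × {a : k // a ^ q = a ∧ a ≠ 0}) :=
    Finite.of_injective some (Option.some_injective _)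
  rw [← hcard, ← Nat.card_congr (Equiv.ofBijective T hT), Finite.card_option, Nat.card_prod]
  have : Nat.card {a : k // a ^ q = a ∧ a ≠ 0} = q - 1 := by omega
  rw [this, mul_comm]

end EE1
end RatCurve

open IntermediateField

namespace RatCurve

section EE3
set_option linter.unusedSectionVars false
variable {k C : Type*} [Field k] [Field C] [Algebra k C] [FF k C] [IsAlgClosed k]

theorem geom_cnt {q n l ℓ : ℕ} (hq : 2 ≤ q) (hqℓ : (q : ZMod ℓ) = 1) (e : (q - 1) * n + 1 = q ^ l) :
    (n : ZMod ℓ) = l := by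
  have h1 := Nat.geomSum_eq hq l
  have h2 : n = ∑ i ∈ Finset.range l, q ^ i := by
    rw [h1]
    symm
    apply Nat.div_eq_of_eq_mul_right (by omega)
    omega
  rw [h2]; simp [hqℓ]

/-- Classes of degree zero fixed by Frobenius -/
noncomputable def Hs {φ : RingAut C} {q : ℕ} (h : IsFr k φ q) :
    AddSubgroup ((Pl k C →₀ ℤ) ⧸ Pr k C) :=
  AddSubgroup.map (QuotientAddGroup.mk' (Pr k C))
    { carrier := {D | dg D = 0 ∧ tau h D - D ∈ Pr k C}
      zero_mem' := ⟨map_zero _, by simp⟩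
      add_mem' := by
        rintro a b ⟨ha, ha'⟩ ⟨hb, hb'⟩
        refine ⟨by rw [map_add, ha, hb, add_zero], ?_⟩
        have : tau h (a + b) - (a + b) = (tau h a - a) + (tau h b - b) := by rw [map_add]; abel
        rw [this]; exact add_mem ha' hb'
      neg_mem' := by
        rintro a ⟨ha, ha'⟩
        refine ⟨by rw [map_neg, ha, neg_zero], ?_⟩
        have : tau h (-a) - (-a) = -(tau h a - a) := by rw [map_neg]; abel
        rw [this]; exact neg_mem ha' }

theorem mk_mem_Hs {φ : RingAut C} {q : ℕ} (h : IsFr k φ q) {D : Pl k C →₀ ℤ} (h0 : dg D = 0)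
    (h1 : tau h D - D ∈ Pr k C) : (QuotientAddGroup.mk D : (Pl k C →₀ ℤ) ⧸ Pr k C) ∈ Hs h :=
  ⟨D, ⟨h0, h1⟩, rfl⟩

theorem exists_Hs {φ : RingAut C} {q : ℕ} (h : IsFr k φ q) (c : Hs h) :
    ∃ (D : Pl k C →₀ ℤ) (h0 : dg D = 0) (h1 : tau h D - D ∈ Pr k C),
      c = ⟨QuotientAddGroup.mk D, mk_mem_Hs h h0 h1⟩ := by
  obtain ⟨c, D, ⟨h0, h1⟩, rfl⟩ := c
  exact ⟨D, h0, h1, rfl⟩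

theorem mk_eq_iff {D E : Pl k C →₀ ℤ} :
    (QuotientAddGroup.mk D : (Pl k C →₀ ℤ) ⧸ Pr k C) = QuotientAddGroup.mk E ↔ D - E ∈ Pr k C := by
  rw [eq_comm, QuotientAddGroup.eq, neg_add_eq_sub]

/-- class map -/
noncomputable def rho {φ : RingAut C} {q : ℕ} (h : IsFr k φ q) {P0 : Pl k C} (hP : sg h P0 = P0)
    (d : ℕ) (D : XD (sg h) d) : Hs h :=
  ⟨QuotientAddGroup.mk (D.1 - Finsupp.single P0 (d : ℤ)), mk_mem_Hs h (by
    rw [map_sub, dg_single]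
    have : dg D.1 = (d : ℤ) := D.2.2.2
    rw [this, sub_self]) (by
    rw [map_sub, tau_single, hP, (tau_eq h D.1).mpr D.2.2.1, sub_self]; exact zero_mem _)⟩

theorem rho_fib {φ : RingAut C} {q : ℕ} (h : IsFr k φ q) {P0 : Pl k C} (hP : sg h P0 = P0)
    (hq : 2 ≤ q) (hqk : (q : k) = 0)
    (d : ℕ) {E : Pl k C →₀ ℤ} (h0 : dg E = 0) (h1 : tau h E - E ∈ Pr k C) :
    (q - 1) * Nat.card {D : XD (sg h) d // rho h hP d D = ⟨QuotientAddGroup.mk E, mk_mem_Hs h h0 h1⟩} + 1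
      = q ^ (Module.finrank k (Ls (E + Finsupp.single P0 (d : ℤ)))) := by
  rw [← cnt_fib h hq hqk (E := E + Finsupp.single P0 (d : ℤ)) (by
    rw [map_add, tau_single, hP]
    simpa using h1)]
  congr 2
  refine Nat.card_congr
    { toFun := fun D => ⟨D.1.1, D.1.2.1, (tau_eq h _).mpr D.1.2.2.1, ?_⟩
      invFun := fun D => ⟨⟨D.1, D.2.1, (tau_eq h _).mp D.2.2.1, ?_⟩, ?_⟩
      left_inv := fun D => rfl
      right_inv := fun D => rfl }
  · have := mk_eq_iff.mp (congrArg Subtype.val D.2)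
    rwa [sub_sub, add_comm] at this
  · have h2 := dg_Pr D.2.2.2
    rw [map_add, dg_single, h0, zero_add] at h2
    exact h2
  · have aux : ∀ X S : Pl k C →₀ ℤ, X - (E + S) ∈ Pr k C → X - S - E ∈ Pr k C := fun X S hX => by
      rwa [sub_sub, add_comm S]
    exact Subtype.ext (mk_eq_iff.mpr (aux _ _ D.2.2.2))

theorem Hs_finite {φ : RingAut C} {q : ℕ} (h : IsFr k φ q) {P0 : Pl k C} (hP : sg h P0 = P0)
    (hq : 2 ≤ q) (hqk : (q : k) = 0)
    (hfin : ∀ d, Finite (XD (sg h) d)) : Finite (Hs h) := by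
  obtain ⟨N, hN⟩ := riemann k C
  let d : ℕ := (max N (gg k C + 1)).toNat
  have hd1 : N ≤ (d : ℤ) := le_trans (le_max_left _ _) (Int.self_le_toNat _)
  have hd2 : gg k C + 1 ≤ (d : ℤ) := le_trans (le_max_right _ _) (Int.self_le_toNat _)
  have := hfin d
  refine Finite.of_surjective (rho h hP d) ?_
  intro c
  obtain ⟨E, h0, h1, rfl⟩ := exists_Hs h c
  have key := rho_fib h hP hq hqk d h0 h1
  have hdg : dg (E + Finsupp.single P0 (d : ℤ)) = d := by rw [map_add, dg_single, h0, zero_add]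
  have hgm := hN (E + Finsupp.single P0 (d : ℤ)) (by rw [hdg]; exact hd1)
  have hpos : 0 < ll (E + Finsupp.single P0 (d : ℤ)) := by
    unfold gm at hgm; rw [hdg] at hgm; omega
  have hpos' : Module.finrank k (Ls (E + Finsupp.single P0 (d : ℤ))) ≠ 0 := by
    unfold ll at hpos; omega
  by_contra hcon
  have : IsEmpty {D : XD (sg h) d // rho h hP d D = ⟨QuotientAddGroup.mk E, mk_mem_Hs h h0 h1⟩} :=
    ⟨fun D => hcon ⟨D.1, D.2⟩⟩
  rw [Nat.card_of_isEmpty, mul_zero, zero_add] at key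
  have := Nat.one_lt_pow hpos' (by omega : 1 < q)
  omega

theorem cnt_sum {φ : RingAut C} {q : ℕ} (h : IsFr k φ q) {P0 : Pl k C} (hP : sg h P0 = P0)
    (hq : 2 ≤ q) (hqk : (q : k) = 0) {ℓ : ℕ} (hqℓ : (q : ZMod ℓ) = 1)
    (hfin : ∀ d, Finite (XD (sg h) d)) [Fintype (Hs h)] (d : ℕ) (L : Hs h → ℤ)
    (hL : ∀ (E : Pl k C →₀ ℤ) (h0 : dg E = 0) (h1 : tau h E - E ∈ Pr k C),
      ll (E + Finsupp.single P0 (d : ℤ)) = L ⟨QuotientAddGroup.mk E, mk_mem_Hs h h0 h1⟩) :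
    (Nat.card (XD (sg h) d) : ZMod ℓ) = ∑ c, (L c : ZMod ℓ) := by
  have := hfin d
  rw [← Nat.card_congr (Equiv.sigmaFiberEquiv (rho h hP d)), Nat.card_sigma, Nat.cast_sum]
  refine Finset.sum_congr rfl fun c _ => ?_
  obtain ⟨E, h0, h1, rfl⟩ := exists_Hs h c
  rw [geom_cnt hq hqℓ (rho_fib h hP hq hqk d h0 h1), ← hL E h0 h1]
  unfold ll
  simp

theorem cnt_H1 {φ : RingAut C} {q : ℕ} (h : IsFr k φ q) {P0 : Pl k C} (hP : sg h P0 = P0)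
    (hq : 2 ≤ q) (hqk : (q : k) = 0) {ℓ : ℕ} (hqℓ : (q : ZMod ℓ) = 1)
    (hfin : ∀ d, Finite (XD (sg h) d)) (d : ℕ)
    (hd : ∀ E : Pl k C →₀ ℤ, dg E = d → gm E = gg k C) :
    (Nat.card (XD (sg h) d) : ZMod ℓ) = Nat.card (Hs h) * (d - (gg k C : ℤ)) := by
  have := Hs_finite h hP hq hqk hfin
  let _ := Fintype.ofFinite (Hs h)
  rw [cnt_sum h hP hq hqk hqℓ hfin d (fun _ => d - gg k C) (fun E h0 h1 => by
    have hdg : dg (E + Finsupp.single P0 (d : ℤ)) = d := by rw [map_add, dg_single, h0, zero_add]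
    have := hd _ hdg
    unfold gm at this; rw [hdg] at this; omega)]
  rw [Finset.sum_const, Finset.card_univ, nsmul_eq_mul, Nat.card_eq_fintype_card]
  push_cast; rfl

theorem tau_sp {φ : RingAut C} {q : ℕ} (h : IsFr k φ q) (D : Pl k C →₀ ℤ) :
    ll (tau h D) = ll D := by
  have hσ : Function.Bijective (fun c : k => c ^ q) := by
    constructor
    · intro a b e
      apply (algebraMap k C).injective
      apply φ.injective
      rw [h.map, h.map]; exact congrArg _ e
    · intro c; exact IsAlgClosed.exists_pow_nat_eq c h.pos
  have hm : ∀ f, φ f ∈ Ls (tau h D) ↔ f ∈ Ls D := by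
    intro f
    rcases eq_or_ne f 0 with rfl | hf
    · simp
    · rw [mem_Ls' hf, mem_Ls' (by simpa using hf), ← tau_dv h hf, ← map_add, tau_nonneg]
  let j : Ls D ≃+ Ls (tau h D) :=
    { toFun := fun f => ⟨φ f.1, (hm _).mpr f.2⟩
      invFun := fun f => ⟨φ.symm f.1, (hm _).mp (by rw [RingEquiv.apply_symm_apply]; exact f.2)⟩
      left_inv := fun f => Subtype.ext (by simp)
      right_inv := fun f => Subtype.ext (by simp)
      map_add' := fun f g => Subtype.ext (by simp) }
  have := rank_eq_of_equiv_equiv (fun c : k => c ^ q) j hσ (fun c f => Subtype.ext (by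
    change φ (c • f.1) = c ^ q • φ f.1
    rw [Algebra.smul_def, Algebra.smul_def, map_mul, h.map]))
  unfold ll Module.finrank
  rw [this]

theorem cnt_H3 {φ : RingAut C} {q : ℕ} (h : IsFr k φ q) {P0 : Pl k C} (hP : sg h P0 = P0)
    (hq : 2 ≤ q) (hqk : (q : k) = 0) {ℓ : ℕ} (hqℓ : (q : ZMod ℓ) = 1)
    (hfin : ∀ d, Finite (XD (sg h) d)) (d : ℕ)
    {D : Pl k C →₀ ℤ} (hD : gm D ≠ gg k C) (hdD : dg D = d)
    (hmax : ∀ E : Pl k C →₀ ℤ, dg D < dg E → gm E = gg k C) :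
    (Nat.card (XD (sg h) d) : ZMod ℓ) = Nat.card (Hs h) * (d - (gg k C : ℤ)) + 1 := by
  classical
  have := Hs_finite h hP hq hqk hfin
  let _ := Fintype.ofFinite (Hs h)
  have hmD := ll_max hD hmax
  have hτ : tau h D - D ∈ Pr k C := by
    obtain ⟨f, hf, e⟩ := max_special_unique (dg_tau h D) hD (by
      unfold gm at hD ⊢; rwa [dg_tau, tau_sp]) hmax
    exact ⟨f, hf, by rw [e]; abel⟩
  have h0 : dg (D - Finsupp.single P0 (d : ℤ)) = 0 := by
    rw [map_sub, dg_single, hdD, sub_self]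
  have h1 : tau h (D - Finsupp.single P0 (d : ℤ)) - (D - Finsupp.single P0 (d : ℤ)) ∈ Pr k C := by
    rw [map_sub, tau_single, hP]; simpa using hτ
  let c0 : Hs h := ⟨QuotientAddGroup.mk (D - Finsupp.single P0 (d : ℤ)), mk_mem_Hs h h0 h1⟩
  rw [cnt_sum h hP hq hqk hqℓ hfin d (fun c => (d - gg k C) + if c = c0 then 1 else 0)
    (fun E h0 h1 => by
      have hdg : dg (E + Finsupp.single P0 (d : ℤ)) = d := by rw [map_add, dg_single, h0, zero_add]
      have hiff : (⟨QuotientAddGroup.mk E, mk_mem_Hs h h0 h1⟩ : Hs h) = c0 ↔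
          (E + Finsupp.single P0 (d : ℤ)) - D ∈ Pr k C := by
        rw [Subtype.ext_iff, mk_eq_iff]
        rw [sub_sub_eq_add_sub]
      split_ifs with hc
      · rw [ll_Pr (hiff.mp hc)]
        unfold gm at hmD; omega
      · have hs : gm (E + Finsupp.single P0 (d : ℤ)) = gg k C := by
          by_contra hne
          apply hc
          rw [hiff]
          obtain ⟨f, hf, e⟩ := max_special_unique (hdg.trans hdD.symm) hD hne hmax
          exact ⟨f, hf, by rw [e]; abel⟩
        unfold gm at hs; rw [hdg] at hs; omega)]
  push_cast
  rw [Finset.sum_add_distrib, Finset.sum_ite_eq' Finset.univ c0,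
    Finset.sum_const, Finset.card_univ, nsmul_eq_mul, Nat.card_eq_fintype_card]
  simp

end EE3
end RatCurve

open IntermediateField

namespace RatCurve

section EE4
set_option linter.unusedSectionVars false
variable {k C : Type*} [Field k] [Field C] [Algebra k C] [FF k C] [IsAlgClosed k]

theorem rat_of_genus (h : gm (0 : Pl k C →₀ ℤ) = gg k C) :
    ∃ t : C, Transcendental k t ∧ IntermediateField.adjoin k {t} = ⊤ := by
  let P : Pl k C := Classical.arbitrary _
  have h0 : (0 : Pl k C →₀ ℤ) ≤ Finsupp.single P 1 := Finsupp.single_nonneg.mpr zero_le_one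
  have h1 := gm_mono h0
  have h2 := gm_le (Finsupp.single P (1 : ℤ))
  have h3 : ll (Finsupp.single P (1 : ℤ)) = 2 := by
    have h4 : gm (Finsupp.single P (1 : ℤ)) = gm (0 : Pl k C →₀ ℤ) := by omega
    unfold gm at h4
    rw [dg_single, map_zero, ll_zero] at h4
    omega
  have h5 : ∃ f ∈ Ls (Finsupp.single P (1 : ℤ)), f ∉ Ls (0 : Pl k C →₀ ℤ) := by
    by_contra hc
    push Not at hc
    have : Ls (Finsupp.single P (1 : ℤ)) = Ls 0 := le_antisymm hc (Ls_mono h0)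
    have h6 := ll_zero (k := k) (C := C)
    unfold ll at h3 h6
    rw [this] at h3
    omega
  obtain ⟨f, hf, hf0⟩ := h5
  have hft : Transcendental k f := by
    apply transc_of_notMem
    rintro ⟨c, rfl⟩
    apply hf0
    rw [Ls_zero, Submodule.mem_span_singleton]
    exact ⟨c, by rw [Algebra.smul_def, mul_one]⟩
  refine ⟨f, hft, ?_⟩
  have hne := transc_ne_zero hft
  rw [mem_Ls' hne] at hf
  have hp : poles k f ≤ Finsupp.single P 1 := by
    unfold poles
    refine sup_le ?_ h0
    rw [dv_inv hne]
    exact neg_le_iff_add_nonneg.mpr hf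
  have hd := dg_mono hp
  rw [dg_single, dg_poles hft] at hd
  have := FF.fin f hft
  have hpos : 0 < Module.finrank k⟮f⟯ C := Module.finrank_pos
  have h1 : Module.finrank k⟮f⟯ C = 1 := by omega
  exact IntermediateField.finrank_eq_one_iff_eq_top.mp h1

theorem Hs_card {φ : RingAut C} {q : ℕ} (h : IsFr k φ q) {ℓ : ℕ} [Fact ℓ.Prime]
    [Finite (Hs h)]
    (htors : ∀ D : Pl k C →₀ ℤ, ℓ • D ∈ Pr k C → D ∈ Pr k C) : (Nat.card (Hs h) : ZMod ℓ) ≠ 0 := by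
  intro hc
  rw [ZMod.natCast_eq_zero_iff] at hc
  obtain ⟨c, hc⟩ := exists_prime_addOrderOf_dvd_card' ℓ hc
  obtain ⟨D, h0, h1, rfl⟩ := exists_Hs h c
  have h2 := addOrderOf_nsmul_eq_zero (⟨QuotientAddGroup.mk D, mk_mem_Hs h h0 h1⟩ : Hs h)
  rw [hc] at h2
  have h3 : (QuotientAddGroup.mk (ℓ • D) : (Pl k C →₀ ℤ) ⧸ Pr k C) = 0 := congrArg Subtype.val h2
  rw [QuotientAddGroup.eq_zero_iff] at h3
  have h4 : (⟨QuotientAddGroup.mk D, mk_mem_Hs h h0 h1⟩ : Hs h) = 0 :=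
    Subtype.ext ((QuotientAddGroup.eq_zero_iff _).mpr (htors D h3))
  rw [h4, addOrderOf_zero] at hc
  exact (Fact.out : ℓ.Prime).one_lt.ne hc

theorem rat_of_tors {φ : RingAut C} {q : ℕ} (h : IsFr k φ q) {P0 : Pl k C} (hP : sg h P0 = P0)
    (hq : 2 ≤ q) (hqk : (q : k) = 0) {ℓ : ℕ} [Fact ℓ.Prime] (hqℓ : (q : ZMod ℓ) = 1)
    (hfin : ∀ m, 0 < m → {P | (sg h ^ m) P = P}.Finite)
    (htors : ∀ D : Pl k C →₀ ℤ, ℓ • D ∈ Pr k C → D ∈ Pr k C) :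
    ∃ t : C, Transcendental k t ∧ IntermediateField.adjoin k {t} = ⊤ := by
  by_contra hcon
  have hsp : gm (0 : Pl k C →₀ ℤ) ≠ gg k C := fun e => hcon (rat_of_genus e)
  obtain ⟨N, hN⟩ := riemann k C
  obtain ⟨z, ⟨D, hDz, hD⟩, hzmax⟩ := Int.exists_greatest_of_bdd
    (P := fun z => ∃ D : Pl k C →₀ ℤ, dg D = z ∧ gm D ≠ gg k C)
    ⟨N, fun z ⟨D, hDz, hD⟩ => by
      by_contra hz
      push Not at hz
      exact hD (hN D (by omega))⟩ ⟨0, 0, map_zero _, hsp⟩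
  have hmax : ∀ E : Pl k C →₀ ℤ, dg D < dg E → gm E = gg k C := by
    intro E hE
    by_contra hne
    have := hzmax (dg E) ⟨E, rfl, hne⟩
    omega
  have hz0 : 0 ≤ z := hzmax 0 ⟨0, map_zero _, hsp⟩
  lift z to ℕ using hz0 with d0
  have hP' : ∀ n, sg (h.pow n) P0 = P0 := by
    intro n
    rw [sg_pow]
    exact Equiv.Perm.pow_apply_eq_self_of_apply_eq_self hP n
  have hfin' : ∀ n, 0 < n → ∀ d, Finite (XD (sg (h.pow n)) d) := by
    intro n hn d
    rw [sg_pow]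
    refine XD_finite (fun m hm => ?_) d
    rw [← pow_mul]
    exact hfin _ (Nat.mul_pos hn hm)
  have hq' : ∀ n, 0 < n → 2 ≤ q ^ n := fun n hn => le_trans hq (Nat.le_self_pow hn.ne' q)
  have hqk' : ∀ n, 0 < n → ((q ^ n : ℕ) : k) = 0 := fun n hn => by
    rw [Nat.cast_pow, hqk, zero_pow hn.ne']
  have hqℓ' : ∀ n, ((q ^ n : ℕ) : ZMod ℓ) = 1 := fun n => by
    rw [Nat.cast_pow, hqℓ, one_pow]
  have e1 : sg (h.pow 1) = sg h := by rw [sg_pow, pow_one]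
  obtain ⟨n, hn, hn0⟩ := zeta_abs hfin ℓ (fun n => Nat.card (Hs (h.pow n))) (gg k C) d0
    (fun n hn => by
      refine ⟨N.toNat, fun d hd => ?_⟩
      rw [← sg_pow]
      exact cnt_H1 (h.pow n) (hP' n) (hq' n hn) (hqk' n hn) (hqℓ' n) (hfin' n hn) d
        (fun E hE => hN E (by omega)))
    (fun d hd => by
      have := cnt_H1 (h.pow 1) (hP' 1) (hq' 1 one_pos) (hqk' 1 one_pos) (hqℓ' 1) (hfin' 1 one_pos) d
        (fun E hE => hmax E (by omega))
      rwa [e1] at this)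
    (by
      have := cnt_H3 (h.pow 1) (hP' 1) (hq' 1 one_pos) (hqk' 1 one_pos) (hqℓ' 1) (hfin' 1 one_pos) d0
        hD hDz hmax
      rwa [e1] at this)
  have := Hs_finite (h.pow n) (hP' n) (hq' n hn) (hqk' n hn) (hfin' n hn)
  exact Hs_card (h.pow n) htors hn0

end EE4
end RatCurve

open IntermediateField

namespace RatCurve

section EE2
set_option linter.unusedSectionVars false

theorem exists_pow_eq {k : Type*} [Field k] (p : ℕ) [Fact p.Prime] [CharP k p]
    (hk : Algebra.IsAlgebraic (⊥ : Subfield k) k) (c : k) : ∃ m, 0 < m ∧ c ^ p ^ m = c := by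
  have hfin : Finite (⊥ : Subfield k) := by
    have hle : (⊥ : Subfield k) ≤ (ZMod.castHom (dvd_refl p) k).fieldRange := bot_le
    have : Finite (ZMod.castHom (dvd_refl p) k).fieldRange :=
      Finite.of_surjective (ZMod.castHom (dvd_refl p) k).rangeRestrictField
        (ZMod.castHom (dvd_refl p) k).rangeRestrictField_bijective.2
    exact Finite.of_injective _ (Subfield.inclusion hle).injective
  have hint : IsIntegral (⊥ : Subfield k) c := (hk.isAlgebraic c).isIntegral
  let K := IntermediateField.adjoin (⊥ : Subfield k) {c}
  have : FiniteDimensional (⊥ : Subfield k) K := IntermediateField.adjoin.finiteDimensional hint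
  have : Finite K := Module.finite_of_finite (⊥ : Subfield k)
  let _ := Fintype.ofFinite K
  have hcp : CharP K p := (algebraMap K k).charP (algebraMap K k).injective p
  obtain ⟨n, hn, hcard⟩ := FiniteField.card K p
  refine ⟨n, n.2, ?_⟩
  have h := FiniteField.pow_card (⟨c, IntermediateField.mem_adjoin_simple_self _ c⟩ : K)
  rw [hcard] at h
  exact congrArg Subtype.val h

theorem pow_iter_eq {k : Type*} [Monoid k] {p m : ℕ} {c : k} (h : c ^ p ^ m = c) (j : ℕ) :
    c ^ p ^ (m * j) = c := by
  induction j with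
  | zero => simp
  | succ j ih => rw [Nat.mul_succ, pow_add, pow_mul, ih, h]

theorem exists_common {k : Type*} [Field k] (p : ℕ) [Fact p.Prime] [CharP k p]
    (hk : Algebra.IsAlgebraic (⊥ : Subfield k) k) (T : Finset k) :
    ∃ m, 0 < m ∧ ∀ c ∈ T, c ^ p ^ m = c := by
  choose m hm h using exists_pow_eq p hk
  refine ⟨∏ c ∈ T, m c, Finset.prod_pos fun c _ => hm c, fun c hc => ?_⟩
  obtain ⟨j, hj⟩ := Finset.dvd_prod_of_mem m hc
  rw [hj]
  exact pow_iter_eq (h c) j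

theorem exists_aut {k C : Type*} [Field k] [Field C] [Algebra k C] [IsAlgClosed k]
    (hfg : (⊤ : IntermediateField k C).FG) :
    ∃ (S : Finset C) (T : Finset k), IntermediateField.adjoin k (S : Set C) = ⊤ ∧
      ∀ F : k ≃+* k, (∀ c ∈ T, F c = c) →
        ∃ φ : RingAut C, (∀ c, φ (algebraMap k C c) = algebraMap k C (F c)) ∧ ∀ x ∈ S, φ x = x := by
  classical
  obtain ⟨S, hS⟩ := hfg
  let ev : MvPolynomial (S : Set C) k →ₐ[k] C := MvPolynomial.aeval (fun s => (s : C))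
  obtain ⟨G, hG⟩ := (isNoetherianRing_iff_ideal_fg _).mp
    (inferInstance : IsNoetherianRing (MvPolynomial (S : Set C) k)) (RingHom.ker (ev : _ →+* C))
  refine ⟨S, G.biUnion (fun g => g.support.image g.coeff), hS, fun F hF => ?_⟩
  have hfix : ∀ F : k ≃+* k, (∀ c ∈ G.biUnion (fun g => g.support.image g.coeff), F c = c) →
      ∀ g ∈ G, MvPolynomial.map (F : k →+* k) g = g := by
    intro F hF g hg
    ext m
    rw [MvPolynomial.coeff_map]
    by_cases hm : m ∈ g.support
    · exact hF _ (Finset.mem_biUnion.mpr ⟨g, hg, Finset.mem_image_of_mem _ hm⟩)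
    · rw [MvPolynomial.notMem_support_iff.mp hm, map_zero]
  have hker : ∀ F : k ≃+* k, (∀ c ∈ G.biUnion (fun g => g.support.image g.coeff), F c = c) →
      ∀ g, ev g = 0 → ev (MvPolynomial.map (F : k →+* k) g) = 0 := by
    intro F hF g hg
    have h1 : g ∈ Ideal.span (G : Set (MvPolynomial (S : Set C) k)) := by
      rw [hG]; exact hg
    have h2 := Ideal.mem_map_of_mem (MvPolynomial.map (F : k →+* k)) h1
    rw [Ideal.map_span] at h2
    have h3 : (MvPolynomial.map (F : k →+* k)) '' (G : Set (MvPolynomial (S : Set C) k)) ⊆ G := by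
      rintro _ ⟨g, hg, rfl⟩
      rw [hfix F hF g hg]; exact hg
    have h4 := Ideal.span_mono h3 h2
    rw [hG] at h4
    exact h4
  have hFs : ∀ c ∈ G.biUnion (fun g => g.support.image g.coeff), F.symm c = c := fun c hc => by
    rw [RingEquiv.symm_apply_eq, hF c hc]
  have hinv : ∀ g : MvPolynomial (S : Set C) k,
      MvPolynomial.map (F.symm : k →+* k) (MvPolynomial.map (F : k →+* k) g) = g := by
    intro g
    rw [MvPolynomial.map_map]
    convert MvPolynomial.map_id g
    ext; simp
  have hinv' : ∀ g : MvPolynomial (S : Set C) k,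
      MvPolynomial.map (F : k →+* k) (MvPolynomial.map (F.symm : k →+* k) g) = g := by
    intro g
    rw [MvPolynomial.map_map]
    convert MvPolynomial.map_id g
    ext; simp
  let A := ev.range
  let e : MvPolynomial (S : Set C) k →+* A := (ev.rangeRestrict : _ →+* A)
  have he : Function.Surjective e := ev.rangeRestrict_surjective
  have hev : ∀ g, ((e g : A) : C) = ev g := fun g => rfl
  let ψ : A →+* C := e.liftOfSurjective he
    ⟨(ev : _ →+* C).comp (MvPolynomial.map (F : k →+* k)), fun g hg => by
      rw [RingHom.mem_ker] at hg ⊢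
      refine hker F hF g ?_
      rw [← hev, hg]; rfl⟩
  have hψ : ∀ g, ψ (e g) = ev (MvPolynomial.map (F : k →+* k) g) := fun g =>
    RingHom.liftOfRightInverse_comp_apply _ _ _ _ g
  have hψi : Function.Injective ψ := by
    rw [injective_iff_map_eq_zero]
    intro a ha
    obtain ⟨g, rfl⟩ := he a
    rw [hψ] at ha
    have := hker F.symm hFs _ ha
    rw [hinv] at this
    exact Subtype.ext this
  have hdiv : ∀ z : C, ∃ r s, z = ev r / ev s := fun z => by
    have : z ∈ IntermediateField.adjoin k (S : Set C) := by rw [hS]; trivial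
    exact (IntermediateField.mem_adjoin_iff k z).mp this
  have hfr : IsFractionRing A C := IsFractionRing.of_field A C (fun z => by
    obtain ⟨r, s, h⟩ := hdiv z
    exact ⟨e r, e s, h⟩)
  let φ : C →+* C := IsFractionRing.lift hψi
  have hφ : ∀ g, φ (ev g) = ev (MvPolynomial.map (F : k →+* k) g) := by
    intro g
    rw [← hψ]
    exact IsFractionRing.lift_algebraMap hψi (e g)
  have hφs : Function.Surjective φ := by
    intro z
    obtain ⟨r, s, rfl⟩ := hdiv z
    refine ⟨ev (MvPolynomial.map (F.symm : k →+* k) r) / ev (MvPolynomial.map (F.symm : k →+* k) s), ?_⟩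
    rw [map_div₀, hφ, hφ, hinv', hinv']
  refine ⟨RingEquiv.ofBijective φ ⟨φ.injective, hφs⟩, fun c => ?_, fun x hx => ?_⟩
  · have := hφ (MvPolynomial.C c)
    change φ _ = _
    simpa [ev] using this
  · have := hφ (MvPolynomial.X ⟨x, hx⟩)
    change φ _ = _
    simpa [ev] using this

theorem exists_frob {k C : Type*} [Field k] [Field C] [Algebra k C] [IsAlgClosed k] [FF k C]
    (hfg : (⊤ : IntermediateField k C).FG) (p ℓ : ℕ) [Fact p.Prime] [Fact ℓ.Prime] (hpℓ : p ≠ ℓ)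
    [CharP k p] (hk : Algebra.IsAlgebraic (⊥ : Subfield k) k) :
    ∃ (φ : RingAut C) (q : ℕ), IsFr k φ q ∧ 2 ≤ q ∧ (q : k) = 0 ∧ (q : ZMod ℓ) = 1 ∧
      ∃ x : C, Transcendental k x ∧ φ x = x := by
  obtain ⟨S, T, hS, H⟩ := exists_aut hfg
  obtain ⟨m, hm, hT⟩ := exists_common p hk T
  have hp : p.Prime := Fact.out
  have hℓ : ℓ.Prime := Fact.out
  have hr : m * (ℓ - 1) ≠ 0 := Nat.mul_ne_zero hm.ne' (by have := hℓ.two_le; omega)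
  obtain ⟨φ, h1, h2⟩ := H (iterateFrobeniusEquiv k p (m * (ℓ - 1))) (fun c hc => by
    rw [iterateFrobeniusEquiv_apply, iterateFrobenius_def]
    exact pow_iter_eq (hT c hc) _)
  refine ⟨φ, p ^ (m * (ℓ - 1)), ⟨pow_pos hp.pos _, fun c => ?_⟩, ?_, ?_, ?_, ?_⟩
  · rw [h1, iterateFrobeniusEquiv_apply, iterateFrobenius_def]
  · exact le_trans hp.two_le (Nat.le_self_pow hr p)
  · rw [Nat.cast_pow, CharP.cast_eq_zero, zero_pow hr]
  · rw [mul_comm, pow_mul, Nat.cast_pow, Nat.cast_pow, ZMod.pow_card_sub_one_eq_one, one_pow]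
    rw [Ne, ZMod.natCast_eq_zero_iff]
    intro hd
    exact hpℓ ((Nat.prime_dvd_prime_iff_eq hℓ hp).mp hd).symm
  · by_contra hcon
    push Not at hcon
    obtain ⟨x, hx⟩ := FF.exT (k := k) (C := C)
    have hle : IntermediateField.adjoin k (S : Set C) ≤ ⊥ := by
      rw [IntermediateField.adjoin_le_iff]
      intro y hy
      rcases mem_range_or_transc (k := k) y with h | h
      · exact IntermediateField.mem_bot.mpr h
      · exact absurd (h2 y hy) (hcon y h)
    rw [hS] at hle
    have hxb : x ∈ (⊥ : IntermediateField k C) := hle trivial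
    obtain ⟨c, hc⟩ := IntermediateField.mem_bot.mp hxb
    rw [← hc] at hx
    exact hx (isAlgebraic_algebraMap c)

theorem fix_finite {k C : Type*} [Field k] [Field C] [Algebra k C] [IsAlgClosed k] [FF k C]
    {φ : RingAut C} {q : ℕ} (h : IsFr k φ q) (hq : 2 ≤ q) (hqk : (q : k) = 0) {x : C}
    (hx : Transcendental k x) (hφ : φ x = x) : {P | sg h P = P}.Finite := by
  have hroots := card_roots hq hqk
  have hfinR : Finite {a : k // a ^ q = a} := Nat.finite_of_card_ne_zero (by omega)
  have ht : ∀ c : k, Transcendental k (x - algebraMap k C c) := fun c hc => hx (by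
    have := hc.add (isAlgebraic_algebraMap (A := C) c)
    rwa [sub_add_cancel] at this)
  refine Set.Finite.subset ((zeros_finite (transc_inv hx)).union
    (Set.finite_iUnion fun a : {a : k // a ^ q = a} => zeros_finite (ht a.1))) ?_
  intro P hP
  have hP : sg h P = P := hP
  by_cases hxP : x ∈ P.1
  · right
    obtain ⟨c, hc⟩ := P.exists_residue hxP
    have hne := transc_ne_zero (ht c)
    have h1 : 0 < ord P (x - algebraMap k C c) := by
      rw [mem_nonunits, mem_M' hne] at hc; omega
    have h2 := ord_sg h P hne
    rw [hP, map_sub, hφ, h.map] at h2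
    have h3 : x - algebraMap k C (c ^ q) ∈ P.1.nonunits := by
      rw [mem_nonunits, mem_M' (transc_ne_zero (ht _))]; omega
    have h4 : algebraMap k C (c ^ q - c) ∈ P.1.nonunits := by
      rw [mem_nonunits] at hc h3 ⊢
      have := sub_mem hc h3
      rw [map_sub]
      convert this using 1
      ring
    have h5 := P.const_nonunit h4
    exact Set.mem_iUnion.mpr ⟨⟨c, sub_eq_zero.mp h5⟩, h1⟩
  · left
    have hx0 := transc_ne_zero hx
    rw [mem_iff_ord P hx0] at hxP
    show 0 < ord P x⁻¹
    rw [ord_inv P hx0]; omega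

theorem exists_fix {k C : Type*} [Field k] [Field C] [Algebra k C] [IsAlgClosed k] [FF k C]
    {φ : RingAut C} {q : ℕ} (h : IsFr k φ q) {x : C}
    (hx : Transcendental k x) (hφ : φ x = x) : ∃ n, 0 < n ∧ ∃ P, (sg h ^ n) P = P := by
  obtain ⟨P, hP⟩ := exists_zero hx
  have hfin := (zeros_finite (k := k) hx).to_subtype
  have hZ : ∀ i : ℕ, 0 < ord ((sg h ^ i) P) x := by
    intro i
    induction i with
    | zero => exact hP
    | succ i ih =>
      rw [pow_succ', Equiv.Perm.mul_apply]
      have := ord_sg h ((sg h ^ i) P) (transc_ne_zero hx)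
      rw [hφ] at this
      omega
  obtain ⟨i, j, hij, e⟩ := Finite.exists_ne_map_eq_of_infinite
    (fun i : ℕ => (⟨(sg h ^ i) P, hZ i⟩ : {P : Pl k C | 0 < ord P x}))
  have e' : (sg h ^ i) P = (sg h ^ j) P := congrArg Subtype.val e
  clear e
  wlog hlt : i < j generalizing i j
  · exact this j i hij.symm e'.symm (by omega)
  obtain ⟨n, rfl⟩ := Nat.exists_eq_add_of_lt hlt
  refine ⟨n + 1, by omega, P, ?_⟩
  apply (sg h ^ i).injective
  rw [← Equiv.Perm.mul_apply, ← pow_add, e']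
  rfl

theorem rat_of_no_tors {k C : Type*} [Field k] [Field C] [Algebra k C] [IsAlgClosed k] [FF k C]
    (hfg : (⊤ : IntermediateField k C).FG) (p ℓ : ℕ) [Fact p.Prime] [Fact ℓ.Prime] (hpℓ : p ≠ ℓ)
    [CharP k p] (hk : Algebra.IsAlgebraic (⊥ : Subfield k) k)
    (htors : ∀ D : Pl k C →₀ ℤ, ℓ • D ∈ Pr k C → D ∈ Pr k C) :
    ∃ t : C, Transcendental k t ∧ IntermediateField.adjoin k {t} = ⊤ := by
  obtain ⟨φ, q, h, hq, hqk, hqℓ, x, hx, hφ⟩ := exists_frob (C := C) hfg p ℓ hpℓ hk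
  obtain ⟨n, hn, P0, hP0⟩ := exists_fix h hx hφ
  have hφn : ∀ n : ℕ, (φ ^ n) x = x := by
    intro n
    induction n with
    | zero => rfl
    | succ n ih => rw [pow_succ, RingAut.mul_apply, hφ, ih]
  have hq' : ∀ n, 0 < n → 2 ≤ q ^ n := fun n hn => le_trans hq (Nat.le_self_pow hn.ne' q)
  have hqk' : ∀ n, 0 < n → ((q ^ n : ℕ) : k) = 0 := fun n hn => by
    rw [Nat.cast_pow, hqk, zero_pow hn.ne']
  refine rat_of_tors (h.pow n) (P0 := P0) (by rwa [sg_pow]) (hq' n hn) (hqk' n hn)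
    (ℓ := ℓ) (by rw [Nat.cast_pow, hqℓ, one_pow]) (fun m hm => ?_) htors
  have hnm := Nat.mul_pos hn hm
  rw [sg_pow h, ← pow_mul, ← sg_pow h]
  exact fix_finite (h.pow (n * m)) (hq' _ hnm) (hqk' _ hnm) hx (hφn _)

end EE2
end RatCurve

open IntermediateField

namespace RatCurve

section KK
set_option linter.unusedSectionVars false

theorem trdeg_eq (k K : Type*) [CommRing k] [CommRing K] [Algebra k K] :
    trdeg k K = Algebra.trdeg k K := rfl

theorem FF_of {k C : Type*} [Field k] [Field C] [Algebra k C]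
    (hfg : (⊤ : IntermediateField k C).FG) (htd : trdeg k C = 1) : FF k C := by
  rw [trdeg_eq] at htd
  constructor
  · intro x hx
    have hi : AlgebraicIndependent k ((↑) : ({x} : Set C) → C) := by
      exact algebraicIndependent_unique_type_iff.mpr hx
    have hb : IsTranscendenceBasis k ((↑) : ({x} : Set C) → C) :=
      hi.isTranscendenceBasis_of_trdeg_le_of_finite (by rw [htd]; simp)
    have halg : Algebra.IsAlgebraic k⟮x⟯ C := by
      have := hb.isAlgebraic_field
      rwa [Subtype.range_coe] at this
    obtain ⟨S, hS⟩ := hfg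
    have h1 : FiniteDimensional k⟮x⟯ (IntermediateField.adjoin k⟮x⟯ (S : Set C)) :=
      IntermediateField.finiteDimensional_adjoin (fun y _ => (halg.isAlgebraic y).isIntegral)
    have h2 : IntermediateField.adjoin k⟮x⟯ (S : Set C) = ⊤ := by
      rw [eq_top_iff]
      have : (⊤ : IntermediateField k C) ≤ (IntermediateField.adjoin k⟮x⟯ (S : Set C)).restrictScalars k := by
        rw [← hS, IntermediateField.adjoin_le_iff]
        exact IntermediateField.subset_adjoin _ _
      intro y _
      exact this (trivial : y ∈ (⊤ : IntermediateField k C))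
    rw [h2] at h1
    exact Module.Finite.equiv (IntermediateField.topEquiv (F := k⟮x⟯) (E := C)).toLinearEquiv
  · by_contra hcon
    push Not at hcon
    have : Algebra.IsAlgebraic k C := ⟨fun x => by
      have := hcon x
      unfold Transcendental at this
      tauto⟩
    rw [trdeg_eq_zero] at htd
    exact zero_ne_one htd

variable {k C : Type*} [Field k] [Field C] [Algebra k C] [FF k C] [IsAlgClosed k]

theorem isZPD_of (htd : trdeg k C = 1) (P : Pl k C) : IsZPD k P.1 where
  trivialBase := P.2.1
  nontrivial := P.2.2
  discrete := by
    have hv : ∀ {x y : C}, x ≠ 0 → y ≠ 0 → (P.1.valuation x = P.1.valuation y ↔ ord P x = ord P y) := by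
      have : ∀ {x y : C}, x ≠ 0 → y ≠ 0 → (P.1.valuation x ≤ P.1.valuation y ↔ ord P y ≤ ord P x) := by
        intro x y hx hy
        have h1 : P.1.valuation x ≤ P.1.valuation y ↔ P.1.valuation (x / y) ≤ 1 := by
          rw [map_div₀, div_le_one₀ (by
            rw [zero_lt_iff]; exact (Valuation.ne_zero_iff _).mpr hy)]
        rw [h1, ValuationSubring.valuation_le_one_iff, mem_iff_ord P (div_ne_zero hx hy),
          div_eq_mul_inv, ord_mul P hx (inv_ne_zero hy), ord_inv P hy]
        omega
      intro x y hx hy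
      rw [le_antisymm_iff, this hx hy, this hy hx]
      omega
    have hex : ∀ u : (P.1.ValueGroup)ˣ, ∃ x : C, x ≠ 0 ∧ P.1.valuation x = u := by
      intro u
      obtain ⟨x, hx⟩ := P.1.valuation_surjective (u : P.1.ValueGroup)
      refine ⟨x, ?_, hx⟩
      rintro rfl
      rw [map_zero] at hx
      exact u.ne_zero hx.symm
    choose r hr0 hr using hex
    refine ⟨MulEquiv.ofBijective (MonoidHom.mk' (fun u => Multiplicative.ofAdd (ord P (r u))) ?_) ⟨?_, ?_⟩⟩
    · intro a b
      rw [← ofAdd_add, ← ord_mul P (hr0 _) (hr0 _)]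
      congr 1
      rw [← hv (hr0 _) (mul_ne_zero (hr0 _) (hr0 _)), map_mul, hr, hr, hr, Units.val_mul]
    · intro a b e
      have e' : ord P (r a) = ord P (r b) := Multiplicative.ofAdd.injective e
      rw [← hv (hr0 _) (hr0 _), hr, hr] at e'
      exact Units.ext e'
    · intro n
      obtain ⟨π, h0, hπ⟩ := exists_unif P
      have hne : P.1.valuation (π ^ (Multiplicative.toAdd n)) ≠ 0 :=
        (Valuation.ne_zero_iff _).mpr (zpow_ne_zero _ h0)
      refine ⟨Units.mk0 _ hne, ?_⟩
      have := (hv (hr0 (Units.mk0 _ hne)) (zpow_ne_zero _ h0)).mp (by rw [hr]; rfl)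
      rw [ord_zpow P h0, hπ, mul_one] at this
      change Multiplicative.ofAdd _ = _
      rw [this]; rfl
  residue_td := by
    rw [htd]
    have halg : @Algebra.IsAlgebraic k (IsLocalRing.ResidueField P.1) _ _
        (resMap P.1 P.2.1).toAlgebra := by
      let _ := (resMap P.1 P.2.1).toAlgebra
      refine ⟨fun y => ?_⟩
      obtain ⟨x, rfl⟩ := IsLocalRing.residue_surjective y
      obtain ⟨c, hc⟩ := P.exists_residue x.2
      have : IsLocalRing.residue P.1 x = algebraMap k _ c := by
        change _ = IsLocalRing.residue P.1 ⟨algebraMap k C c, P.2.1 c⟩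
        rw [← sub_eq_zero, ← map_sub, IsLocalRing.residue_eq_zero_iff]
        rw [ValuationSubring.mem_nonunits_iff_exists_mem_maximalIdeal] at hc
        exact hc.2
      rw [this]
      exact isAlgebraic_algebraMap c
    let _ := (resMap P.1 P.2.1).toAlgebra
    have h0 : trdeg k (IsLocalRing.ResidueField P.1) = 0 := by
      rw [trdeg_eq]; exact trdeg_eq_zero
    exact (congrArg (· + 1) h0).trans (zero_add 1)

end KK
end RatCurve

open IntermediateField

namespace RatCurve

section II
set_option linter.unusedSectionVars false

theorem normal_bSup {K A : Type*} [Field K] [Field A] [Algebra K A]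
    (S : Set (IntermediateField K A)) (h : ∀ L ∈ S, Normal K L) :
    Normal K (⨆ L ∈ S, L : IntermediateField K A) := by
  have e : (⨆ L ∈ S, L : IntermediateField K A) = ⨆ L : S, L.1 := iSup_subtype'
  rw [e]
  have : ∀ L : S, Normal K L.1 := fun L => h L.1 L.2
  exact IntermediateField.normal_iSup K A _

instance galLab (ℓ : ℕ) (K : Type*) [Field K] : IsGalois K (proLab ℓ K) := by
  have hn : Normal K (proLab ℓ K) := normal_bSup _ fun L hL => hL.1.to_normal
  have hs : Algebra.IsSeparable K (proLab ℓ K) := by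
    rw [← le_separableClosure_iff]
    refine iSup₂_le fun L hL => ?_
    rw [le_separableClosure_iff]
    exact hL.1.to_isSeparable
  exact { }

theorem adjoin_simple_gen_top {K A : Type*} [Field K] [Field A] [Algebra K A] (y : A) :
    IntermediateField.adjoin K {AdjoinSimple.gen K y} = ⊤ := by
  apply IntermediateField.lift_injective
  rw [lift_adjoin_simple, lift_top, AdjoinSimple.coe_gen]

theorem mem_proLab {ℓ : ℕ} (hl : ℓ.Prime) {K : Type*} [Field K] (hK : (primitiveRoots ℓ K).Nonempty)
    {f : K} {y : AlgebraicClosure K} (hy : y ^ ℓ = algebraMap K _ f) : y ∈ proLab ℓ K := by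
  by_cases hf : ∃ b, b ^ ℓ = f
  · obtain ⟨b, rfl⟩ := hf
    obtain ⟨ζ, hζ⟩ := hK
    rw [mem_primitiveRoots hl.pos] at hζ
    have hζ' := hζ.map_of_injective (algebraMap K (AlgebraicClosure K)).injective
    by_cases hb : b = 0
    · subst hb
      rw [zero_pow hl.ne_zero, map_zero] at hy
      rw [eq_zero_of_pow_eq_zero hy]
      exact zero_mem _
    have hb' : algebraMap K (AlgebraicClosure K) b ≠ 0 := by simpa using hb
    obtain ⟨i, -, hi⟩ := have := NeZero.mk hl.ne_zero
      hζ'.eq_pow_of_pow_eq_one (ξ := y / algebraMap K _ b) (by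
      rw [div_pow, hy, map_pow, div_self (pow_ne_zero _ hb')])
    have : y = algebraMap K _ (ζ ^ i * b) := by
      rw [map_mul, map_pow, hi, div_mul_cancel₀ _ hb']
    rw [this]
    exact IntermediateField.algebraMap_mem _ _
  · push Not at hf
    have hirr := X_pow_sub_C_irreducible_of_prime hl (a := f) hf
    have hm : minpoly K y = Polynomial.X ^ ℓ - Polynomial.C f :=
      (minpoly.eq_of_irreducible_of_monic hirr (by simp [hy])
        (Polynomial.monic_X_pow_sub_C f hl.ne_zero)).symm
    have hint : IsIntegral K y := Algebra.IsIntegral.isIntegral y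
    have hfr : Module.finrank K K⟮y⟯ = ℓ := by
      rw [IntermediateField.adjoin.finrank hint, hm, Polynomial.natDegree_X_pow_sub_C]
    have : FiniteDimensional K K⟮y⟯ := IntermediateField.adjoin.finiteDimensional hint
    have h3 : IsGalois K K⟮y⟯ ∧ IsCyclic (K⟮y⟯ ≃ₐ[K] K⟮y⟯) := by
      have hh := (isCyclic_tfae K K⟮y⟯ (by rwa [hfr])).out 0 2
      refine hh.mpr ⟨AdjoinSimple.gen K y, ⟨f, ?_⟩, ?_⟩
      · apply Subtype.val_injective
        rw [hfr]
        exact hy.symm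
      · exact adjoin_simple_gen_top y
    refine (le_iSup₂_of_le (f := fun L _ => L) K⟮y⟯ ⟨h3.1, ⟨1, by rw [hfr, pow_one]⟩, ?_⟩ le_rfl) (mem_adjoin_simple_self K y)
    have := h3.2
    exact fun a b => (IsCyclic.isMulCommutative (α := K⟮y⟯ ≃ₐ[K] K⟮y⟯)).is_comm.comm a b

variable {k C : Type*} [Field k] [Field C] [Algebra k C] [FF k C] [IsAlgClosed k]

theorem inertia_fix {E : Type*} [Field E] [Algebra C E] {ℓ : ℕ} (hl : ℓ.Prime) {ζ : k}
    (hζ : IsPrimitiveRoot ζ ℓ) (P : Pl k C) (O' : ValuationSubring E)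
    (hO : O'.comap (algebraMap C E) = P.1) {σ : E ≃ₐ[C] E} (hσ : σ ∈ inertiaSubgroup O')
    {f : C} (hf : f ≠ 0) (hd : (ℓ : ℤ) ∣ ord P f) {y : E} (hy : y ^ ℓ = algebraMap C E f) :
    σ y = y := by
  obtain ⟨π, hπ, hπ1⟩ := exists_unif P
  obtain ⟨m, hm⟩ := hd
  have := NeZero.mk hl.ne_zero
  have hmem : ∀ x : C, algebraMap C E x ∈ O' ↔ x ∈ P.1 := by
    intro x; rw [← hO]; rfl
  set a : C := π ^ m with ha
  have ha0 : a ≠ 0 := zpow_ne_zero _ hπ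
  have ha0' : algebraMap C E a ≠ 0 := by simpa using ha0
  have hy0 : y ≠ 0 := by
    rintro rfl
    rw [zero_pow hl.ne_zero] at hy
    exact hf ((map_eq_zero (algebraMap C E)).mp hy.symm)
  have hg : ord P (f / a ^ ℓ) = 0 := by
    rw [div_eq_mul_inv, ord_mul P hf (inv_ne_zero (pow_ne_zero _ ha0)), ord_inv P (pow_ne_zero _ ha0),
      ord_pow P ha0, hm, ha, ord_zpow P hπ, hπ1]
    ring
  have hg0 : f / a ^ ℓ ≠ 0 := div_ne_zero hf (pow_ne_zero _ ha0)
  set u := y / algebraMap C E a with hu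
  have hu0 : u ≠ 0 := div_ne_zero hy0 ha0'
  have hul : u ^ ℓ = algebraMap C E (f / a ^ ℓ) := by
    rw [hu, div_pow, hy, map_div₀, map_pow]
  have hv : O'.valuation u = 1 := by
    have h1 : O'.valuation u ^ ℓ = 1 := by
      rw [← map_pow, hul]
      refine le_antisymm ?_ ?_
      · rw [ValuationSubring.valuation_le_one_iff, hmem, mem_iff_ord P hg0, hg]
      · have : O'.valuation (algebraMap C E (f / a ^ ℓ))⁻¹ ≤ 1 := by
          rw [← map_inv₀, ValuationSubring.valuation_le_one_iff, hmem, mem_iff_ord P (inv_ne_zero hg0), ord_inv P hg0, hg]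
          rfl
        rw [map_inv₀] at this
        have hp : 0 < O'.valuation (algebraMap C E (f / a ^ ℓ)) := by
          rw [zero_lt_iff, Valuation.ne_zero_iff]; simpa using hg0
        exact (inv_le_one₀ hp).mp this
    exact (pow_eq_one_iff_of_nonneg zero_le hl.ne_zero).mp h1
  have hζE : IsPrimitiveRoot (algebraMap C E (algebraMap k C ζ)) ℓ :=
    (hζ.map_of_injective (algebraMap k C).injective).map_of_injective (algebraMap C E).injective
  obtain ⟨i, -, hi⟩ := hζE.eq_pow_of_pow_eq_one (ξ := σ u / u) (by
    rw [div_pow, ← map_pow, hul, AlgEquiv.commutes, div_self (by simpa using hg0)])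
  have hσu : σ u = algebraMap C E (algebraMap k C (ζ ^ i)) * u := by
    rw [map_pow, map_pow, hi, div_mul_cancel₀ _ hu0]
  have h2 : O'.valuation (σ u - u) < 1 := hσ.2 u ((ValuationSubring.valuation_le_one_iff _ _).mp hv.le)
  have h3 : σ u - u = algebraMap C E (algebraMap k C (ζ ^ i - 1)) * u := by
    rw [hσu, map_sub, map_sub, map_one, map_one]; ring
  rw [h3, map_mul, hv, mul_one] at h2
  have h4 : ζ ^ i - 1 = 0 := by
    apply Pl.const_nonunit P
    by_contra hn
    have hne : ζ ^ i - 1 ≠ 0 := fun h => by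
      apply hn; rw [h, map_zero]; exact P.1.nonunits.zero_mem
    have h5 : algebraMap C E (algebraMap k C (ζ ^ i - 1))⁻¹ ∈ O' := by
      rw [hmem, ← map_inv₀]; exact P.2.1 _
    rw [← ValuationSubring.valuation_le_one_iff, map_inv₀, map_inv₀] at h5
    have hp : 0 < O'.valuation (algebraMap C E (algebraMap k C (ζ ^ i - 1))) := by
      rw [zero_lt_iff, Valuation.ne_zero_iff]
      exact (map_ne_zero _).mpr ((map_ne_zero _).mpr hne)
    exact absurd ((inv_le_one₀ hp).mp h5) (not_le.mpr h2)
  have h6 : σ u = u := by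
    rw [← sub_eq_zero, h3, h4]; simp
  rw [hu, map_div₀, AlgEquiv.commutes] at h6
  exact (div_left_inj' ha0').mp h6

theorem rat_of_gen (ℓ p : ℕ) [Fact ℓ.Prime] [Fact p.Prime] (hpℓ : p ≠ ℓ) [CharP k p]
    (hkfin : Algebra.IsAlgebraic (⊥ : Subfield k) k)
    (hCfg : (⊤ : IntermediateField k C).FG)
    (hgen : closure ((Subgroup.closure {σ : GalLab ℓ C |
          ∃ O' : ValuationSubring ↥(proLab ℓ C),
            IsZPD k (O'.comap (algebraMap C ↥(proLab ℓ C))) ∧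
            σ ∈ inertiaSubgroup O'} : Subgroup (GalLab ℓ C)) : Set (GalLab ℓ C)) =
        Set.univ) : ∃ t : C, Transcendental k t ∧ IntermediateField.adjoin k {t} = ⊤ := by
  refine rat_of_no_tors hCfg p ℓ hpℓ hkfin ?_
  have hl : ℓ.Prime := Fact.out
  have hne : NeZero (ℓ : k) := ⟨fun h => hpℓ <| by
    rw [CharP.cast_eq_zero_iff k p] at h
    exact (Nat.prime_dvd_prime_iff_eq Fact.out Fact.out).mp h⟩
  obtain ⟨ζ, hζ⟩ := HasEnoughRootsOfUnity.exists_primitiveRoot k ℓ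
  intro D hD
  obtain ⟨f, hf, hDf⟩ := mem_Pr.mp hD
  obtain ⟨y, hy⟩ := IsAlgClosed.exists_pow_nat_eq (algebraMap C (AlgebraicClosure C) f) hl.pos
  have hyE := mem_proLab hl ⟨algebraMap k C ζ, by
    rw [mem_primitiveRoots hl.pos]
    exact hζ.map_of_injective (algebraMap k C).injective⟩ hy
  set z : proLab ℓ C := ⟨y, hyE⟩ with hz
  have hzl : z ^ ℓ = algebraMap C (proLab ℓ C) f := by
    apply Subtype.val_injective
    exact hy
  have hall : ∀ σ : GalLab ℓ C, σ z = z := by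
    have hsub : closure ((Subgroup.closure {σ : GalLab ℓ C |
          ∃ O' : ValuationSubring ↥(proLab ℓ C),
            IsZPD k (O'.comap (algebraMap C ↥(proLab ℓ C))) ∧
            σ ∈ inertiaSubgroup O'} : Subgroup (GalLab ℓ C)) : Set (GalLab ℓ C)) ⊆
        (C⟮z⟯.fixingSubgroup : Set (GalLab ℓ C)) := by
      refine closure_minimal ?_ (InfiniteGalois.fixingSubgroup_isClosed _)
      rw [SetLike.coe_subset_coe, Subgroup.closure_le]
      rintro σ ⟨O', hO', hσ⟩
      rw [SetLike.mem_coe, IntermediateField.mem_fixingSubgroup_iff]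
      have hfz : σ z = z := by
        let P : Pl k C := ⟨_, hO'.trivialBase, hO'.nontrivial⟩
        have hdd : (ℓ : ℤ) ∣ ord P f := by
          rw [← dv_apply hf, ← hDf]
          exact ⟨D P, by simp⟩
        exact inertia_fix hl hζ P O' rfl hσ hf hdd hzl
      have : C⟮z⟯ ≤ IntermediateField.fixedField (Subgroup.zpowers σ) := by
        rw [adjoin_simple_le_iff, IntermediateField.mem_fixedField_iff]
        rintro g ⟨n, rfl⟩
        have : σ ∈ MulAction.stabilizer (GalLab ℓ C) z := hfz
        exact (MulAction.stabilizer (GalLab ℓ C) z).zpow_mem this n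
      intro x hx
      exact (IntermediateField.mem_fixedField_iff _ _).mp (this hx) σ (Subgroup.mem_zpowers σ)
    rw [hgen] at hsub
    intro σ
    exact (IntermediateField.mem_fixingSubgroup_iff _ _).mp (hsub (Set.mem_univ σ)) z (mem_adjoin_simple_self C z)
  obtain ⟨g, hg⟩ := (InfiniteGalois.mem_range_algebraMap_iff_fixed z).mpr hall
  have hgf : g ^ ℓ = f := by
    apply (algebraMap C (proLab ℓ C)).injective
    rw [map_pow, hg, hzl]
  have hg0 : g ≠ 0 := by
    rintro rfl
    rw [zero_pow hl.ne_zero] at hgf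
    exact hf hgf.symm
  refine mem_Pr.mpr ⟨g, hg0, ?_⟩
  rw [← hgf, dv_pow hg0] at hDf
  ext P
  have := DFunLike.congr_fun hDf P
  simpa [hl.ne_zero] using this

end II
end RatCurve

open IntermediateField

namespace RatCurve

section JJ1
set_option linter.unusedSectionVars false
variable {k C : Type*} [Field k] [Field C] [Algebra k C] [FF k C] [IsAlgClosed k]

theorem poles_single {x : C} (hx : Transcendental k x) (h : k⟮x⟯ = ⊤) {P : Pl k C} (hP : x ∉ P.1) :
    poles k x = Finsupp.single P 1 := by
  have hx0 := transc_ne_zero hx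
  symm
  refine eq_of_dg ?_ ?_
  · intro Q
    by_cases hQ : P = Q
    swap
    · rw [Finsupp.single_eq_of_ne' hQ]
      exact poles_nonneg x Q
    subst hQ
    rw [Finsupp.single_eq_same, poles, Finsupp.sup_apply, dv_inv hx0, Finsupp.neg_apply, dv_apply hx0]
    rw [mem_iff_ord P hx0] at hP
    refine le_sup_of_le_left ?_
    omega
  · rw [dg_poles hx, dg_single, h, IntermediateField.finrank_top]
    rfl

theorem dv_poles {f : C} (hf : f ≠ 0) : dv k f = poles k f⁻¹ - poles k f := by
  ext P
  simp only [poles, dv_inv hf, inv_inv, Finsupp.coe_sub, Pi.sub_apply, Finsupp.sup_apply,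
    Finsupp.neg_apply, Finsupp.coe_zero, Pi.zero_apply]
  omega

theorem prin_of_rat {t : C} (ht : Transcendental k t) (h : k⟮t⟯ = ⊤) {D : Pl k C →₀ ℤ}
    (hD : dg D = 0) : D ∈ Pr k C := by
  obtain ⟨Q, hQ⟩ : ∃ Q : Pl k C, t ∉ Q.1 := by
    by_contra hcon
    push Not at hcon
    have h1 := dg_poles ht
    rw [h, IntermediateField.finrank_top] at h1
    have : poles k t = 0 := by
      ext P
      have := (mem_iff_ord P (transc_ne_zero ht)).mp (hcon P)
      simp only [poles, Finsupp.sup_apply, dv_inv (transc_ne_zero ht), Finsupp.neg_apply,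
        dv_apply (transc_ne_zero ht), Finsupp.coe_zero, Pi.zero_apply]
      omega
    rw [this] at h1
    simp at h1
  have key : ∀ P : Pl k C, Finsupp.single P (1 : ℤ) - Finsupp.single Q 1 ∈ Pr k C := by
    intro P
    by_cases hP : t ∈ P.1
    · obtain ⟨c, hc⟩ := P.exists_residue hP
      set x := t - algebraMap k C c with hx
      have htop : k⟮x⟯ = ⊤ := by
        rw [eq_top_iff, ← h, adjoin_simple_le_iff]
        have : t = x + algebraMap k C c := by rw [hx]; ring
        rw [this]
        exact add_mem (mem_adjoin_simple_self k x) (IntermediateField.algebraMap_mem _ c)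
      have htr : Transcendental k x := by
        rcases mem_range_or_transc (k := k) x with ⟨d, hd⟩ | h'
        · exfalso
          apply ht
          have : t = algebraMap k C (d + c) := by rw [map_add, hd, hx]; ring
          rw [this]
          exact isAlgebraic_algebraMap _
        · exact h'
      have hx0 := transc_ne_zero htr
      have h1 : poles k x = Finsupp.single Q 1 := poles_single htr htop (fun hm => hQ (by
        have : t = x + algebraMap k C c := by rw [hx]; ring
        rw [this]
        exact add_mem hm (Q.2.1 c)))
      have h2 : poles k x⁻¹ = Finsupp.single P 1 := poles_single (transc_inv htr) (by rw [adjoin_inv, htop]) (by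
        rw [mem_nonunits, mem_M' hx0] at hc
        rw [mem_iff_ord P (inv_ne_zero hx0), ord_inv P hx0]
        omega)
      exact mem_Pr.mpr ⟨x, hx0, by rw [dv_poles hx0, h1, h2]⟩
    · have h1 := poles_single ht h hP
      rw [poles_single ht h hQ] at h1
      rw [h1, sub_self]
      exact zero_mem _
  have key2 : ∀ D : Pl k C →₀ ℤ, D - dg D • Finsupp.single Q (1 : ℤ) ∈ Pr k C := by
    intro D
    induction D using Finsupp.induction_linear with
    | zero => simp
    | add D E hD hE =>
      have := add_mem hD hE
      rw [map_add, add_smul]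
      convert this using 1
      abel
    | single P n =>
      have := (Pr k C).zsmul_mem (key P) n
      rw [dg_single]
      convert this using 1
      simp only [smul_sub, Finsupp.smul_single, smul_eq_mul, mul_one]
  have := key2 D
  rwa [hD, zero_smul, sub_zero] at this

theorem pow_of_rat {t : C} (ht : Transcendental k t) (h : k⟮t⟯ = ⊤) {ℓ : ℕ} (hl : 0 < ℓ)
    {f : C} (hf : f ≠ 0) (hd : ∀ P : Pl k C, (ℓ : ℤ) ∣ ord P f) : ∃ g, g ^ ℓ = f := by
  set D : Pl k C →₀ ℤ := (dv k f).mapRange (fun n => n / (ℓ : ℤ)) (by simp) with hDdef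
  have hlD : ℓ • D = dv k f := by
    ext P
    rw [Finsupp.smul_apply, hDdef, Finsupp.mapRange_apply, dv_apply hf, nsmul_eq_mul]
    exact Int.mul_ediv_cancel' (hd P)
  have hD0 : dg D = 0 := by
    have := dg_dv (k := k) hf
    rw [← hlD, map_nsmul, nsmul_eq_mul] at this
    have hl' : (ℓ : ℤ) ≠ 0 := by exact_mod_cast hl.ne'
    exact (mul_eq_zero.mp this).resolve_left hl'
  obtain ⟨g, hg, hDg⟩ := mem_Pr.mp (prin_of_rat ht h hD0)
  have h0 : dv k (f * (g ^ ℓ)⁻¹) = 0 := by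
    rw [dv_mul hf (inv_ne_zero (pow_ne_zero _ hg)), dv_inv (pow_ne_zero _ hg), dv_pow hg, ← hDg, hlD,
      add_neg_cancel]
  obtain ⟨c, hc, hfc⟩ := const_of_dv (mul_ne_zero hf (inv_ne_zero (pow_ne_zero _ hg))) h0
  obtain ⟨d, rfl⟩ := IsAlgClosed.exists_pow_nat_eq c hl
  refine ⟨algebraMap k C d * g, ?_⟩
  rw [mul_pow, ← map_pow, ← hfc, mul_assoc, inv_mul_cancel₀ (pow_ne_zero _ hg), mul_one]

end JJ1
end RatCurve

open IntermediateField

namespace RatCurve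

section JJ2
set_option linter.unusedSectionVars false

theorem prim_rel {K E : Type*} [Field K] [Field E] [Algebra K E] (A : ValuationSubring K) {x : E}
    (hx : IsAlgebraic K x) : ∃ (p : Polynomial K) (j : ℕ), (∀ i, p.coeff i ∈ A) ∧ p.coeff j = 1 ∧
      (∀ i, j < i → p.coeff i ∈ A.nonunits) ∧ Polynomial.aeval x p = 0 := by
  obtain ⟨q, hq, hqx⟩ := hx
  have hne : q.support.Nonempty := Polynomial.support_nonempty.mpr hq
  obtain ⟨m, hm, hmax⟩ := Finset.exists_max_image q.support (fun i => A.valuation (q.coeff i)) hne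
  have hmax' : ∀ i, A.valuation (q.coeff i) ≤ A.valuation (q.coeff m) := by
    intro i
    by_cases hi : i ∈ q.support
    · exact hmax i hi
    · rw [Polynomial.notMem_support_iff.mp hi, map_zero]; exact zero_le
  let T := q.support.filter (fun i => A.valuation (q.coeff i) = A.valuation (q.coeff m))
  have hT : T.Nonempty := ⟨m, Finset.mem_filter.mpr ⟨hm, rfl⟩⟩
  set j := T.max' hT with hj
  have hjT : j ∈ T := Finset.max'_mem T hT
  obtain ⟨hjs, hjv⟩ := Finset.mem_filter.mp hjT
  have hj0 : q.coeff j ≠ 0 := Polynomial.mem_support_iff.mp hjs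
  have hv0 : 0 < A.valuation (q.coeff j) := by
    rw [zero_lt_iff, Valuation.ne_zero_iff]; exact hj0
  refine ⟨Polynomial.C (q.coeff j)⁻¹ * q, j, ?_, ?_, ?_, ?_⟩
  · intro i
    rw [Polynomial.coeff_C_mul, ← ValuationSubring.valuation_le_one_iff, map_mul, map_inv₀,
      inv_mul_le_one₀ hv0, hjv]
    exact hmax' i
  · rw [Polynomial.coeff_C_mul, inv_mul_cancel₀ hj0]
  · intro i hi
    rw [Polynomial.coeff_C_mul, ValuationSubring.mem_nonunits_iff, map_mul, map_inv₀,
      inv_mul_lt_one₀ hv0, hjv]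
    refine lt_of_le_of_ne (hmax' i) fun h => ?_
    have : i ∈ T := by
      refine Finset.mem_filter.mpr ⟨?_, h⟩
      rw [Polynomial.mem_support_iff]
      intro h0
      rw [h0, map_zero, ← hjv] at h
      exact hv0.ne h
    exact absurd (Finset.le_max' T i this) (not_le.mpr hi)
  · rw [map_mul, hqx, mul_zero]

variable {K E : Type*} [Field K] [Field E] [Algebra K E]

/-- intersection of all valuation rings over `A` -/
def IC (E : Type*) [Field E] [Algebra K E] (A : ValuationSubring K) : Subring E where
  carrier := {z | ∀ V : ValuationSubring E, (∀ a ∈ A, algebraMap K E a ∈ V) → z ∈ V}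
  mul_mem' ha hb V hV := V.mul_mem _ _ (ha V hV) (hb V hV)
  one_mem' V _ := V.one_mem
  add_mem' ha hb V hV := V.add_mem _ _ (ha V hV) (hb V hV)
  zero_mem' V _ := V.zero_mem
  neg_mem' ha V hV := V.neg_mem _ (ha V hV)

theorem mem_IC {A : ValuationSubring K} {z : E} : z ∈ IC E A ↔
    ∀ V : ValuationSubring E, (∀ a ∈ A, algebraMap K E a ∈ V) → z ∈ V := Iff.rfl

theorem val_lt {F : Type*} [Field F] (V : ValuationSubring F) {z : F} (hz : z ≠ 0) :
    V.valuation z < 1 ↔ z⁻¹ ∉ V := by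
  rw [← ValuationSubring.valuation_le_one_iff, map_inv₀, not_le, one_lt_inv₀ (by
    rw [zero_lt_iff, Valuation.ne_zero_iff]; exact hz)]

theorem comap_lt {O : ValuationSubring E} {x : K} :
    O.valuation (algebraMap K E x) < 1 ↔ x ∈ (O.comap (algebraMap K E)).nonunits := by
  by_cases hx : x = 0
  · simp [hx]
  rw [ValuationSubring.mem_nonunits_iff, val_lt O (by simpa using hx), val_lt _ hx,
    ValuationSubring.mem_comap, map_inv₀]

theorem frac_IC {A : ValuationSubring K} {O : ValuationSubring E}
    (hO : O.comap (algebraMap K E) = A) {x : E} (hx : IsAlgebraic K x) (hxO : x ∈ O) :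
    ∃ s, s ∈ IC E A ∧ s * x ∈ IC E A ∧ O.valuation s = 1 := by
  obtain ⟨p, j, h1, h2, h3, h4⟩ := prim_rel A hx
  by_cases hx0 : x = 0
  · exact ⟨1, one_mem _, by rw [hx0, mul_zero]; exact zero_mem _, map_one _⟩
  set N := p.natDegree with hN
  rw [Polynomial.aeval_eq_sum_range' (n := j + (N + 1)) (by omega), Finset.sum_range_add] at h4
  set s := ∑ i ∈ Finset.range (N + 1), p.coeff (j + i) • x ^ i with hs
  have e1 : ∑ i ∈ Finset.range (N + 1), p.coeff (j + i) • x ^ (j + i) = s * x ^ j := by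
    rw [hs, Finset.sum_mul]
    refine Finset.sum_congr rfl fun i _ => ?_
    rw [pow_add, smul_mul_assoc, mul_comm]
  rw [e1] at h4
  have hsx : s = - ∑ i ∈ Finset.range j, p.coeff i • (x⁻¹) ^ (j - i) := by
    have : s * x ^ j = - ∑ i ∈ Finset.range j, p.coeff i • x ^ i := by linear_combination h4
    rw [← mul_div_cancel_right₀ s (pow_ne_zero j hx0), this, neg_div, Finset.sum_div]
    congr 1
    refine Finset.sum_congr rfl fun i hi => ?_
    rw [smul_div_assoc]
    congr 1
    have hij : i < j := Finset.mem_range.mp hi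
    rw [inv_pow]
    refine eq_inv_of_mul_eq_one_left ?_
    rw [div_mul_eq_mul_div, ← pow_add,
      Nat.add_sub_cancel' hij.le, div_self (pow_ne_zero _ hx0)]
  have hsx2 : s * x = - ∑ i ∈ Finset.range j, p.coeff i • (x⁻¹) ^ (j - i - 1) := by
    rw [hsx, neg_mul, Finset.sum_mul]
    congr 1
    refine Finset.sum_congr rfl fun i hi => ?_
    have hij : i < j := Finset.mem_range.mp hi
    obtain ⟨m, hm⟩ : ∃ m, j - i = m + 1 := ⟨j - i - 1, by omega⟩
    rw [hm, pow_succ, smul_mul_assoc, mul_assoc, inv_mul_cancel₀ hx0, mul_one, Nat.add_sub_cancel]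
  have hsm : ∀ V : ValuationSubring E, (∀ a ∈ A, algebraMap K E a ∈ V) → ∀ a ∈ A, ∀ z ∈ V, ∀ n : ℕ,
      a • z ^ n ∈ V := by
    intro V hV a ha z hz n
    rw [Algebra.smul_def]
    exact mul_mem (hV a ha) (pow_mem hz n)
  have hsIC : s ∈ IC E A := by
    intro V hV
    rcases V.mem_or_inv_mem x with h | h
    · exact sum_mem fun i _ => hsm V hV _ (h1 _) _ h _
    · rw [hsx]
      exact neg_mem (sum_mem fun i _ => hsm V hV _ (h1 _) _ h _)
  refine ⟨s, hsIC, ?_, ?_⟩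
  · intro V hV
    rcases V.mem_or_inv_mem x with h | h
    · exact mul_mem (hsIC V hV) h
    · rw [hsx2]
      exact neg_mem (sum_mem fun i _ => hsm V hV _ (h1 _) _ h _)
  · rw [hs, Finset.sum_range_succ']
    simp only [add_zero, h2, pow_zero, one_smul]
    have hlt : O.valuation (∑ i ∈ Finset.range N, p.coeff (j + (i + 1)) • x ^ (i + 1)) < 1 := by
      refine Valuation.map_sum_lt _ one_ne_zero fun i _ => ?_
      rw [Algebra.smul_def, map_mul]
      have hc := h3 (j + (i + 1)) (by omega)
      have hxv : O.valuation (x ^ (i + 1)) ≤ 1 := (O.valuation_le_one_iff _).mpr (pow_mem hxO _)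
      refine lt_of_le_of_lt (mul_le_of_le_one_right' hxv) ?_
      rw [← hO] at hc
      exact comap_lt.mpr hc
    rw [Valuation.map_add_eq_of_lt_right _ (by rwa [map_one]), map_one]

end JJ2
end RatCurve

open IntermediateField

namespace RatCurve

section JJ3
set_option linter.unusedSectionVars false
variable {K E : Type*} [Field K] [Field E] [Algebra K E]

theorem smul_IC {A : ValuationSubring K} (σ : E ≃ₐ[K] E) {z : E} (hz : z ∈ IC E A) : σ z ∈ IC E A := by
  intro V hV
  have := hz (V.comap (σ : E →+* E)) (fun a ha => by
    rw [ValuationSubring.mem_comap]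
    simpa using hV a ha)
  exact this

instance actIC (A : ValuationSubring K) : MulSemiringAction (E ≃ₐ[K] E) (IC E A) where
  smul σ z := ⟨σ z.1, smul_IC σ z.2⟩
  one_smul _ := rfl
  mul_smul _ _ _ := rfl
  smul_zero σ := Subtype.ext (map_zero σ)
  smul_add σ a b := Subtype.ext (map_add σ _ _)
  smul_one σ := Subtype.ext (map_one σ)
  smul_mul σ a b := Subtype.ext (map_mul σ _ _)

theorem coe_smul_IC {A : ValuationSubring K} (σ : E ≃ₐ[K] E) (z : IC E A) : ((σ • z : IC E A) : E) = σ z := rfl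

/-- the prime of `IC` under a valuation ring -/
def primeIC (A : ValuationSubring K) (O : ValuationSubring E) (hO : O.comap (algebraMap K E) = A) :
    Ideal (IC E A) where
  carrier := {z | O.valuation z.1 < 1}
  zero_mem' := by simp
  add_mem' ha hb := lt_of_le_of_lt (O.valuation.map_add _ _) (max_lt ha hb)
  smul_mem' a b hb := by
    have h1 : O.valuation a.1 ≤ 1 := (O.valuation_le_one_iff _).mpr (a.2 O fun x hx => by
      rw [← hO] at hx; exact hx)
    change O.valuation (a.1 * b.1) < 1
    rw [map_mul]
    exact lt_of_le_of_lt (mul_le_of_le_one_left' h1) hb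

theorem mem_primeIC {A : ValuationSubring K} {O : ValuationSubring E} (hO : O.comap (algebraMap K E) = A)
    (z : IC E A) : z ∈ primeIC A O hO ↔ O.valuation z.1 < 1 := Iff.rfl

theorem IC_le {A : ValuationSubring K} {O : ValuationSubring E} (hO : O.comap (algebraMap K E) = A)
    {z : E} (hz : z ∈ IC E A) : O.valuation z ≤ 1 :=
  (O.valuation_le_one_iff _).mpr (hz O fun x hx => by rw [← hO] at hx; exact hx)

theorem primeIC_prime {A : ValuationSubring K} {O : ValuationSubring E}
    (hO : O.comap (algebraMap K E) = A) : (primeIC A O hO).IsPrime := by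
  refine Ideal.isPrime_iff.mpr ⟨?_, ?_⟩
  · rw [Ideal.ne_top_iff_one, mem_primeIC]
    simp
  · intro a b hab
    by_contra hcon
    push Not at hcon
    simp only [mem_primeIC, not_lt] at hcon hab
    have h1 := le_antisymm (IC_le hO a.2) hcon.1
    have h2 := le_antisymm (IC_le hO b.2) hcon.2
    have : O.valuation (a.1 * b.1) < 1 := hab
    rw [map_mul, h1, h2, mul_one] at this
    exact lt_irrefl _ this

theorem mem_of_primeIC [Algebra.IsAlgebraic K E] {A : ValuationSubring K} {O O₂ : ValuationSubring E}
    (hO : O.comap (algebraMap K E) = A) (hO₂ : O₂.comap (algebraMap K E) = A) {σ : E ≃ₐ[K] E}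
    (h : ∀ z ∈ IC E A, O₂.valuation (σ z) < 1 → O.valuation z < 1) {x : E} (hx : x ∈ O) : σ x ∈ O₂ := by
  obtain ⟨s, hs, hsx, hs1⟩ := frac_IC hO (Algebra.IsAlgebraic.isAlgebraic x) hx
  have h1 : O₂.valuation (σ s) = 1 := by
    refine le_antisymm (IC_le hO₂ (smul_IC σ hs)) ?_
    by_contra hlt
    push Not at hlt
    exact absurd (h s hs hlt) (by rw [hs1]; exact lt_irrefl _)
  have h2 := IC_le hO₂ (smul_IC σ hsx)
  rw [map_mul, map_mul, h1, one_mul] at h2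
  exact (O₂.valuation_le_one_iff _).mp h2

theorem val_trans [IsGalois K E] {O₁ O₂ : ValuationSubring E}
    (h : O₁.comap (algebraMap K E) = O₂.comap (algebraMap K E)) :
    ∃ σ : E ≃ₐ[K] E, ∀ x, σ x ∈ O₂ ↔ x ∈ O₁ := by
  set A := O₂.comap (algebraMap K E) with hA
  let B := IC E A
  let F := FixedPoints.subalgebra ℤ B (E ≃ₐ[K] E)
  have i1 : SMulCommClass (E ≃ₐ[K] E) F B := ⟨fun g a b => by
    change g • (a.1 * b) = a.1 * (g • b)
    rw [smul_mul', a.2 g]⟩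
  let _ : TopologicalSpace B := ⊥
  have i2 : DiscreteTopology B := ⟨rfl⟩
  have i3 : ContinuousSMul (E ≃ₐ[K] E) B := by
    rw [continuousSMul_iff_stabilizer_isOpen]
    intro x
    have := stabilizer_isOpen_of_isIntegral (K := K) x.1
    convert this using 1
    ext σ
    exact Subtype.ext_iff
  have i4 : Algebra.IsInvariant F B (E ≃ₐ[K] E) := ⟨fun b hb => ⟨⟨b, hb⟩, rfl⟩⟩
  have p1 := primeIC_prime h
  have p2 := primeIC_prime (O := O₂) (A := A) hA.symm
  obtain ⟨σ, hσ⟩ := Algebra.IsInvariant.exists_smul_of_under_eq_of_profinite (A := F) (B := B) (G := E ≃ₐ[K] E)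
    (primeIC A O₁ h) (primeIC A O₂ hA.symm) (by
      ext a
      obtain ⟨c, hc⟩ := (InfiniteGalois.mem_range_algebraMap_iff_fixed (k := K) (a.1.1 : E)).mpr
        (fun g => congrArg Subtype.val (a.2 g))
      change O₁.valuation (a.1.1 : E) < 1 ↔ O₂.valuation (a.1.1 : E) < 1
      rw [← hc, comap_lt, comap_lt, h])
  have key : ∀ z ∈ IC E A, (O₂.valuation (σ z) < 1 ↔ O₁.valuation z < 1) := by
    intro z hz
    have h1 : (σ • (⟨z, hz⟩ : B)) ∈ primeIC A O₂ hA.symm ↔ (⟨z, hz⟩ : B) ∈ primeIC A O₁ h := by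
      rw [hσ]
      exact Ideal.smul_mem_pointwise_smul_iff
    exact h1
  refine ⟨σ, fun x => ⟨fun hx => ?_, fun hx => ?_⟩⟩
  · have := mem_of_primeIC (σ := σ.symm) hA.symm h (fun z hz hlt => by
      have := (key _ (smul_IC σ.symm hz)).mpr hlt
      rwa [AlgEquiv.apply_symm_apply] at this) hx
    rwa [AlgEquiv.symm_apply_apply] at this
  · exact mem_of_primeIC h hA.symm (fun z hz hlt => (key z hz).mp hlt) hx

end JJ3
end RatCurve

open IntermediateField

namespace RatCurve

section JJ4
set_option linter.unusedSectionVars false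

theorem exists_over {K E : Type*} [Field K] [Field E] [Algebra K E] (A : ValuationSubring K) :
    ∃ O : ValuationSubring E, O.comap (algebraMap K E) = A := by
  obtain ⟨O, h, hl⟩ := IsLocalRing.exists_factor_valuationRing (R := A) ((algebraMap K E).comp (algebraMap A K))
  refine ⟨O, ?_⟩
  ext x
  rw [ValuationSubring.mem_comap]
  constructor
  · intro hx
    by_contra hxA
    have hx0 : x ≠ 0 := by rintro rfl; exact hxA A.zero_mem
    have hi : x⁻¹ ∈ A := (A.mem_or_inv_mem x).resolve_left hxA
    have hu : IsUnit (⟨x⁻¹, hi⟩ : A) := by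
      apply hl.map_nonunit
      refine IsUnit.of_mul_eq_one ⟨algebraMap K E x, hx⟩ ?_
      apply Subtype.ext
      change algebraMap K E x⁻¹ * algebraMap K E x = 1
      rw [← map_mul, inv_mul_cancel₀ hx0, map_one]
    obtain ⟨⟨b, hb⟩, hb1⟩ := hu.exists_right_inv
    have : x⁻¹ * b = 1 := congrArg Subtype.val hb1
    have hxb : x = b := by rw [inv_mul_eq_one₀ hx0] at this; exact this
    exact hxA (hxb ▸ hb)
  · intro hx
    exact h ⟨x, hx⟩

variable {k C : Type*} [Field k] [Field C] [Algebra k C] [FF k C] [IsAlgClosed k]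
variable {E : Type*} [Field E] [Algebra C E]

theorem over_const {P : Pl k C} {O : ValuationSubring E} (hO : O.comap (algebraMap C E) = P.1) {c : k}
    (hc : c ≠ 0) : O.valuation (algebraMap C E (algebraMap k C c)) = 1 := by
  refine le_antisymm ((O.valuation_le_one_iff _).mpr ?_) ?_
  · have : algebraMap k C c ∈ O.comap (algebraMap C E) := by rw [hO]; exact P.2.1 c
    exact this
  · by_contra h
    push Not at h
    rw [comap_lt, hO] at h
    exact hc (P.const_nonunit h)

theorem over_residue [Algebra.IsAlgebraic C E] {P : Pl k C} {O : ValuationSubring E}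
    (hO : O.comap (algebraMap C E) = P.1) {x : E} (hx : x ∈ O) :
    ∃ c : k, O.valuation (x - algebraMap C E (algebraMap k C c)) < 1 := by
  obtain ⟨p, j, h1, h2, h3, h4⟩ := prim_rel P.1 (Algebra.IsAlgebraic.isAlgebraic (R := C) x)
  choose c hc using fun i => P.exists_residue (h1 i)
  set φ : k →+* E := (algebraMap C E).comp (algebraMap k C) with hφ
  set N := j + p.natDegree + 1 with hN
  set q : Polynomial k := ∑ i ∈ Finset.range N, Polynomial.monomial i (c i) with hq
  have hcj : c j ≠ 0 := by
    intro h0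
    have := hc j
    rw [h0, h2, map_zero, sub_zero, mem_nonunits, mem_M' one_ne_zero, ord_one] at this
    omega
  have hq0 : q ≠ 0 := by
    intro h
    have : q.coeff j = c j := by
      rw [hq, Polynomial.finsetSum_coeff]
      simp only [Polynomial.coeff_monomial]
      rw [Finset.sum_ite_eq' (Finset.range N) j c, if_pos (Finset.mem_range.mpr (by omega))]
    rw [h, Polynomial.coeff_zero] at this
    exact hcj this.symm
  have hlt : O.valuation (q.eval₂ φ x) < 1 := by
    have e : q.eval₂ φ x = - ∑ i ∈ Finset.range N,
        algebraMap C E (p.coeff i - algebraMap k C (c i)) * x ^ i := by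
      rw [Polynomial.aeval_eq_sum_range' (n := N) (by omega)] at h4
      simp only [Algebra.smul_def] at h4
      simp only [map_sub, sub_mul, Finset.sum_sub_distrib, h4]
      rw [hq, Polynomial.eval₂_finsetSum]
      simp [hφ]
    rw [e, Valuation.map_neg]
    refine Valuation.map_sum_lt _ one_ne_zero fun i _ => ?_
    rw [map_mul]
    refine lt_of_le_of_lt (mul_le_of_le_one_right' ((O.valuation_le_one_iff _).mpr (pow_mem hx _))) ?_
    rw [comap_lt, hO]
    exact hc i
  rw [(IsAlgClosed.splits q).eq_prod_roots, Polynomial.eval₂_mul, Polynomial.eval₂_C, map_mul,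
    show O.valuation (φ q.leadingCoeff) = 1 from
      over_const hO (by simpa using hq0 : q.leadingCoeff ≠ 0), one_mul] at hlt
  generalize q.roots = s at hlt
  induction s using Multiset.induction_on with
  | empty => simp at hlt
  | cons r s ih =>
    rw [Multiset.map_cons, Multiset.prod_cons, Polynomial.eval₂_mul, map_mul] at hlt
    by_cases hr : O.valuation (x - φ r) < 1
    · exact ⟨r, hr⟩
    · apply ih
      have hle : O.valuation (x - φ r) ≤ 1 := by
        rw [ValuationSubring.valuation_le_one_iff]
        refine sub_mem hx ?_
        have : algebraMap k C r ∈ O.comap (algebraMap C E) := by rw [hO]; exact P.2.1 r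
        exact this
      have h1 : O.valuation (x - φ r) = 1 := le_antisymm hle (not_lt.mp hr)
      simpa [h1] using hlt

theorem inertia_of_decomp [Algebra.IsAlgebraic C E] {P : Pl k C} {O : ValuationSubring E}
    (hO : O.comap (algebraMap C E) = P.1) {σ : E ≃ₐ[C] E} (h : ∀ x, σ x ∈ O ↔ x ∈ O) :
    σ ∈ inertiaSubgroup O := by
  refine ⟨h, fun x hx => ?_⟩
  obtain ⟨c, hc⟩ := over_residue hO hx
  have hσ : ∀ z : E, O.valuation z < 1 → O.valuation (σ z) < 1 := by
    intro z hz
    by_cases hz0 : z = 0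
    · simp [hz0]
    rw [val_lt O (by simpa using hz0), ← map_inv₀, h]
    exact (val_lt O hz0).mp hz
  have h2 := hσ _ hc
  rw [map_sub, AlgEquiv.commutes] at h2
  have e : σ x - x = (σ x - algebraMap C E (algebraMap k C c)) - (x - algebraMap C E (algebraMap k C c)) := by ring
  rw [e]
  exact lt_of_le_of_lt (O.valuation.map_sub _ _) (max_lt h2 hc)

theorem over_ord {P : Pl k C} {O : ValuationSubring E} (hO : O.comap (algebraMap C E) = P.1) {a b : C}
    (ha : a ≠ 0) (hb : b ≠ 0) (h : O.valuation (algebraMap C E a) = O.valuation (algebraMap C E b)) :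
    ord P a = ord P b := by
  have key : ∀ {a b : C}, a ≠ 0 → b ≠ 0 → O.valuation (algebraMap C E a) = O.valuation (algebraMap C E b) →
      ord P b ≤ ord P a := by
    intro a b ha hb h
    have : a * b⁻¹ ∈ O.comap (algebraMap C E) := by
      rw [ValuationSubring.mem_comap, ← ValuationSubring.valuation_le_one_iff, map_mul, map_inv₀,
        map_mul, map_inv₀, h, mul_inv_cancel₀]
      rw [Valuation.ne_zero_iff]; simpa using hb
    rw [hO, mem_iff_ord P (mul_ne_zero ha (inv_ne_zero hb)), ord_mul P ha (inv_ne_zero hb), ord_inv P hb] at this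
    omega
  exact le_antisymm (key hb ha h.symm) (key ha hb h)

theorem ram_mem {P : Pl k C} {O : ValuationSubring E} (hO : O.comap (algebraMap C E) = P.1) {ℓ : ℕ}
    (hl : ℓ.Prime) {f : C} (hf : f ≠ 0) (hd : ¬ (ℓ : ℤ) ∣ ord P f) {y : E}
    (hy : y ^ ℓ = algebraMap C E f) (b : ℕ → C) :
    (∑ i ∈ Finset.range ℓ, algebraMap C E (b i) * y ^ i) ∈ O ↔
      ∀ i ∈ Finset.range ℓ, algebraMap C E (b i) * y ^ i ∈ O := by
  refine ⟨fun h => ?_, fun h => sum_mem h⟩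
  obtain ⟨m, hm, hmax⟩ := Finset.exists_max_image (Finset.range ℓ)
    (fun i => O.valuation (algebraMap C E (b i) * y ^ i)) ⟨0, Finset.mem_range.mpr hl.pos⟩
  have hv : O.valuation (∑ i ∈ Finset.range ℓ, algebraMap C E (b i) * y ^ i) =
      O.valuation (algebraMap C E (b m) * y ^ m) := by
    by_cases h0 : b m = 0
    · refine le_antisymm (Valuation.map_sum_le _ hmax) ?_
      rw [h0]; simp
    refine Valuation.map_sum_eq_of_lt _ hm fun i hi => ?_
    obtain ⟨hi1, hi2⟩ := Finset.mem_sdiff.mp hi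
    rw [Finset.mem_singleton] at hi2
    refine lt_of_le_of_ne (hmax i hi1) fun heq => ?_
    have hpow : ∀ i, (algebraMap C E (b i) * y ^ i) ^ ℓ = algebraMap C E (b i ^ ℓ * f ^ i) := by
      intro i
      rw [mul_pow, ← pow_mul, mul_comm i ℓ, pow_mul, hy, map_mul, map_pow, map_pow]
    have hy0 : y ≠ 0 := by
      rintro rfl
      rw [zero_pow hl.ne_zero] at hy
      exact hf ((map_eq_zero (algebraMap C E)).mp hy.symm)
    have hbi : b i ≠ 0 := by
      intro hbi
      rw [hbi, map_zero, zero_mul, map_zero] at heq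
      have := (Valuation.zero_iff _).mp heq.symm
      exact (mul_ne_zero ((map_ne_zero (algebraMap C E)).mpr h0) (pow_ne_zero m hy0)) this
    have h5 : O.valuation (algebraMap C E (b i ^ ℓ * f ^ i)) = O.valuation (algebraMap C E (b m ^ ℓ * f ^ m)) := by
      rw [← hpow, ← hpow, map_pow, map_pow, heq]
    have h6 := over_ord hO (mul_ne_zero (pow_ne_zero _ hbi) (pow_ne_zero _ hf))
      (mul_ne_zero (pow_ne_zero _ h0) (pow_ne_zero _ hf)) h5
    rw [ord_mul P (pow_ne_zero _ hbi) (pow_ne_zero _ hf), ord_mul P (pow_ne_zero _ h0) (pow_ne_zero _ hf),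
      ord_pow P hbi, ord_pow P h0, ord_pow P hf, ord_pow P hf] at h6
    have h7 : (ℓ : ℤ) ∣ ((i : ℤ) - m) * ord P f := ⟨ord P (b m) - ord P (b i), by linear_combination h6⟩
    rcases (Nat.prime_iff_prime_int.mp hl).dvd_or_dvd h7 with h8 | h8
    · have hm' := Finset.mem_range.mp hm
      have hi' := Finset.mem_range.mp hi1
      have := Int.eq_zero_of_abs_lt_dvd h8 (by rw [abs_lt]; constructor <;> omega)
      omega
    · exact hd h8
  intro i hi
  rw [← ValuationSubring.valuation_le_one_iff] at h ⊢
  exact (hmax i hi).trans (hv ▸ h)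

theorem ram_stable {P : Pl k C} {O : ValuationSubring E} (hO : O.comap (algebraMap C E) = P.1) {ℓ : ℕ}
    (hl : ℓ.Prime) {f : C} (hf : f ≠ 0) (hd : ¬ (ℓ : ℤ) ∣ ord P f) {y : E}
    (hy : y ^ ℓ = algebraMap C E f) {ζ : k} (hζ : ζ ≠ 0) {τ : E ≃ₐ[C] E}
    (hτ : τ y = algebraMap C E (algebraMap k C ζ) * y) {z : E} (hz : z ∈ C⟮y⟯) : τ z ∈ O ↔ z ∈ O := by
  have hmon := Polynomial.monic_X_pow_sub_C f hl.ne_zero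
  have hint : IsIntegral C y := ⟨_, hmon, by simp [hy]⟩
  obtain ⟨g, hg⟩ : ∃ g : Polynomial C, Polynomial.aeval y g = z := by
    have : z ∈ Algebra.adjoin C {y} := by
      rw [← IntermediateField.adjoin_simple_toSubalgebra_of_isAlgebraic hint.isAlgebraic]
      exact hz
    rwa [Algebra.adjoin_singleton_eq_range_aeval] at this
  set r := g %ₘ (Polynomial.X ^ ℓ - Polynomial.C f) with hr
  have hr1 : Polynomial.aeval y r = z := by
    rw [hr, Polynomial.aeval_modByMonic_eq_self_of_root (by simp [hy]), hg]
  have hdeg : r.natDegree < ℓ := by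
    have := Polynomial.natDegree_modByMonic_lt g hmon (by
      intro h
      have := congrArg Polynomial.natDegree h
      rw [Polynomial.natDegree_X_pow_sub_C, Polynomial.natDegree_one] at this
      exact hl.ne_zero this)
    rwa [Polynomial.natDegree_X_pow_sub_C] at this
  rw [Polynomial.aeval_eq_sum_range' hdeg] at hr1
  simp only [Algebra.smul_def] at hr1
  have h2 : τ z = ∑ i ∈ Finset.range ℓ, algebraMap C E (r.coeff i * algebraMap k C (ζ ^ i)) * y ^ i := by
    rw [← hr1, map_sum]
    refine Finset.sum_congr rfl fun i _ => ?_
    rw [map_mul, AlgEquiv.commutes, map_pow, hτ, mul_pow, map_mul, map_pow, map_pow]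
    ring
  rw [h2, ← hr1, ram_mem hO hl hf hd hy, ram_mem hO hl hf hd hy]
  refine forall₂_congr fun i _ => ?_
  rw [← ValuationSubring.valuation_le_one_iff, ← ValuationSubring.valuation_le_one_iff, map_mul, map_mul,
    map_mul, map_mul, over_const hO (pow_ne_zero i hζ), mul_one]

end JJ4
end RatCurve

open IntermediateField

namespace RatCurve

section JJ5
set_option linter.unusedSectionVars false

/-- elements with abelian, `ℓ`-primary orbits -/
def abT (ℓ : ℕ) (K A : Type*) [Field K] [Field A] [Algebra K A] : IntermediateField K A where
  carrier := {x | (∀ σ : A ≃ₐ[K] A, ∃ N : ℕ, (σ ^ (ℓ ^ N)) x = x) ∧ ∀ σ τ : A ≃ₐ[K] A, σ (τ x) = τ (σ x)}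
  mul_mem' := by
    rintro a b ⟨ha, ha2⟩ ⟨hb, hb2⟩
    refine ⟨fun σ => ?_, fun σ τ => by simp [ha2 σ τ, hb2 σ τ]⟩
    obtain ⟨m, hm⟩ := ha σ
    obtain ⟨n, hn⟩ := hb σ
    refine ⟨m + n, ?_⟩
    have h1 : (σ ^ (ℓ ^ (m + n))) a = a := by
      rw [pow_add, pow_mul]
      exact (MulAction.stabilizer (A ≃ₐ[K] A) a).pow_mem hm _
    have h2 : (σ ^ (ℓ ^ (m + n))) b = b := by
      rw [add_comm, pow_add, pow_mul]
      exact (MulAction.stabilizer (A ≃ₐ[K] A) b).pow_mem hn _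
    rw [map_mul, h1, h2]
  add_mem' := by
    rintro a b ⟨ha, ha2⟩ ⟨hb, hb2⟩
    refine ⟨fun σ => ?_, fun σ τ => by simp [ha2 σ τ, hb2 σ τ]⟩
    obtain ⟨m, hm⟩ := ha σ
    obtain ⟨n, hn⟩ := hb σ
    refine ⟨m + n, ?_⟩
    have h1 : (σ ^ (ℓ ^ (m + n))) a = a := by
      rw [pow_add, pow_mul]
      exact (MulAction.stabilizer (A ≃ₐ[K] A) a).pow_mem hm _
    have h2 : (σ ^ (ℓ ^ (m + n))) b = b := by
      rw [add_comm, pow_add, pow_mul]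
      exact (MulAction.stabilizer (A ≃ₐ[K] A) b).pow_mem hn _
    rw [map_add, h1, h2]
  algebraMap_mem' r := ⟨fun σ => ⟨0, AlgEquiv.commutes _ r⟩, fun σ τ => by simp⟩
  inv_mem' := by
    rintro a ⟨ha, ha2⟩
    refine ⟨fun σ => ?_, fun σ τ => by simp [ha2 σ τ]⟩
    obtain ⟨m, hm⟩ := ha σ
    exact ⟨m, by rw [map_inv₀, hm]⟩

theorem proLab_le_abT {ℓ : ℕ} (hl : ℓ.Prime) {K : Type*} [Field K] :
    proLab ℓ K ≤ abT ℓ K (AlgebraicClosure K) := by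
  refine iSup₂_le fun L hL => ?_
  obtain ⟨h1, ⟨n, hn⟩, h3⟩ := hL
  have hfd : FiniteDimensional K L := Module.finite_of_finrank_pos (by rw [hn]; exact pow_pos hl.pos n)
  have key : ∀ (σ : AlgebraicClosure K ≃ₐ[K] AlgebraicClosure K) (x : L),
      σ x.1 = (AlgEquiv.restrictNormalHom L σ x).1 := fun σ x => (σ.restrictNormal_commutes L x).symm
  intro x hx
  refine ⟨fun σ => ⟨n, ?_⟩, fun σ τ => ?_⟩
  · refine (key _ ⟨x, hx⟩).trans ?_
    have hc : Nat.card (L ≃ₐ[K] L) = ℓ ^ n := by rw [IsGalois.card_aut_eq_finrank, hn]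
    rw [map_pow, ← hc, pow_card_eq_one']
    rfl
  · have e1 := key τ ⟨x, hx⟩
    have e2 := key σ ⟨x, hx⟩
    simp only at e1 e2
    rw [e1, e2, key, key]
    congr 1
    exact DFunLike.congr_fun (h3 (AlgEquiv.restrictNormalHom L σ) (AlgEquiv.restrictNormalHom L τ)) _

theorem proLab_orbit {ℓ : ℕ} (hl : ℓ.Prime) {K : Type*} [Field K] (x : proLab ℓ K) :
    (∀ σ : GalLab ℓ K, ∃ N : ℕ, (σ ^ (ℓ ^ N)) x = x) ∧ ∀ σ τ : GalLab ℓ K, σ (τ x) = τ (σ x) := by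
  obtain ⟨h1, h2⟩ := proLab_le_abT hl x.2
  have key : ∀ (σ : AlgebraicClosure K ≃ₐ[K] AlgebraicClosure K) (x : proLab ℓ K),
      (AlgEquiv.restrictNormalHom (proLab ℓ K) σ x).1 = σ x.1 :=
    fun σ x => σ.restrictNormal_commutes (proLab ℓ K) x
  have hs := AlgEquiv.restrictNormalHom_surjective (F := K) (K₁ := proLab ℓ K) (AlgebraicClosure K)
  refine ⟨fun σ => ?_, fun σ τ => ?_⟩
  · obtain ⟨σ, rfl⟩ := hs σ
    obtain ⟨N, hN⟩ := h1 σ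
    refine ⟨N, Subtype.val_injective ?_⟩
    rw [← map_pow, key, hN]
  · obtain ⟨σ, rfl⟩ := hs σ
    obtain ⟨τ, rfl⟩ := hs τ
    apply Subtype.val_injective
    rw [key, key, key, key, h2]

theorem exists_kummer_fin {ℓ : ℕ} (hl : ℓ.Prime) {K F : Type*} [Field K] [Field F] [Algebra K F]
    [FiniteDimensional K F] [IsGalois K F] (hK : (primitiveRoots ℓ K).Nonempty)
    (hcommF : ∀ σ τ : F ≃ₐ[K] F, σ * τ = τ * σ) (m : ℕ) (hn : Nat.card (F ≃ₐ[K] F) = ℓ ^ (m + 1)) :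
    ∃ y : F, y ∉ Set.range (algebraMap K F) ∧ ∃ f : K, y ^ ℓ = algebraMap K F f := by
  have hfl : Fact ℓ.Prime := ⟨hl⟩
  obtain ⟨H, hH⟩ := Sylow.exists_subgroup_card_pow_prime (G := F ≃ₐ[K] F) ℓ (n := m)
    (by rw [hn]; exact pow_dvd_pow _ (Nat.le_succ m))
  have hHn : H.Normal := ⟨fun a ha g => by rw [hcommF g a, mul_inv_cancel_right]; exact ha⟩
  have hgL : IsGalois K (IntermediateField.fixedField H) := IsGalois.of_fixedField_normal_subgroup H
  have h1 := IntermediateField.finrank_fixedField_eq_card H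
  generalize IntermediateField.fixedField H = L at hgL h1
  have hfr : Module.finrank K L = ℓ := by
    have h2 := Module.finrank_mul_finrank K L F
    rw [h1, hH, ← IsGalois.card_aut_eq_finrank K F, hn, pow_succ'] at h2
    exact Nat.eq_of_mul_eq_mul_right (pow_pos hl.pos m) h2
  have hcyc : IsCyclic (L ≃ₐ[K] L) := isCyclic_of_prime_card (p := ℓ) (by
    rw [IsGalois.card_aut_eq_finrank, hfr])
  obtain ⟨β, ⟨f, hf⟩, hβ⟩ := exists_root_adjoin_eq_top_of_isCyclic K L (by rwa [hfr])
  rw [hfr] at hf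
  refine ⟨β.1, ?_, f, ?_⟩
  · rintro ⟨c, hc⟩
    have : β = algebraMap K L c := by
      apply Subtype.val_injective
      exact hc.symm
    have hbot : K⟮β⟯ = ⊥ := by
      rw [IntermediateField.adjoin_simple_eq_bot_iff, this]
      exact IntermediateField.algebraMap_mem _ _
    have h1 : Module.finrank K L = 1 := by
      rw [← IntermediateField.finrank_top' (F := K) (E := L), ← hβ, hbot, IntermediateField.finrank_bot]
    rw [hfr] at h1
    exact hl.ne_one h1
  · have := congrArg (fun x : L => x.1) hf
    exact this.symm

theorem exists_kummer {ℓ : ℕ} (hl : ℓ.Prime) {K : Type*} [Field K] (hK : (primitiveRoots ℓ K).Nonempty)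
    {α : proLab ℓ K} (hα : α ∉ (⊥ : IntermediateField K (proLab ℓ K))) :
    ∃ y ∈ K⟮α⟯, y ∉ (⊥ : IntermediateField K (proLab ℓ K)) ∧ ∃ f : K, y ^ ℓ = algebraMap K _ f := by
  have hfl : Fact ℓ.Prime := ⟨hl⟩
  have hint : IsIntegral K α := Algebra.IsIntegral.isIntegral α
  have hfd : FiniteDimensional K K⟮α⟯ := IntermediateField.adjoin.finiteDimensional hint
  have hcomm : ∀ σ τ : GalLab ℓ K, σ * τ = τ * σ := fun σ τ =>
    AlgEquiv.ext fun x => (proLab_orbit hl x).2 σ τ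
  have hgal : IsGalois K K⟮α⟯ := by
    rw [← InfiniteGalois.normal_iff_isGalois]
    refine ⟨fun n hn g => ?_⟩
    rw [hcomm g n, mul_inv_cancel_right]
    exact hn
  have hs := AlgEquiv.restrictNormalHom_surjective (F := K) (K₁ := K⟮α⟯) (proLab ℓ K)
  have key : ∀ (σ : GalLab ℓ K) (x : K⟮α⟯), (AlgEquiv.restrictNormalHom K⟮α⟯ σ x).1 = σ x.1 :=
    fun σ x => σ.restrictNormal_commutes K⟮α⟯ x
  have hcommF : ∀ σ τ : K⟮α⟯ ≃ₐ[K] K⟮α⟯, σ * τ = τ * σ := by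
    intro σ τ
    obtain ⟨σ, rfl⟩ := hs σ
    obtain ⟨τ, rfl⟩ := hs τ
    rw [← map_mul, hcomm, map_mul]
  have hp : IsPGroup ℓ (K⟮α⟯ ≃ₐ[K] K⟮α⟯) := by
    intro σ
    obtain ⟨σ, rfl⟩ := hs σ
    obtain ⟨N, hN⟩ := (proLab_orbit hl α).1 σ
    refine ⟨N, ?_⟩
    rw [← map_pow]
    have h1 : K⟮α⟯ ≤ IntermediateField.fixedField (Subgroup.zpowers (σ ^ ℓ ^ N)) := by
      rw [adjoin_simple_le_iff, IntermediateField.mem_fixedField_iff]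
      intro τ hτ
      have h2 : Subgroup.zpowers (σ ^ ℓ ^ N) ≤ MulAction.stabilizer (GalLab ℓ K) α := by
        rw [Subgroup.zpowers_le]
        exact hN
      exact h2 hτ
    refine AlgEquiv.ext fun x => Subtype.val_injective ((key _ x).trans ?_)
    exact (IntermediateField.mem_fixedField_iff _ _).mp (h1 x.2) _ (Subgroup.mem_zpowers _)
  obtain ⟨n, hn⟩ := IsPGroup.iff_card.mp hp
  have hn0 : n ≠ 0 := by
    rintro rfl
    rw [pow_zero, IsGalois.card_aut_eq_finrank, IntermediateField.finrank_eq_one_iff] at hn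
    exact hα (hn ▸ mem_adjoin_simple_self K α)
  obtain ⟨m, rfl⟩ := Nat.exists_eq_succ_of_ne_zero hn0
  obtain ⟨y, hy, f, hf⟩ := exists_kummer_fin hl hK hcommF m hn
  refine ⟨y.1, y.2, ?_, f, congrArg Subtype.val hf⟩
  intro hb
  obtain ⟨c, hc⟩ := IntermediateField.mem_bot.mp hb
  exact hy ⟨c, Subtype.val_injective hc⟩

variable {k C : Type*} [Field k] [Field C] [Algebra k C] [FF k C] [IsAlgClosed k]

theorem gen_of_rat (ℓ p : ℕ) [Fact ℓ.Prime] [Fact p.Prime] (hpℓ : p ≠ ℓ) [CharP k p]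
    (htd : trdeg k C = 1) (hrat : ∃ t : C, Transcendental k t ∧ IntermediateField.adjoin k {t} = ⊤) :
    closure ((Subgroup.closure {σ : GalLab ℓ C |
          ∃ O' : ValuationSubring ↥(proLab ℓ C),
            IsZPD k (O'.comap (algebraMap C ↥(proLab ℓ C))) ∧
            σ ∈ inertiaSubgroup O'} : Subgroup (GalLab ℓ C)) : Set (GalLab ℓ C)) =
        Set.univ := by
  obtain ⟨t, ht, htop⟩ := hrat
  have hl : ℓ.Prime := Fact.out
  have hnl := NeZero.mk hl.ne_zero
  have hne : NeZero (ℓ : k) := ⟨fun h => hpℓ <| by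
    rw [CharP.cast_eq_zero_iff k p] at h
    exact (Nat.prime_dvd_prime_iff_eq Fact.out Fact.out).mp h⟩
  obtain ⟨ζ, hζ⟩ := HasEnoughRootsOfUnity.exists_primitiveRoot k ℓ
  set S : Set (GalLab ℓ C) := {σ : GalLab ℓ C |
          ∃ O' : ValuationSubring ↥(proLab ℓ C),
            IsZPD k (O'.comap (algebraMap C ↥(proLab ℓ C))) ∧
            σ ∈ inertiaSubgroup O'} with hS
  let H : ClosedSubgroup (GalLab ℓ C) := ⟨(Subgroup.closure S).topologicalClosure,
    Subgroup.isClosed_topologicalClosure _⟩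
  have hSH : S ⊆ (H : Set (GalLab ℓ C)) := fun σ hσ =>
    Subgroup.le_topologicalClosure _ (Subgroup.subset_closure hσ)
  have hfix := InfiniteGalois.fixingSubgroup_fixedField H
  suffices hbot : IntermediateField.fixedField (H : Subgroup (GalLab ℓ C)) = ⊥ by
    rw [hbot, IntermediateField.fixingSubgroup_bot] at hfix
    rw [← Subgroup.topologicalClosure_coe]
    change ((H : Subgroup (GalLab ℓ C)) : Set (GalLab ℓ C)) = Set.univ
    rw [← hfix]
    rfl
  rw [eq_bot_iff]
  intro α hαM
  by_contra hα
  have hζC := hζ.map_of_injective (algebraMap k C).injective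
  have hζE := hζC.map_of_injective (algebraMap C (proLab ℓ C)).injective
  obtain ⟨y, hyα, hy, f, hyf⟩ := exists_kummer hl ⟨algebraMap k C ζ, by
    rw [mem_primitiveRoots hl.pos]; exact hζC⟩ hα
  have hyM : y ∈ IntermediateField.fixedField (H : Subgroup (GalLab ℓ C)) :=
    (adjoin_simple_le_iff.mpr hαM) hyα
  have hy0 : y ≠ 0 := by rintro rfl; exact hy (zero_mem _)
  have hf0 : f ≠ 0 := by
    rintro rfl
    rw [map_zero] at hyf
    exact hy0 (eq_zero_of_pow_eq_zero hyf)
  have root : ∀ z : proLab ℓ C, z ^ ℓ = y ^ ℓ → ∃ i : ℕ, z = algebraMap C _ (algebraMap k C (ζ ^ i)) * y := by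
    intro z hz
    obtain ⟨i, -, hi⟩ := hζE.eq_pow_of_pow_eq_one (ξ := z / y) (by
      rw [div_pow, hz, div_self (pow_ne_zero _ hy0)])
    exact ⟨i, by rw [map_pow, map_pow, hi, div_mul_cancel₀ _ hy0]⟩
  obtain ⟨P, hP⟩ : ∃ P : Pl k C, ¬ (ℓ : ℤ) ∣ ord P f := by
    by_contra hcon
    push Not at hcon
    obtain ⟨g, hg⟩ := pow_of_rat ht htop hl.pos hf0 hcon
    obtain ⟨i, hi⟩ := root (algebraMap C _ g) (by rw [← map_pow, hg, hyf])
    apply hy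
    have hz0 : algebraMap C (proLab ℓ C) (algebraMap k C (ζ ^ i)) ≠ 0 :=
      (map_ne_zero _).mpr ((map_ne_zero _).mpr (pow_ne_zero _ (hζ.ne_zero hl.ne_zero)))
    have : y = algebraMap C _ ((algebraMap k C (ζ ^ i))⁻¹ * g) := by
      rw [map_mul, hi, map_inv₀, inv_mul_cancel_left₀ hz0]
    rw [this]
    exact IntermediateField.algebraMap_mem _ _
  obtain ⟨O, hO⟩ := exists_over (E := proLab ℓ C) P.1
  obtain ⟨τ, hτ⟩ : ∃ τ : GalLab ℓ C, τ y ≠ y := by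
    by_contra hcon
    push Not at hcon
    exact hy ((InfiniteGalois.mem_bot_iff_fixed y).mpr hcon)
  obtain ⟨i, hi⟩ := root (τ y) (by rw [← map_pow, hyf, AlgEquiv.commutes])
  obtain ⟨σ, hσ⟩ := val_trans (K := C⟮y⟯) (O₁ := O) (O₂ := O.comap (τ : proLab ℓ C →+* proLab ℓ C)) (by
    ext z
    rw [ValuationSubring.mem_comap, ValuationSubring.mem_comap, ValuationSubring.mem_comap]
    exact (ram_stable hO hl hf0 hP hyf (pow_ne_zero i (hζ.ne_zero hl.ne_zero)) hi z.2).symm)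
  let σ' : GalLab ℓ C := σ.restrictScalars C
  have hmem : τ * σ' ∈ S := by
    refine ⟨O, ?_, inertia_of_decomp hO hσ⟩
    rw [hO]
    exact isZPD_of htd P
  have h1 := (IntermediateField.mem_fixedField_iff _ _).mp hyM _ (hSH hmem)
  have h2 : σ' y = y := σ.commutes ⟨y, mem_adjoin_simple_self C y⟩
  apply hτ
  rw [AlgEquiv.mul_apply, h2] at h1
  exact h1

end JJ5
end RatCurve

/-- A function field `C|k` of transcendence degree 1 over an algebraic
closure of a finite field of characteristic `p ≠ ℓ` is rational (i.e. `C = k(t)`) if and only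
if the inertia subgroups of (prolongations of) the Zariski prime divisors of `C|k`
topologically generate `G^{ℓ,ab}_C`. -/
theorem statement14 (ℓ p : ℕ) [Fact ℓ.Prime] [Fact p.Prime] (hpℓ : p ≠ ℓ)
    (k C : Type*) [Field k] [Field C] [Algebra k C]
    [IsAlgClosed k] [CharP k p] (hkfin : Algebra.IsAlgebraic (⊥ : Subfield k) k)
    (hCfg : (⊤ : IntermediateField k C).FG) (htd : trdeg k C = 1) :
    (∃ t : C, Transcendental k t ∧ IntermediateField.adjoin k {t} = ⊤) ↔
      closure ((Subgroup.closure {σ : GalLab ℓ C |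
          ∃ O' : ValuationSubring ↥(proLab ℓ C),
            IsZPD k (O'.comap (algebraMap C ↥(proLab ℓ C))) ∧
            σ ∈ inertiaSubgroup O'} : Subgroup (GalLab ℓ C)) : Set (GalLab ℓ C)) =
        Set.univ := by
  have := RatCurve.FF_of hCfg htd
  exact ⟨fun h => RatCurve.gen_of_rat ℓ p hpℓ htd h,
    fun h => RatCurve.rat_of_gen ℓ p hpℓ hkfin hCfg h⟩
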